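/- Let G be a connected tricyclic graph of order n ≥ 29. Then Sz*(G) ≤ B(n), where B(n) = (n³ + 2n² − 16)/4 if n is even and B(n) = (n³ + 2n² − 18)/4 if n is odd, and equality holds if and only if G is isomorphic to F_n. -/

import Mathlib

attribute [local instance] Classical.propDecidable

noncomputable def nC {V : Type*} [Fintype V] (G : SimpleGraph V) (u v : V) : ℕ :=
  (Finset.univ.filter fun w => G.dist u w < G.dist v w).card

noncomputable def nE {V : Type*} [Fintype V] (G : SimpleGraph V) (u v : V) : ℕ :=
  (Finset.univ.filter fun w => G.dist u w = G.dist v w).card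

lemma nE_comm {V : Type*} [Fintype V] (G : SimpleGraph V) (u v : V) :
    nE G u v = nE G v u := by
  unfold nE; congr 1; ext w; simp [eq_comm]

noncomputable def szContrib {V : Type*} [Fintype V] (G : SimpleGraph V) : Sym2 V → ℚ :=
  Sym2.lift ⟨fun u v =>
    ((nC G u v : ℚ) + (nE G u v : ℚ) / 2) * ((nC G v u : ℚ) + (nE G u v : ℚ) / 2),
    fun u v => by dsimp only; rw [nE_comm]; ring⟩

noncomputable def revSz {V : Type*} [Fintype V] (G : SimpleGraph V) : ℚ :=
  ∑ e ∈ G.edgeFinset, szContrib G e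
/-- Two paths are internally disjoint if every common vertex is an endpoint of both. -/
def IntDisj {V : Type*} {G : SimpleGraph V} {x y x' y' : V}
    (P : G.Walk x y) (Q : G.Walk x' y') : Prop :=
  ∀ v : V, v ∈ P.support → v ∈ Q.support → (v = x ∨ v = y) ∧ (v = x' ∨ v = y')
/-- `G` consists of the four distinct vertices `w, y, x, z`, two internally disjoint
paths `Q₁, Q₂` joining `w` and `y`, two internally disjoint paths `R₁, R₂` joining
`x` and `z`, a path `S` joining `w` and `x`, and a path `T` joining `y` and `z`,
all pairwise internally disjoint, every vertex and every edge of `G` lying on one of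
these paths. -/
def Theta3Cond {V : Type*} (G : SimpleGraph V) (w y x z : V)
    (Q₁ Q₂ : G.Walk w y) (R₁ R₂ : G.Walk x z) (S : G.Walk w x) (T : G.Walk y z) : Prop :=
  w ≠ y ∧ w ≠ x ∧ w ≠ z ∧ y ≠ x ∧ y ≠ z ∧ x ≠ z ∧
  Q₁.IsPath ∧ Q₂.IsPath ∧ R₁.IsPath ∧ R₂.IsPath ∧ S.IsPath ∧ T.IsPath ∧
  Q₁ ≠ Q₂ ∧ R₁ ≠ R₂ ∧
  IntDisj Q₁ Q₂ ∧ IntDisj Q₁ R₁ ∧ IntDisj Q₁ R₂ ∧ IntDisj Q₁ S ∧ IntDisj Q₁ T ∧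
  IntDisj Q₂ R₁ ∧ IntDisj Q₂ R₂ ∧ IntDisj Q₂ S ∧ IntDisj Q₂ T ∧
  IntDisj R₁ R₂ ∧ IntDisj R₁ S ∧ IntDisj R₁ T ∧
  IntDisj S T ∧ IntDisj R₂ S ∧ IntDisj R₂ T ∧
  (∀ v : V, v ∈ Q₁.support ∨ v ∈ Q₂.support ∨ v ∈ R₁.support ∨ v ∈ R₂.support ∨
    v ∈ S.support ∨ v ∈ T.support) ∧
  (∀ e ∈ G.edgeSet, e ∈ Q₁.edges ∨ e ∈ Q₂.edges ∨ e ∈ R₁.edges ∨ e ∈ R₂.edges ∨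
    e ∈ S.edges ∨ e ∈ T.edges)

/-- `G` is a Θ₃-graph. -/
def IsTheta3 {V : Type*} (G : SimpleGraph V) : Prop :=
  ∃ (w y x z : V) (Q₁ Q₂ : G.Walk w y) (R₁ R₂ : G.Walk x z) (S : G.Walk w x)
    (T : G.Walk y z), Theta3Cond G w y x z Q₁ Q₂ R₁ R₂ S T

/-- `G` is the Θ₃-graph in which the two paths joining `w` and `y` have length 2,
the two paths joining `x` and `z` have length 2, the path joining `w` and `x` has
length `a` and the path joining `y` and `z` has length `b`, where `a + b + 6 = n`,
`0 < a`, and `b = a + 2` if `n` is even, `b = a + 3` if `n` is odd; i.e. `G ≅ Fₙ`. -/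
def IsFGraph {V : Type*} (n : ℕ) (G : SimpleGraph V) : Prop :=
  ∃ (a b : ℕ), 0 < a ∧ 0 < b ∧ a + b + 6 = n ∧
    (if Even n then b = a + 2 else b = a + 3) ∧
    ∃ (w y x z : V) (Q₁ Q₂ : G.Walk w y) (R₁ R₂ : G.Walk x z) (S : G.Walk w x)
      (T : G.Walk y z), Theta3Cond G w y x z Q₁ Q₂ R₁ R₂ S T ∧
      Q₁.length = 2 ∧ Q₂.length = 2 ∧ R₁.length = 2 ∧ R₂.length = 2 ∧
      S.length = a ∧ T.length = b

namespace RevSz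
open Finset

set_option linter.unusedSectionVars false

section
variable {V : Type*} [Fintype V] {G : SimpleGraph V}

/-- The neighbours of `v`. -/
noncomputable def nb (G : SimpleGraph V) (v : V) : Finset V := univ.filter (G.Adj v)

/-- The transmission (sum of distances) of a vertex. -/
noncomputable def tr (G : SimpleGraph V) (v : V) : ℤ := ∑ z, (G.dist v z : ℤ)

/-- The sum of the squared transmission differences over all arcs. -/
noncomputable def energy (G : SimpleGraph V) : ℤ := ∑ v, ∑ u ∈ nb G v, (tr G u - tr G v) ^ 2

/-- The discrete curvature at `y` of the distance function from `z`. -/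
noncomputable def curv (G : SimpleGraph V) (y z : V) : ℤ :=
  ∑ u ∈ nb G y, ((G.dist y z : ℤ) - G.dist u z)

/-- The number of edges with an end in `A`. -/
noncomputable def incE (G : SimpleGraph V) (A : Finset V) : ℕ :=
  (G.edgeFinset.filter fun e => ∃ a ∈ A, a ∈ e).card

/-- The number of edges leaving `A`. -/
noncomputable def bdry (G : SimpleGraph V) (A : Finset V) : ℕ :=
  ∑ a ∈ A, ((nb G a).filter (· ∉ A)).card

@[simp] lemma mem_nb {v u : V} : u ∈ nb G v ↔ G.Adj v u := by simp [nb]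

lemma dist_le_of_adj (hc : G.Connected) {u v : V} (h : G.Adj u v) (z : V) :
    G.dist u z ≤ G.dist v z + 1 := by
  have := hc.dist_triangle (u := u) (v := v) (w := z)
  rw [SimpleGraph.dist_eq_one_iff_adj.2 h] at this
  omega

lemma dist_self_adj {u v : V} (h : G.Adj u v) : G.dist u v = 1 :=
  SimpleGraph.dist_eq_one_iff_adj.2 h

lemma exists_parent (hc : G.Connected) {v z : V} (h : v ≠ z) :
    ∃ u, G.Adj v u ∧ G.dist u z + 1 = G.dist v z := by
  obtain ⟨p, hp⟩ := hc.exists_walk_length_eq_dist v z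
  cases p with
  | nil => exact absurd rfl h
  | cons hadj q =>
    rename_i u
    refine ⟨u, hadj, ?_⟩
    have h1 := SimpleGraph.dist_le q
    have h2 := dist_le_of_adj hc hadj z
    simp only [SimpleGraph.Walk.length_cons] at hp
    omega

lemma sum_nb_comm (f : V → V → ℤ) :
    ∑ v, ∑ u ∈ nb G v, f v u = ∑ v, ∑ u ∈ nb G v, f u v := by
  simp only [nb, sum_filter]
  rw [sum_comm]
  simp only [G.adj_comm]

lemma sum_arcs (f : Sym2 V → ℚ) :
    ∑ v, ∑ u ∈ nb G v, f s(v, u) = 2 * ∑ e ∈ G.edgeFinset, f e := by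
  have h1 : ∑ v, ∑ u ∈ nb G v, f s(v, u)
      = ∑ p ∈ (univ : Finset (V × V)).filter (fun p => G.Adj p.1 p.2), f s(p.1, p.2) := by
    rw [sum_filter, Fintype.sum_prod_type]
    simp only [nb, sum_filter]
  rw [h1, ← sum_fiberwise_of_maps_to (t := G.edgeFinset) (g := fun p => s(p.1, p.2)), mul_sum]
  · refine sum_congr rfl fun e he => ?_
    induction e with
    | _ a b =>
      have hab : G.Adj a b := by simpa using he
      have : ((univ : Finset (V × V)).filter (fun p => G.Adj p.1 p.2)).filter
          (fun p => s(p.1, p.2) = s(a, b)) = {(a, b), (b, a)} := by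
        ext ⟨c, d⟩
        simp only [mem_filter, mem_univ, true_and, Sym2.eq_iff, mem_insert, mem_singleton,
          Prod.mk.injEq]
        constructor
        · exact fun h => h.2
        · rintro (⟨rfl, rfl⟩ | ⟨rfl, rfl⟩)
          · exact ⟨hab, Or.inl ⟨rfl, rfl⟩⟩
          · exact ⟨hab.symm, Or.inr ⟨rfl, rfl⟩⟩
      rw [this, sum_pair (by simp [hab.ne]), Sym2.eq_swap (a := b)]
      ring
  · intro p hp
    simpa using hp

lemma sum_deg : ∑ v, (nb G v).card = 2 * G.edgeFinset.card := by
  have := sum_arcs (G := G) fun _ => 1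
  simp only [sum_const, nsmul_eq_mul, mul_one] at this
  exact_mod_cast this

lemma sum_deg_add_bdry (A : Finset V) :
    ∑ a ∈ A, (nb G a).card + bdry G A = 2 * incE G A := by
  have h := sum_arcs (G := G) fun e => if ∃ a ∈ A, a ∈ e then 1 else 0
  have h2 : ∑ e ∈ G.edgeFinset, (if ∃ a ∈ A, a ∈ e then (1 : ℚ) else 0) = incE G A := by
    rw [sum_boole]; rfl
  rw [h2] at h
  have h3 : ∑ v, ∑ u ∈ nb G v, (if ∃ a ∈ A, a ∈ s(v, u) then (1 : ℚ) else 0)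
      = ∑ v, ∑ u ∈ nb G v, ((if v ∈ A then 1 else 0) + (if u ∈ A ∧ v ∉ A then 1 else 0)) := by
    refine sum_congr rfl fun v _ => sum_congr rfl fun u _ => ?_
    have : (∃ a ∈ A, a ∈ s(v, u)) ↔ v ∈ A ∨ u ∈ A := by
      simp only [Sym2.mem_iff]
      constructor
      · rintro ⟨a, h, rfl | rfl⟩ <;> tauto
      · rintro (h | h)
        · exact ⟨_, h, Or.inl rfl⟩
        · exact ⟨_, h, Or.inr rfl⟩
    by_cases h1 : v ∈ A <;> by_cases h2 : u ∈ A <;> simp only [this, h1, h2] <;> simp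
  rw [h3] at h
  simp only [sum_add_distrib] at h
  have h4 : ∑ v, ∑ u ∈ nb G v, (if v ∈ A then (1 : ℚ) else 0) = ((∑ a ∈ A, (nb G a).card : ℕ) : ℚ) := by
    simp
  have h5 : ∑ v, ∑ u ∈ nb G v, (if u ∈ A ∧ v ∉ A then (1 : ℚ) else 0) = (bdry G A : ℚ) := by
    have := sum_nb_comm (G := G) fun v u => if u ∈ A ∧ v ∉ A then (1 : ℤ) else 0
    have h6 : ∑ v, ∑ u ∈ nb G v, (if v ∈ A ∧ u ∉ A then (1 : ℤ) else 0) = (bdry G A : ℤ) := by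
      rw [bdry, ← sum_subset (subset_univ A)]
      · push_cast
        refine sum_congr rfl fun v hv => ?_
        simp only [hv, true_and, sum_boole]
      · intro v _ hv
        simp [hv]
    rw [h6] at this
    exact_mod_cast this
  rw [h4, h5] at h
  exact_mod_cast h

/-- Disjoint sets without edges between them. -/
lemma incE_add_le {A B : Finset V} (h : ∀ a ∈ A, ∀ b ∈ B, a ≠ b ∧ ¬ G.Adj a b) :
    incE G A + incE G B ≤ G.edgeFinset.card := by
  unfold incE
  rw [← card_union_of_disjoint]
  · exact card_le_card (union_subset (filter_subset _ _) (filter_subset _ _))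
  · rw [disjoint_left]
    intro e
    simp only [mem_filter, not_and, not_exists]
    rintro ⟨he, a, ha, hae⟩ _ b hb hbe
    obtain ⟨h1, h2⟩ := h a ha b hb
    rw [(Sym2.mem_and_mem_iff h1).1 ⟨hae, hbe⟩] at he
    exact h2 (by simpa using he)

lemma nC_sub (hc : G.Connected) {u v : V} (h : G.Adj u v) :
    (nC G u v : ℤ) - nC G v u = tr G v - tr G u := by
  unfold nC tr
  rw [← sum_sub_distrib, ← sum_boole, ← sum_boole, ← sum_sub_distrib]
  refine sum_congr rfl fun z _ => ?_
  have h1 := dist_le_of_adj hc h z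
  have h2 := dist_le_of_adj hc h.symm z
  split_ifs <;> omega

lemma nC_add (u v : V) : nC G u v + nC G v u + nE G u v = Fintype.card V := by
  unfold nC nE
  have : ((Fintype.card V : ℕ) : ℤ) = ∑ _z : V, (1 : ℤ) := by simp
  zify
  rw [this, ← sum_boole, ← sum_boole, ← sum_boole, ← sum_add_distrib, ← sum_add_distrib]
  refine sum_congr rfl fun z _ => ?_
  split_ifs <;> omega

lemma revSz_eq (hc : G.Connected) :
    8 * revSz G = 2 * (Fintype.card V : ℚ) ^ 2 * G.edgeFinset.card - energy G := by
  have h := sum_arcs (G := G) (szContrib G)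
  have h1 : ∑ v, ∑ u ∈ nb G v, szContrib G s(v, u)
      = ∑ v, ∑ u ∈ nb G v, ((Fintype.card V : ℚ) ^ 2 - ((tr G u - tr G v : ℤ) : ℚ) ^ 2) / 4 := by
    refine sum_congr rfl fun v _ => sum_congr rfl fun u hu => ?_
    rw [← nC_sub hc (mem_nb.1 hu), ← nC_add v u (G := G)]
    simp only [szContrib, Sym2.lift_mk]
    push_cast
    ring
  rw [h1] at h
  simp only [← sum_div, sum_sub_distrib, sum_const, nsmul_eq_mul, ← sum_mul] at h
  have h2 : ∑ v, ((nb G v).card : ℚ) = 2 * G.edgeFinset.card := by exact_mod_cast sum_deg (G := G)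
  rw [h2] at h
  have h3 : ((energy G : ℤ) : ℚ) = ∑ v, ∑ u ∈ nb G v, ((tr G u - tr G v : ℤ) : ℚ) ^ 2 := by
    simp [energy]
  unfold revSz
  rw [h3]
  linarith

/-- The arcs across a cut contribute twice. -/
lemma cut_energy (O : Finset V) :
    2 * ∑ y ∈ O, ∑ g ∈ (nb G y).filter (· ∉ O), (tr G y - tr G g) ^ 2 ≤ energy G := by
  have key : ∀ v, ∀ u ∈ nb G v, ((if v ∈ O ∧ u ∉ O then (tr G v - tr G u) ^ 2 else 0) +
      (if u ∈ O ∧ v ∉ O then (tr G u - tr G v) ^ 2 else 0)) ≤ (tr G u - tr G v) ^ 2 := by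
    intro v u _
    by_cases h1 : v ∈ O <;> by_cases h2 : u ∈ O <;> simp [h1, h2] <;> nlinarith
  have h := sum_le_sum fun v (_ : v ∈ univ) => sum_le_sum (key v)
  simp only [sum_add_distrib] at h
  rw [sum_nb_comm (G := G) fun v u => (if u ∈ O ∧ v ∉ O then (tr G u - tr G v) ^ 2 else 0)] at h
  have h6 : ∑ v, ∑ u ∈ nb G v, (if v ∈ O ∧ u ∉ O then (tr G v - tr G u) ^ 2 else 0)
      = ∑ y ∈ O, ∑ g ∈ (nb G y).filter (· ∉ O), (tr G y - tr G g) ^ 2 := by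
    rw [← sum_subset (subset_univ O)]
    · refine sum_congr rfl fun v hv => ?_
      simp [hv, sum_filter]
    · intro v _ hv
      simp [hv]
  rw [h6] at h
  unfold energy
  linarith

lemma star_energy (y : V) : 2 * ∑ g ∈ nb G y, (tr G y - tr G g) ^ 2 ≤ energy G := by
  have := cut_energy (G := G) {y}
  rw [sum_singleton, filter_true_of_mem] at this
  · exact this
  · intro g hg
    simpa using (mem_nb.1 hg).ne'

lemma edge_energy {y g : V} (h : G.Adj y g) : 2 * (tr G y - tr G g) ^ 2 ≤ energy G := by
  have h1 := star_energy (G := G) y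
  have := single_le_sum (f := fun g => (tr G y - tr G g) ^ 2) (fun i _ => sq_nonneg _)
    (mem_nb.2 h)
  linarith

lemma sum_curv (y : V) : ∑ z, curv G y z = ∑ u ∈ nb G y, (tr G y - tr G u) := by
  unfold curv tr
  rw [sum_comm]
  simp only [sum_sub_distrib]

lemma curv_self (y : V) : curv G y y = -((nb G y).card : ℤ) := by
  unfold curv
  rw [sum_congr rfl (g := fun _ => (-1 : ℤ))]
  · simp
  · intro u hu
    simp [dist_self_adj (mem_nb.1 hu).symm]

/-- `y` has exactly the two neighbours `u` and `w`. -/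
def Two (G : SimpleGraph V) (y u w : V) : Prop := u ≠ w ∧ nb G y = {u, w}

lemma exists_two {y : V} (h : (nb G y).card = 2) : ∃ u w, Two G y u w := by
  obtain ⟨u, w, h1, h2⟩ := card_eq_two.1 h
  exact ⟨u, w, h1, h2⟩

lemma Two.symm {y u w : V} (h : Two G y u w) : Two G y w u :=
  ⟨h.1.symm, by rw [h.2, pair_comm]⟩

lemma Two.adj_iff {y u w a : V} (h : Two G y u w) : G.Adj y a ↔ a = u ∨ a = w := by
  rw [← mem_nb, h.2]; simp

lemma Two.left {y u w : V} (h : Two G y u w) : G.Adj y u := h.adj_iff.2 (Or.inl rfl)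
lemma Two.right {y u w : V} (h : Two G y u w) : G.Adj y w := h.adj_iff.2 (Or.inr rfl)

lemma Two.card {y u w : V} (h : Two G y u w) : (nb G y).card = 2 := by
  rw [h.2, card_pair h.1]

lemma Two.dist {y u w : V} (h : Two G y u w) (hc : G.Connected) {z : V} (hz : z ≠ y) :
    G.dist y z = 1 + min (G.dist u z) (G.dist w z) := by
  obtain ⟨a, ha, h1⟩ := exists_parent hc hz.symm
  have h2 := dist_le_of_adj hc h.left z
  have h3 := dist_le_of_adj hc h.right z
  rcases h.adj_iff.1 ha with rfl | rfl <;> omega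

lemma Two.curv_eq {y u w : V} (h : Two G y u w) (hc : G.Connected) {z : V} (hz : z ≠ y) :
    curv G y z = 2 - |(G.dist u z : ℤ) - G.dist w z| := by
  unfold curv
  rw [h.2, sum_pair h.1, h.dist hc hz]
  rcases le_total (G.dist u z) (G.dist w z) with h1 | h1
  · rw [min_eq_left h1, abs_of_nonpos (by omega)]; push_cast; ring
  · rw [min_eq_right h1, abs_of_nonneg (by omega)]; push_cast; ring

lemma Two.abs_diff_le {y u w : V} (h : Two G y u w) (hc : G.Connected) (z : V) :
    |(G.dist u z : ℤ) - G.dist w z| ≤ 2 := by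
  have h1 := dist_le_of_adj hc h.left z
  have h2 := dist_le_of_adj hc h.right z
  have h3 := dist_le_of_adj hc h.left.symm z
  have h4 := dist_le_of_adj hc h.right.symm z
  rw [abs_le]; constructor <;> omega

lemma Two.curv_nonneg {y u w : V} (h : Two G y u w) (hc : G.Connected) {z : V} (hz : z ≠ y) :
    0 ≤ curv G y z := by
  rw [h.curv_eq hc hz]; linarith [h.abs_diff_le hc z]

/-- Crossing a bisector of the two neighbours of `y` costs curvature at least two. -/
lemma Two.crossing {y u w : V} (h : Two G y u w) (hc : G.Connected) {X : Finset V} (hX : y ∉ X)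
    {a b : V} (ha : a ∈ X) (hb : b ∈ X) (hab : G.Adj a b)
    (h1 : G.dist u a < G.dist w a) (h2 : G.dist w b ≤ G.dist u b) :
    2 ≤ ∑ z ∈ X, curv G y z := by
  have hsub : ({a, b} : Finset V) ⊆ X := by
    intro z; simp only [mem_insert, mem_singleton]; rintro (rfl | rfl) <;> assumption
  have h3 := sum_le_sum_of_subset_of_nonneg (f := curv G y) hsub fun z hz _ =>
    h.curv_nonneg hc (ne_of_mem_of_not_mem hz hX)
  refine le_trans ?_ h3
  rw [sum_pair hab.ne, h.curv_eq hc (ne_of_mem_of_not_mem ha hX),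
    h.curv_eq hc (ne_of_mem_of_not_mem hb hX), abs_of_neg (by omega), abs_of_nonneg (by omega)]
  have h3 := dist_le_of_adj hc hab u
  have h4 := dist_le_of_adj hc hab.symm u
  have h5 := dist_le_of_adj hc hab w
  have h6 := dist_le_of_adj hc hab.symm w
  simp only [G.dist_comm (v := u), G.dist_comm (v := w)] at *
  omega

end

section
variable {V : Type*} [Fintype V] {G : SimpleGraph V}

/-- A tricyclic graph whose revised Szeged index is large. -/
structure Low (G : SimpleGraph V) : Prop where
  conn : G.Connected
  edges : G.edgeFinset.card = Fintype.card V + 2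
  large : 29 ≤ Fintype.card V
  small : energy G ≤ 36

/-- Two vertices separating `U` from its complement lie on all geodesics leaving `U`. -/
lemma dist_separator (hc : G.Connected) {U : Finset V} {v x : V}
    (h : ∀ a ∈ U, ∀ b, G.Adj a b → b ∈ U ∨ b = v ∨ b = x) {z : V} (hz : z ∉ U) {y : V}
    (hy : y ∈ U) :
    G.dist y z = G.dist y v + G.dist v z ∨ G.dist y z = G.dist y x + G.dist x z := by
  induction hk : G.dist y z generalizing y with
  | zero => exact absurd ((hc.dist_eq_zero_iff.1 hk) ▸ hy) hz
  | succ k ih =>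
    obtain ⟨u, hu, h1⟩ := exists_parent hc (ne_of_mem_of_not_mem hy hz)
    have t1 := hc.dist_triangle (u := y) (v := v) (w := z)
    have t2 := hc.dist_triangle (u := y) (v := x) (w := z)
    have t3 := dist_le_of_adj hc hu v
    have t4 := dist_le_of_adj hc hu x
    rcases h y hy u hu with h2 | rfl | rfl
    · rcases ih h2 (by omega) with h3 | h3
      · have := dist_le_of_adj hc hu v; omega
      · have := dist_le_of_adj hc hu x; omega
    · have := dist_self_adj hu; omega
    · have := dist_self_adj hu; omega

lemma dist_cut (hc : G.Connected) {A : Finset V} {g : V}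
    (h : ∀ a ∈ A, ∀ b, G.Adj a b → b ∈ A ∨ b = g) {z : V} (hz : z ∉ A) {y : V}
    (hy : y ∈ A ∨ y = g) : G.dist y z = G.dist y g + G.dist g z := by
  rcases hy with hy | rfl
  · simpa using dist_separator hc (v := g) (x := g) (fun a ha b hb => by simpa using h a ha b hb) hz hy
  · simp

/-- Edges joining the vertices of `P` to their parents, together with the edges meeting `O`. -/
lemma incE_add_parents {A O P : Finset V} (p : V → V) (r : V → ℕ) (hOA : O ⊆ A)
    (hadj : ∀ a ∈ P, G.Adj a (p a)) (hr : ∀ a ∈ P, r (p a) < r a)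
    (hA : ∀ a ∈ P, a ∈ A ∨ p a ∈ A) (hO : ∀ a ∈ P, a ∉ O ∧ p a ∉ O) :
    incE G O + P.card ≤ incE G A := by
  have hinj : Set.InjOn (fun a => s(a, p a)) (P : Set V) := by
    intro a ha b hb hab
    rcases Sym2.eq_iff.1 hab with h | h
    · exact h.1
    · have h1 := hr a ha
      have h2 := hr b hb
      rw [h.2] at h1
      rw [← h.1] at h2
      omega
  rw [← card_image_of_injOn hinj]
  unfold incE
  rw [← card_union_of_disjoint]
  · refine card_le_card (union_subset (fun e => ?_) fun e => ?_)
    · simp only [mem_filter]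
      exact fun ⟨h1, a, ha, h2⟩ => ⟨h1, a, hOA ha, h2⟩
    · simp only [mem_image, mem_filter]
      rintro ⟨a, ha, rfl⟩
      refine ⟨by simpa using hadj a ha, ?_⟩
      rcases hA a ha with h | h
      · exact ⟨a, h, by simp⟩
      · exact ⟨p a, h, by simp⟩
  · rw [disjoint_left]
    intro e
    simp only [mem_filter, mem_image, not_exists, not_and]
    rintro ⟨-, o, ho, hoe⟩ a ha rfl
    obtain ⟨h1, h2⟩ := hO a ha
    rcases Sym2.mem_iff.1 hoe with rfl | rfl
    · exact h1 ho
    · exact h2 ho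

lemma incE_singleton (y : V) : incE G {y} = (nb G y).card := by
  have h := sum_deg_add_bdry (G := G) {y}
  have : bdry G {y} = (nb G y).card := by
    rw [bdry, sum_singleton, filter_true_of_mem]
    intro g hg
    simpa using (mem_nb.1 hg).ne'
  rw [sum_singleton, this] at h
  omega

lemma exists_parent_fun (hc : G.Connected) (g : V) :
    ∃ p : V → V, ∀ a, a ≠ g → G.Adj a (p a) ∧ G.dist (p a) g + 1 = G.dist a g := by
  have : ∀ a, ∃ b, a ≠ g → G.Adj a b ∧ G.dist b g + 1 = G.dist a g := by
    intro a
    by_cases h : a = g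
    · exact ⟨a, fun h' => absurd h h'⟩
    · obtain ⟨b, hb⟩ := exists_parent hc h
      exact ⟨b, fun _ => hb⟩
  exact ⟨fun a => (this a).choose, fun a => (this a).choose_spec⟩

namespace Low

variable (hL : Low G)
include hL

lemma edge_sq {y g : V} (h : G.Adj y g) : (tr G y - tr G g) ^ 2 ≤ 18 := by
  linarith [edge_energy h, hL.small]

lemma two_sum_le {y u w : V} (h : Two G y u w) : ∑ g ∈ nb G y, (tr G y - tr G g) ≤ 6 := by
  have h1 := star_energy (G := G) y
  have h2 := hL.small
  rw [h.2, sum_pair h.1] at *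
  nlinarith [sq_nonneg ((tr G y - tr G u) - (tr G y - tr G w))]

lemma two_le_deg (y : V) : 2 ≤ (nb G y).card := by
  have hc := hL.conn
  have hn := hL.large
  obtain ⟨z, hz⟩ : ∃ z, z ≠ y := by
    have : 1 < Fintype.card V := by omega
    exact Fintype.exists_ne_of_one_lt_card this y
  obtain ⟨u, hu, -⟩ := exists_parent hc hz.symm
  by_contra hlt
  have h1 : nb G y = {u} := by
    refine (eq_of_subset_of_card_le (by simpa using hu) ?_).symm
    rw [card_singleton]; omega
  have h2 : ∀ z, (G.dist y z : ℤ) - G.dist u z = 1 - if z = y then 2 else 0 := by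
    intro z
    split_ifs with h
    · subst h; simp [dist_self_adj hu.symm]
    · obtain ⟨a, ha, h3⟩ := exists_parent hc (Ne.symm h)
      have : a = u := by simpa [h1] using mem_nb.2 ha
      subst this; omega
  have h3 : tr G y - tr G u = Fintype.card V - 2 := by
    unfold tr
    rw [← sum_sub_distrib, sum_congr rfl fun z _ => h2 z]
    simp
  have := hL.edge_sq hu
  rw [h3] at this
  have : (29 : ℤ) ≤ Fintype.card V := by exact_mod_cast hn
  nlinarith

lemma card_side {A : Finset V} {g : V} (hA : A.Nonempty) (hg : g ∉ A)
    (h : ∀ a ∈ A, ∀ b, G.Adj a b → b ∈ A ∨ b = g) : Fintype.card V ≤ 2 * A.card + 4 := by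
  have hc := hL.conn
  obtain ⟨y, hy⟩ := hA
  obtain ⟨u, hu, h1⟩ := exists_parent hc (ne_of_mem_of_not_mem hy hg)
  have h2 : ∀ z, (1 : ℤ) - (if z ∈ A then 2 else 0) ≤ (G.dist y z : ℤ) - G.dist u z := by
    intro z
    split_ifs with hz
    · have := dist_le_of_adj hc hu.symm z; omega
    · have h3 := dist_cut hc h hz (Or.inl hy)
      have h4 := dist_cut hc h hz (h y hy u hu)
      omega
  have h3 := sum_le_sum fun z (_ : z ∈ univ) => h2 z
  simp only [sum_sub_distrib, sum_const, sum_ite_mem, univ_inter, nsmul_eq_mul, card_univ] at h3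
  have h4 := hL.edge_sq hu
  unfold tr at h4
  have h5 : (∑ x, (G.dist y x : ℤ)) - ∑ x, (G.dist u x : ℤ) ≤ 4 := by nlinarith
  have : (Fintype.card V : ℤ) ≤ 2 * A.card + 4 := by linarith
  exact_mod_cast this

lemma not_sparse_side {A B : Finset V} {g : V} (hA : A.Nonempty) (hg : g ∉ A)
    (h : ∀ a ∈ A, ∀ b, G.Adj a b → b ∈ A ∨ b = g) (hn : A.card + B.card + 1 = Fintype.card V)
    (hB : Fintype.card V ≤ 2 * B.card + 4) : A.card + 2 ≤ incE G A := by
  have hc := hL.conn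
  by_contra hlt
  obtain ⟨y, hy, hmax⟩ := exists_max_image A (fun a => G.dist a g) hA
  obtain ⟨p, hp⟩ := exists_parent_fun hc g
  have hne : ∀ a ∈ A, a ≠ g := fun a ha => ne_of_mem_of_not_mem ha hg
  have h1 := incE_add_parents (G := G) (A := A) (O := {y}) (P := A.erase y) p (fun a => G.dist a g)
    (by simpa using hy) (fun a ha => (hp a (hne a (mem_of_mem_erase ha))).1)
    (fun a ha => by have := (hp a (hne a (mem_of_mem_erase ha))).2; omega)
    (fun a ha => Or.inl (mem_of_mem_erase ha))
    (fun a ha => by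
      have h1 := (hp a (hne a (mem_of_mem_erase ha))).2
      have h2 := hmax a (mem_of_mem_erase ha)
      simp only [mem_singleton]
      refine ⟨ne_of_mem_erase ha, fun h => ?_⟩
      rw [h] at h1
      omega)
  rw [incE_singleton, card_erase_of_mem hy] at h1
  have h2 := hL.two_le_deg y
  have hA1 : 0 < A.card := card_pos.2 hA
  obtain ⟨u, w, htwo⟩ := exists_two (G := G) (y := y) (by omega)
  have h3 : ∀ z, (if z ∈ A then 0 else 1) - (if z = y then 2 else 0) ≤ curv G y z := by
    intro z
    by_cases hz : z = y
    · subst hz; simp [hy, curv_self, htwo.card]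
    by_cases hzA : z ∈ A
    · simpa [hz, hzA] using htwo.curv_nonneg hc hz
    · simp only [hz, hzA, if_false, sub_zero]
      obtain ⟨hq1, hq2⟩ := hp y (hne y hy)
      have hle : ∀ u ∈ nb G y, (0 : ℤ) ≤ (G.dist y z : ℤ) - G.dist u z := by
        intro u hu
        have h4 := h y hy u (mem_nb.1 hu)
        have h5 : G.dist u g ≤ G.dist y g := by
          rcases h4 with h4 | rfl
          · exact hmax u h4
          · simp
        have h6 := dist_cut hc h hzA (Or.inl hy)
        have h7 := dist_cut hc h hzA h4
        omega
      refine le_trans ?_ (single_le_sum hle (mem_nb.2 hq1))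
      have h6 := dist_cut hc h hzA (Or.inl hy)
      have h7 := dist_cut hc h hzA (h y hy _ hq1)
      omega
  have h4 := sum_le_sum fun z (_ : z ∈ univ) => h3 z
  rw [sum_curv] at h4
  have h5 := hL.two_sum_le htwo
  have h6 : ∑ z : V, (if z ∈ A then (0 : ℤ) else 1) = Fintype.card V - A.card := by
    have : ∀ z : V, (if z ∈ A then (0 : ℤ) else 1) = 1 - if z ∈ A then 1 else 0 := by
      intro z; split_ifs <;> simp
    simp [this]
  rw [sum_sub_distrib, h6] at h4
  simp only [sum_ite_eq', mem_univ, if_true] at h4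
  have := hL.large
  omega

/-- No vertex separates the graph. -/
lemma noCut {A : Finset V} {g : V} (hA : A.Nonempty) (hg : g ∉ A) (hz : ∃ z, z ∉ A ∧ z ≠ g) :
    ∃ a ∈ A, ∃ b, b ∉ A ∧ b ≠ g ∧ G.Adj a b := by
  by_contra! hno
  have h : ∀ a ∈ A, ∀ b, G.Adj a b → b ∈ A ∨ b = g := by
    intro a ha b hb
    by_contra! h
    exact hno a ha b h.1 h.2 hb
  obtain ⟨z, hz1, hz2⟩ := hz
  set B : Finset V := (insert g A)ᶜ with hB
  have hBm : ∀ b, b ∈ B ↔ b ≠ g ∧ b ∉ A := by intro b; simp [hB]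
  have hBne : B.Nonempty := ⟨z, (hBm z).2 ⟨hz2, hz1⟩⟩
  have hgB : g ∉ B := by simp [hBm]
  have h' : ∀ a ∈ B, ∀ b, G.Adj a b → b ∈ B ∨ b = g := by
    intro a ha b hb
    rw [hBm] at *
    by_contra! hh
    have hbA : b ∈ A := by tauto
    rcases h b hbA a hb.symm with h1 | h1 <;> tauto
  have hcard : A.card + B.card + 1 = Fintype.card V := by
    have := card_add_card_compl (insert g A)
    rw [← hB, card_insert_of_notMem hg] at this
    omega
  have h1 := hL.not_sparse_side hA hg h hcard (hL.card_side hBne hgB h')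
  have h2 := hL.not_sparse_side hBne hgB h' (by omega : B.card + A.card + 1 = _) (hL.card_side hA hg h)
  have h3 := incE_add_le (G := G) (A := A) (B := B) fun a ha b hb => by
    rw [hBm] at hb
    refine ⟨ne_of_mem_of_not_mem ha hb.2, fun hab => ?_⟩
    rcases h a ha b hab with h1 | h1 <;> tauto
  rw [hL.edges] at h3
  omega

end Low

lemma Two.two_le_sum {y u w : V} (h : Two G y u w) (hc : G.Connected) {X : Finset V} (hX : y ∉ X)
    (hconn : ∀ P : V → Prop, P u → ¬ P w → ∃ a ∈ X, ∃ b ∈ X, G.Adj a b ∧ P a ∧ ¬ P b) :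
    2 ≤ ∑ z ∈ X, curv G y z := by
  obtain ⟨a, ha, b, hb, hab, h1, h2⟩ := hconn (fun z => G.dist u z < G.dist w z)
    (by simpa using hc.pos_dist_of_ne h.1.symm) (by simp)
  exact h.crossing hc hX ha hb hab h1 (by simpa using h2)

namespace Low

variable (hL : Low G)
include hL

lemma two_conn {y u w : V} (h : Two G y u w) (P : V → Prop) (hu : P u) (hw : ¬ P w) :
    ∃ a, a ≠ y ∧ ∃ b, b ≠ y ∧ G.Adj a b ∧ P a ∧ ¬ P b := by
  obtain ⟨a, ha, b, hb, hby, hab⟩ := hL.noCut (A := univ.filter fun z => z ≠ y ∧ P z) (g := y)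
    ⟨u, by simp [hu, h.left.ne']⟩ (by simp) ⟨w, by simp [hw], h.right.ne'⟩
  simp only [mem_filter, mem_univ, true_and, not_and] at ha hb
  exact ⟨a, ha.1, b, hby, hab, ha.2, hb hby⟩

lemma concave {y u w : V} (h : Two G y u w) : 0 ≤ ∑ g ∈ nb G y, (tr G y - tr G g) := by
  rw [← sum_curv, ← add_sum_erase _ _ (mem_univ y), curv_self, h.card]
  have := h.two_le_sum hL.conn (X := univ.erase y) (by simp) fun P hu hw => by
    obtain ⟨a, ha, b, hb, h1⟩ := hL.two_conn h P hu hw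
    exact ⟨a, by simpa using ha, b, by simpa using hb, h1⟩
  push_cast
  linarith

end Low

lemma sum_diff : ∑ v, ∑ u ∈ nb G v, (tr G u - tr G v) = 0 := by
  have h := sum_nb_comm (G := G) fun v u => tr G u - tr G v
  have h2 : ∑ v, ∑ u ∈ nb G v, (tr G v - tr G u) = - ∑ v, ∑ u ∈ nb G v, (tr G u - tr G v) := by
    simp only [← sum_neg_distrib, neg_sub]
  linarith

lemma energy_eq (k : ℤ) :
    energy G = ∑ v, ∑ u ∈ nb G v, ((tr G u - tr G v) ^ 2 - k * (tr G u - tr G v)) := by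
  have h : energy G - k * ∑ v, ∑ u ∈ nb G v, (tr G u - tr G v) =
      ∑ v, ∑ u ∈ nb G v, ((tr G u - tr G v) ^ 2 - k * (tr G u - tr G v)) := by
    rw [energy, mul_sum, ← sum_sub_distrib]
    refine sum_congr rfl fun v _ => ?_
    rw [mul_sum, ← sum_sub_distrib]
  rw [← h, sum_diff]
  ring

lemma Low.exists_good (hL : Low G) :
    ∃ v u w, Two G v u w ∧ tr G u = tr G v ∧ tr G w = tr G v := by
  by_contra! hno
  have key : ∀ v, 12 - 5 * ((nb G v).card : ℤ) ≤
      ∑ u ∈ nb G v, ((tr G u - tr G v) ^ 2 - 2 * (tr G u - tr G v)) := by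
    intro v
    rcases (hL.two_le_deg v).eq_or_lt with h | h
    · obtain ⟨u, w, htwo⟩ := exists_two h.symm
      have h1 := hL.concave htwo
      have h2 := hno v u w htwo
      rw [← h]
      rw [htwo.2, sum_pair htwo.1] at *
      by_cases h3 : tr G u = tr G v
      · have h4 := h2 h3
        have h5 : tr G w - tr G v < 0 := by omega
        rw [h3]
        push_cast
        nlinarith
      · have h5 : 1 ≤ (tr G u - tr G v) ^ 2 := by
          have := sub_ne_zero.2 h3; have := sq_pos_of_ne_zero this; omega
        rcases h1.eq_or_lt with h6 | h6
        · have h7 : tr G w - tr G v = - (tr G u - tr G v) := by linarith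
          rw [h7]; push_cast; nlinarith
        · have : 1 ≤ tr G v - tr G u + (tr G v - tr G w) := h6
          push_cast
          nlinarith [sq_nonneg (tr G w - tr G v)]
    · have h1 : ∑ u ∈ nb G v, (-1 : ℤ) ≤
          ∑ u ∈ nb G v, ((tr G u - tr G v) ^ 2 - 2 * (tr G u - tr G v)) :=
        sum_le_sum fun u _ => by nlinarith [sq_nonneg (tr G u - tr G v - 1)]
      simp only [sum_const, nsmul_eq_mul] at h1
      omega
  have h1 := sum_le_sum fun v (_ : v ∈ univ) => key v
  rw [← energy_eq] at h1
  have h2 := sum_deg (G := G)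
  rw [hL.edges] at h2
  have h3 : ∑ v, ((nb G v).card : ℤ) = 2 * (Fintype.card V + 2) := by exact_mod_cast h2
  rw [sum_sub_distrib, ← mul_sum, h3] at h1
  have := hL.small
  have := hL.large
  simp only [sum_const, nsmul_eq_mul, card_univ] at h1
  omega

end

section
variable {V : Type*} [Fintype V] {G : SimpleGraph V}

/-- `U` is one of the two sides of the graph between the vertices `v` and `x`. -/
structure Side (G : SimpleGraph V) (U : Finset V) (u v x : V) : Prop where
  mem : u ∈ U
  adj : G.Adj v u
  v_notMem : v ∉ U
  x_notMem : x ∉ U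
  ne : v ≠ x
  nadj : ¬ G.Adj v x
  only : ∀ a ∈ U, G.Adj v a → a = u
  nbr : ∀ a ∈ U, ∀ b, G.Adj a b → b ∈ U ∨ b = v ∨ b = x
  dist : G.dist u x + 1 = G.dist v x

/-- The decomposition of the graph into two sides of equal size. -/
structure Sides (G : SimpleGraph V) (U W : Finset V) (u w v x x' : V) : Prop where
  two : Two G v u w
  left : Side G U u v x
  right : Side G W w v x'
  disj : ∀ a ∈ U, a ∉ W
  x_notMem : x ∉ W
  x'_notMem : x' ∉ U
  card : U.card = W.card
  cover : ∀ z, z ∈ U ∨ z ∈ W ∨ z = v ∨ z = x ∨ z = x'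
  dist : G.dist v x = G.dist v x'
  inc : incE G U + incE G W = 2 * U.card + 4
  parity : x = x' ∧ Fintype.card V = 2 * U.card + 2 ∨
    G.Adj x x' ∧ Fintype.card V = 2 * U.card + 3

/-- The difference of the distances to `u` and `w`. -/
noncomputable def dd (G : SimpleGraph V) (u w z : V) : ℤ := (G.dist u z : ℤ) - G.dist w z

lemma dd_symm (u w z : V) : dd G w u z = - dd G u w z := by unfold dd; ring

lemma dd_adj (hc : G.Connected) (u w : V) {a b : V} (h : G.Adj a b) :
    dd G u w a ≤ dd G u w b + 2 := by
  have h1 := dist_le_of_adj hc h u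
  have h2 := dist_le_of_adj hc h.symm w
  unfold dd
  simp only [G.dist_comm (v := u), G.dist_comm (v := w)] at *
  omega

lemma Two.dd_v {v u w : V} (h : Two G v u w) : dd G u w v = 0 := by
  unfold dd
  rw [dist_self_adj h.left.symm, dist_self_adj h.right.symm, sub_self]

lemma Two.dd_left {v u w : V} (h : Two G v u w) (hc : G.Connected) :
    dd G u w u = -1 ∧ G.Adj u w ∨ dd G u w u = -2 := by
  have h1 := hc.dist_triangle (u := w) (v := v) (w := u)
  rw [dist_self_adj h.right.symm, dist_self_adj h.left] at h1
  have h2 := hc.pos_dist_of_ne h.1.symm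
  unfold dd
  simp only [SimpleGraph.dist_self]
  rcases (by omega : G.dist w u = 1 ∨ G.dist w u = 2) with h3 | h3
  · exact Or.inl ⟨by omega, (SimpleGraph.dist_eq_one_iff_adj.1 h3).symm⟩
  · exact Or.inr (by omega)

/-- One half of the decomposition. -/
lemma side_of_dd (hc : G.Connected) {v u w x : V} (h : Two G v u w)
    (hx : x ≠ v) (hxd : dd G u w x = 0 ∨ dd G u w x = -1) (hu : dd G u w u = -2)
    (hw : dd G u w w = 2)
    (hall : ∀ z, z ≠ v → dd G u w z ≤ 0 → z ≠ x → dd G u w z = -2) :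
    Side G (univ.filter fun z => z ≠ v ∧ dd G u w z = -2) u v x where
  mem := by simp [hu, h.left.ne']
  adj := h.left
  v_notMem := by simp
  x_notMem := by rcases hxd with h1 | h1 <;> simp [h1]
  ne := hx.symm
  nadj := fun hadj => by
    rcases h.adj_iff.1 hadj with rfl | rfl <;> omega
  only := by
    intro a ha hva
    simp only [mem_filter, mem_univ, true_and] at ha
    rcases h.adj_iff.1 hva with rfl | rfl
    · rfl
    · omega
  nbr := by
    intro a ha b hb
    simp only [mem_filter, mem_univ, true_and] at ha ⊢
    have := dd_adj hc u w hb.symm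
    by_cases h1 : b = v
    · exact Or.inr (Or.inl h1)
    by_cases h2 : b = x
    · exact Or.inr (Or.inr h2)
    · exact Or.inl ⟨h1, hall b h1 (by omega) h2⟩
  dist := by
    rw [h.dist hc hx, min_eq_left]
    · omega
    · unfold dd at hxd; omega

lemma Low.exists_crossing (hL : Low G) {v u w : V} (h : Two G v u w) (hu : tr G u = tr G v)
    (hw : tr G w = tr G v) :
    ∃ a b, a ≠ v ∧ b ≠ v ∧ G.Adj a b ∧
      (dd G u w a = -2 ∧ dd G u w b = 0 ∨ dd G u w a = -1 ∧ dd G u w b = 1) ∧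
      ∀ z, z ≠ v → z ≠ a → z ≠ b → dd G u w z = 2 ∨ dd G u w z = -2 := by
  have hc := hL.conn
  obtain ⟨a, ha, b, hb, hab, h1, h2⟩ := hL.two_conn h (fun z => dd G u w z < 0)
    (by rcases h.dd_left hc with h1 | h1 <;> omega)
    (by rw [← neg_neg (dd G u w w), ← dd_symm]; rcases h.symm.dd_left hc with h1 | h1 <;> omega)
  have hs : ∑ z ∈ univ.erase v, curv G v z = 2 := by
    have := sum_curv (G := G) v
    rw [← add_sum_erase _ _ (mem_univ v), curv_self, h.card, h.2, sum_pair h.1, hu, hw] at this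
    push_cast at this
    linarith
  have hcv : ∀ z, z ≠ v → curv G v z = 2 - |dd G u w z| := fun z hz => h.curv_eq hc hz
  have hnn : ∀ z ∈ univ.erase v, 0 ≤ curv G v z := fun z hz => h.curv_nonneg hc (ne_of_mem_erase hz)
  have h3 := dd_adj hc u w hab.symm
  have hca := hcv a ha
  have hcb := hcv b hb
  rw [abs_of_neg h1] at hca
  rw [abs_of_nonneg (not_lt.1 h2)] at hcb
  have hpair : ∀ S ⊆ univ.erase v, ∑ z ∈ S, curv G v z ≤ 2 := fun S hS =>
    hs ▸ sum_le_sum_of_subset_of_nonneg hS fun z hz _ => hnn z hz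
  have hz : ∀ z, z ≠ v → z ≠ a → z ≠ b → dd G u w z = 2 ∨ dd G u w z = -2 := by
    intro z hz hza hzb
    have h4 := hpair {z, a, b} (by intro t; simp; rintro (rfl | rfl | rfl) <;> assumption)
    rw [sum_insert (by simp [hza, hzb]), sum_pair hab.ne] at h4
    have h5 := h.abs_diff_le hc z
    have h6 := hcv z hz
    change |dd G u w z| ≤ 2 at h5
    rcases abs_cases (dd G u w z) with h7 | h7 <;> omega
  refine ⟨a, b, ha, hb, hab, ?_, hz⟩
  have h4 := hpair {a, b} (by intro t; simp; rintro (rfl | rfl) <;> assumption)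
  rw [sum_pair hab.ne] at h4
  have h5 := h.curv_nonneg hc ha
  omega

/-- The two neighbours of a good vertex are not adjacent. -/
lemma Low.not_adj_aux (hL : Low G) {v u w : V} (h : Two G v u w)
    (hcr : ∀ a b, a ≠ v → b ≠ v → G.Adj a b → dd G u w a < 0 → 0 ≤ dd G u w b → a = u)
    (hw : dd G u w w = 1) : ∀ z, z ≠ v → dd G u w z < 0 → z = u := by
  by_contra! hne
  obtain ⟨z, hz1, hz2, hz3⟩ := hne
  obtain ⟨a, ha, b, hb, hbu, hab⟩ := hL.noCut
    (A := univ.filter fun z => z ≠ v ∧ z ≠ u ∧ dd G u w z < 0) (g := u)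
    ⟨z, by simp [hz1, hz2, hz3]⟩ (by simp) ⟨v, by simp, h.left.ne⟩
  simp only [mem_filter, mem_univ, true_and, not_and] at ha hb
  by_cases hbv : b = v
  · subst hbv
    rcases h.adj_iff.1 hab.symm with rfl | rfl
    · exact ha.2.1 rfl
    · omega
  · exact ha.2.1 (hcr a b ha.1 hbv hab ha.2.2 (by have := hb hbv hbu; omega))

lemma Low.not_adj (hL : Low G) {v u w : V} (h : Two G v u w) (hu : tr G u = tr G v)
    (hw : tr G w = tr G v) : dd G u w u = -2 ∧ dd G u w w = 2 := by
  have hc := hL.conn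
  have key : ¬ G.Adj u w := by
    intro huw
    obtain ⟨a, b, ha, hb, hab, h1, h2⟩ := hL.exists_crossing h hu hw
    have hdu : dd G u w u = -1 := by
      unfold dd; simp [dist_self_adj huw.symm]
    have hdw : dd G u w w = 1 := by
      unfold dd; simp [dist_self_adj huw]
    have hua : u = a := by
      by_contra hne
      by_cases h3 : u = b
      · subst h3; omega
      · have := h2 u h.left.ne' hne h3; omega
    have hwb : w = b := by
      by_contra hne
      by_cases h3 : w = a
      · subst h3; omega
      · have := h2 w h.right.ne' h3 hne; omega
    subst hua; subst hwb
    have e1 := hL.not_adj_aux h (by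
      intro a b ha hb hab h3 h4
      by_contra hau
      have h5 := dd_adj hc u w hab.symm
      have h6 := h2 a ha hau (by rintro rfl; omega)
      have h7 : b ≠ u := by rintro rfl; omega
      by_cases h8 : b = w
      · subst h8; omega
      · have := h2 b hb h7 h8; omega) hdw
    have e2 := hL.not_adj_aux h.symm (by
      intro a b ha hb hab h3 h4
      rw [dd_symm] at h3 h4
      by_contra hau
      have h5 := dd_adj hc u w hab
      have h6 := h2 a ha (by rintro rfl; omega) hau
      have h7 : b ≠ w := by rintro rfl; omega
      by_cases h8 : b = u
      · subst h8; omega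
      · have := h2 b hb h8 h7; omega) (by rw [dd_symm, hdu]; rfl)
    have h3 : (univ : Finset V) ⊆ {v, u, w} := by
      intro z _
      simp only [mem_insert, mem_singleton]
      by_contra! hz
      have h4 := h2 z hz.1 hz.2.1 hz.2.2
      have h5 := e1 z hz.1
      have h6 := e2 z hz.1
      rw [dd_symm] at h6
      rcases h4 with h4 | h4
      · exact hz.2.2 (h6 (by omega))
      · exact hz.2.1 (h5 (by omega))
    have h4 := card_le_card h3
    have h5 := card_le_three (a := v) (b := u) (c := w)
    have := hL.large
    rw [card_univ] at h4
    omega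
  constructor
  · rcases h.dd_left hc with h1 | h1
    · exact absurd h1.2 key
    · exact h1
  · rcases h.symm.dd_left hc with h1 | h1
    · exact absurd h1.2.symm key
    · rw [dd_symm] at h1; omega

/-- Counting vertices and edges of the two sides. -/
lemma sides_count {U W : Finset V} {u w v x b : V} (hedges : G.edgeFinset.card = Fintype.card V + 2)
    (sU : Side G U u v x) (sW : Side G W w v b) (hdis : ∀ a ∈ U, a ∉ W) (hxW : x ∉ W) (hbU : b ∉ U)
    (hcard : U.card = W.card) (hcov : ∀ z, z ∈ U ∨ z ∈ W ∨ z = v ∨ z = x ∨ z = b)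
    (hUW : ∀ a ∈ U, ∀ b ∈ W, a ≠ b ∧ ¬ G.Adj a b) (hxb : x = b ∨ G.Adj x b) :
    incE G U + incE G W = 2 * U.card + 4 ∧ (x = b ∧ Fintype.card V = 2 * U.card + 2 ∨
      G.Adj x b ∧ Fintype.card V = 2 * U.card + 3) := by
  have hx := sU.ne.symm
  have hb := sW.ne.symm
  have hUd : Disjoint U W := disjoint_left.2 hdis
  have hedge : ∀ p q, G.Adj p q → p ∈ U ∨ q ∈ U ∨ p ∈ W ∨ q ∈ W ∨ s(p, q) = s(x, b) := by
    intro p q hpq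
    by_contra! hno
    obtain ⟨h1, h2, h3, h4, h5⟩ := hno
    have hp : p = v ∨ p = x ∨ p = b := by have := hcov p; tauto
    have hq : q = v ∨ q = x ∨ q = b := by have := hcov q; tauto
    have e1 := sU.nadj
    have e2 := sW.nadj
    rcases hp with rfl | rfl | rfl <;> rcases hq with rfl | rfl | rfl
    all_goals first
      | exact hpq.ne rfl
      | exact e1 hpq
      | exact e2 hpq
      | exact e1 hpq.symm
      | exact e2 hpq.symm
      | exact h5 rfl
      | exact h5 Sym2.eq_swap
  have hle := incE_add_le (G := G) hUW
  rcases hxb with rfl | h5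
  · have hn : Fintype.card V = 2 * U.card + 2 := by
      have : (univ : Finset V) = insert v (insert x (U ∪ W)) := by
        ext z; have := hcov z; simp; tauto
      rw [← card_univ, this, card_insert_of_notMem, card_insert_of_notMem,
        card_union_of_disjoint hUd]
      · omega
      · simp [sU.x_notMem, hxW]
      · simp [hx.symm, sU.v_notMem, sW.v_notMem]
    refine ⟨?_, Or.inl ⟨rfl, hn⟩⟩
    have hge : G.edgeFinset.card ≤ incE G U + incE G W := by
      unfold incE
      refine le_trans (card_le_card ?_) (card_union_le _ _)
      intro e
      induction e with
      | _ p q =>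
        intro he
        have hpq : G.Adj p q := by simpa using he
        simp only [mem_union, mem_filter, he, true_and, Sym2.mem_iff]
        rcases hedge p q hpq with h1 | h1 | h1 | h1 | h1
        · exact Or.inl ⟨p, h1, Or.inl rfl⟩
        · exact Or.inl ⟨q, h1, Or.inr rfl⟩
        · exact Or.inr ⟨p, h1, Or.inl rfl⟩
        · exact Or.inr ⟨q, h1, Or.inr rfl⟩
        · rcases Sym2.eq_iff.1 h1 with ⟨rfl, rfl⟩ | ⟨rfl, rfl⟩ <;> exact absurd rfl hpq.ne
    omega
  · have hn : Fintype.card V = 2 * U.card + 3 := by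
      have : (univ : Finset V) = insert v (insert x (insert b (U ∪ W))) := by
        ext z; have := hcov z; simp; tauto
      rw [← card_univ, this, card_insert_of_notMem, card_insert_of_notMem, card_insert_of_notMem,
        card_union_of_disjoint hUd]
      · omega
      · simp [hbU, sW.x_notMem]
      · simp [sU.x_notMem, hxW, h5.ne]
      · simp [hx.symm, hb.symm, sU.v_notMem, sW.v_notMem]
    refine ⟨?_, Or.inr ⟨h5, hn⟩⟩
    have hge : G.edgeFinset.card ≤ incE G U + incE G W + 1 := by
      unfold incE
      rw [← card_singleton s(x, b)]
      refine le_trans (card_le_card ?_)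
        ((card_union_le _ _).trans (Nat.add_le_add_right (card_union_le _ _) _))
      intro e
      induction e with
      | _ p q =>
        intro he
        have hpq : G.Adj p q := by simpa using he
        simp only [mem_union, mem_filter, he, true_and, Sym2.mem_iff, mem_singleton]
        rcases hedge p q hpq with h1 | h1 | h1 | h1 | h1
        · exact Or.inl (Or.inl ⟨p, h1, Or.inl rfl⟩)
        · exact Or.inl (Or.inl ⟨q, h1, Or.inr rfl⟩)
        · exact Or.inl (Or.inr ⟨p, h1, Or.inl rfl⟩)
        · exact Or.inl (Or.inr ⟨q, h1, Or.inr rfl⟩)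
        · exact Or.inr h1
    have h6 := incE_add_parents (G := G) (A := insert b W) (O := W) (P := {b}) (fun _ => x)
      (fun z => if z = b then 1 else 0) (subset_insert _ _) (by simpa using h5.symm)
      (by simp [h5.ne]) (by simp) (by simp [sW.x_notMem, hxW])
    have h7 := incE_add_le (G := G) (A := U) (B := insert b W) fun p hp q hq => by
      rcases mem_insert.1 hq with rfl | hq
      · refine ⟨ne_of_mem_of_not_mem hp hbU, fun hpq => ?_⟩
        rcases sU.nbr p hp _ hpq with h1 | h1 | h1
        · exact hbU h1
        · exact hb h1
        · exact h5.ne h1.symm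
      · exact hUW p hp q hq
    rw [card_singleton] at h6
    omega

lemma Low.exists_sides (hL : Low G) : ∃ U W u w v x x', Sides G U W u w v x x' := by
  have hc := hL.conn
  obtain ⟨v, u, w, h, hu, hw⟩ := hL.exists_good
  obtain ⟨a, b, ha, hb, hab, hcase, hall⟩ := hL.exists_crossing h hu hw
  obtain ⟨hdu, hdw⟩ := hL.not_adj h hu hw
  have hdv := h.dd_v
  have hdw' : dd G w u w = -2 := by rw [dd_symm, hdw]
  have hdu' : dd G w u u = 2 := by rw [dd_symm, hdu]; rfl
  obtain ⟨x, hx, hxd, hxs, hparity⟩ : ∃ x, x ≠ v ∧ dd G u w b = dd G u w x * (-1) ∧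
      (∀ z, z ≠ v → z ≠ x → z ≠ b → dd G u w z = 2 ∨ dd G u w z = -2) ∧
      (dd G u w x = 0 ∧ x = b ∨ dd G u w x = -1 ∧ G.Adj x b) := by
    rcases hcase with ⟨h1, h2⟩ | ⟨h1, h2⟩
    · refine ⟨b, hb, by rw [h2]; rfl, fun z hz hz1 _ => ?_, Or.inl ⟨h2, rfl⟩⟩
      by_cases h3 : z = a
      · subst h3; exact Or.inr h1
      · exact hall z hz h3 hz1
    · exact ⟨a, ha, by rw [h1, h2]; rfl, hall, Or.inr ⟨h1, hab⟩⟩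
  set U := univ.filter fun z => z ≠ v ∧ dd G u w z = -2 with hU
  set W := univ.filter fun z => z ≠ v ∧ dd G w u z = -2 with hW
  have hUm : ∀ z, z ∈ U ↔ z ≠ v ∧ dd G u w z = -2 := by intro z; simp [U]
  have hWm : ∀ z, z ∈ W ↔ z ≠ v ∧ dd G u w z = 2 := by
    intro z; simp [W, dd_symm (u := u) (w := w), neg_eq_iff_eq_neg]
  have sU : Side G U u v x := by
    refine side_of_dd hc h hx (by omega) hdu hdw fun z hz hz1 hz2 => ?_
    by_cases h3 : z = b
    · subst h3
      rcases hparity with ⟨_, h4⟩ | ⟨h4, _⟩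
      · exact absurd h4.symm hz2
      · omega
    · have := hxs z hz hz2 h3; omega
  have sW : Side G W w v b := by
    refine side_of_dd hc h.symm hb (by rw [dd_symm]; omega) hdw' hdu' fun z hz hz1 hz2 => ?_
    rw [dd_symm] at hz1 ⊢
    by_cases h3 : z = x
    · subst h3
      rcases hparity with ⟨_, h4⟩ | ⟨h4, _⟩
      · exact absurd h4 hz2
      · omega
    · have := hxs z hz h3 hz2; omega
  have hxW : x ∉ W := by rw [hWm]; omega
  have hbU : b ∉ U := by rw [hUm]; omega
  have hdis : ∀ a ∈ U, a ∉ W := by intro a; rw [hUm, hWm]; omega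
  have hcov : ∀ z, z ∈ U ∨ z ∈ W ∨ z = v ∨ z = x ∨ z = b := by
    intro z
    rw [hUm, hWm]
    by_contra! hz
    have := hxs z hz.2.2.1 hz.2.2.2.1 hz.2.2.2.2
    tauto
  have hUW : ∀ a ∈ U, ∀ b ∈ W, a ≠ b ∧ ¬ G.Adj a b := by
    intro a ha b hb
    refine ⟨fun hab => hdis a ha (hab ▸ hb), fun hab => ?_⟩
    have := dd_adj hc u w hab.symm
    rw [hUm] at ha
    rw [hWm] at hb
    omega
  have hpt : ∀ z, dd G u w z = (if z = x then dd G u w x else 0) -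
      (if z = b then dd G u w x else 0) + 2 * (if z ∈ W then 1 else 0) -
      2 * (if z ∈ U then 1 else 0) := by
    intro z
    by_cases hzv : z = v
    · subst hzv
      simp [hdv, hx.symm, hb.symm, sU.v_notMem, sW.v_notMem]
    by_cases h1 : z = x
    · subst h1
      rcases hparity with ⟨h4, h5⟩ | ⟨h4, h5⟩
      · simp [h4, hxW, sU.x_notMem]
      · simp [hxW, sU.x_notMem, h5.ne]
    by_cases h2 : z = b
    · subst h2
      simp [hbU, sW.x_notMem, h1, hxd]
    have h3 := hxs z hzv h1 h2
    have h4 := hUm z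
    have h5 := hWm z
    rcases h3 with h3 | h3 <;> simp [h1, h2, h3, h4, h5, hzv]
  have hcard : U.card = W.card := by
    have h1 : ∑ z, dd G u w z = 0 := by
      have : tr G u - tr G w = 0 := by omega
      rw [← this]; unfold dd tr; rw [sum_sub_distrib]
    rw [sum_congr rfl fun z _ => hpt z] at h1
    simp only [sum_add_distrib, sum_sub_distrib, ← mul_sum, sum_boole, sum_ite_eq', mem_univ,
      if_true, filter_mem_eq_inter, univ_inter] at h1
    omega
  have hdist : G.dist v x = G.dist v b := by
    rcases hparity with ⟨_, rfl⟩ | ⟨h4, h5⟩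
    · rfl
    · rw [h.dist hc hx, h.dist hc hb]
      have h6 := dist_le_of_adj hc h5 u
      have h7 := dist_le_of_adj hc h5.symm w
      have h6' := dist_le_of_adj hc h5.symm u
      have h7' := dist_le_of_adj hc h5 w
      simp only [G.dist_comm (v := u), G.dist_comm (v := w)] at *
      unfold dd at h4 hxd
      omega
  obtain ⟨h1, h2⟩ := sides_count hL.edges sU sW hdis hxW hbU hcard hcov hUW
    (hparity.imp (fun h => h.2) fun h => h.2)
  exact ⟨U, W, u, w, v, x, b, h, sU, sW, hdis, hxW, hbU, hcard, hcov, hdist, h1, h2⟩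

end

section
variable {V : Type*} [Fintype V] {G : SimpleGraph V}

/-- `U` is attached to the rest of the graph through `s` and `t`. -/
structure Strip (G : SimpleGraph V) (U : Finset V) (s t : V) : Prop where
  s_notMem : s ∉ U
  t_notMem : t ∉ U
  nbr : ∀ a ∈ U, ∀ b, G.Adj a b → b ∈ U ∨ b = s ∨ b = t

lemma Strip.symm {U : Finset V} {s t : V} (h : Strip G U s t) : Strip G U t s :=
  ⟨h.t_notMem, h.s_notMem, fun a ha b hb => (h.nbr a ha b hb).imp_right Or.symm⟩

lemma Side.strip {U : Finset V} {u v x : V} (h : Side G U u v x) : Strip G U v x :=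
  ⟨h.v_notMem, h.x_notMem, h.nbr⟩

/-- `y` lies on a geodesic from `s` to `t`. -/
def Geo (G : SimpleGraph V) (s t y : V) : Prop := G.dist y s + G.dist y t = G.dist s t

lemma Geo.symm {s t y : V} (h : Geo G s t y) : Geo G t s y := by
  unfold Geo at *; rw [G.dist_comm (u := t)]; omega

lemma geo_left {s t : V} : Geo G s t s := by simp [Geo]

lemma geo_right {s t : V} : Geo G s t t := by simp [Geo, G.dist_comm]

lemma dist_le_sum (hc : G.Connected) (s t y : V) : G.dist s t ≤ G.dist y s + G.dist y t := by
  rw [G.dist_comm (u := y) (v := s)]; exact hc.dist_triangle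

lemma Strip.step {U : Finset V} {s t : V} (h : Strip G U s t) (hc : G.Connected) {z : V}
    (hz : z ∈ U) (hg : Geo G s t z) :
    ∃ b, G.Adj z b ∧ (b ∈ U ∨ b = t) ∧ Geo G s t b ∧ G.dist b t + 1 = G.dist z t := by
  obtain ⟨b, hb, h1⟩ := exists_parent hc (ne_of_mem_of_not_mem hz h.t_notMem)
  have h2 := dist_le_of_adj hc hb.symm s
  have h3 := dist_le_sum hc s t b
  have h4 := hc.pos_dist_of_ne (ne_of_mem_of_not_mem hz h.s_notMem)
  unfold Geo at *
  refine ⟨b, hb, ?_, by omega, h1⟩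
  rcases h.nbr z hz b hb with h5 | rfl | h5
  · exact Or.inl h5
  · omega
  · exact Or.inr h5

lemma Strip.chain {U : Finset V} {s t : V} (h : Strip G U s t) (hc : G.Connected)
    {P : V → Prop} (ht : ¬ P t) {z : V} (hz : z ∈ U) (hg : Geo G s t z) (hP : P z) :
    ∃ a ∈ U, ∃ b, (b ∈ U ∨ b = t) ∧ G.Adj a b ∧ P a ∧ ¬ P b ∧ Geo G s t a ∧ Geo G s t b ∧
      G.dist b t + 1 = G.dist a t ∧ G.dist a t ≤ G.dist z t := by
  induction hk : G.dist z t generalizing z with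
  | zero => exact absurd (hc.dist_eq_zero_iff.1 hk) (ne_of_mem_of_not_mem hz h.t_notMem)
  | succ k ih =>
    obtain ⟨b, hb, hbU, hbg, h1⟩ := h.step hc hz hg
    by_cases hPb : P b
    · rcases hbU with hbU | rfl
      · obtain ⟨a, ha, c, hc', h2⟩ := ih hbU hbg hPb (by omega)
        refine ⟨a, ha, c, hc', h2.1, h2.2.1, h2.2.2.1, h2.2.2.2.1, h2.2.2.2.2.1, h2.2.2.2.2.2.1, ?_⟩
        omega
      · exact absurd hPb ht
    · exact ⟨z, hz, b, hbU, hb, hP, hPb, hg, hbg, h1, by omega⟩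

section SideLemmas

variable {U : Finset V} {u v x : V}

lemma Side.geo (hS : Side G U u v x) : Geo G v x u := by
  have := hS.dist
  have := dist_self_adj hS.adj.symm
  unfold Geo; omega

/-- A geodesic from `v` to `x` inside the side. -/
lemma Side.full_chain (hS : Side G U u v x) (hc : G.Connected) (P : V → Prop) (hv : P v)
    (hx : ¬ P x) : ∃ a b, (a ∈ U ∨ a = v) ∧ (b ∈ U ∨ b = x) ∧ G.Adj a b ∧ P a ∧ ¬ P b ∧
      Geo G v x a ∧ Geo G v x b := by
  by_cases hu : P u
  · obtain ⟨a, ha, b, hb, h1, h2, h3, h4, h5, -⟩ := hS.strip.chain hc hx hS.mem hS.geo hu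
    exact ⟨a, b, Or.inl ha, hb, h1, h2, h3, h4, h5⟩
  · exact ⟨v, u, Or.inr rfl, Or.inl hS.mem, hS.adj, hv, hu, geo_left, hS.geo⟩

lemma Side.exists_level (hS : Side G U u v x) (hc : G.Connected) {l : ℕ} (h1 : 1 ≤ l)
    (h2 : l < G.dist v x) : ∃ y ∈ U, G.dist y v = l ∧ Geo G v x y := by
  obtain ⟨a, ha, b, hb, hab, h3, h4, h5, h6, h7, -⟩ := hS.strip.chain hc
    (P := fun z => G.dist z v ≤ l) (by rw [G.dist_comm]; omega) hS.mem hS.geo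
    (by rw [dist_self_adj hS.adj.symm]; exact h1)
  refine ⟨a, ha, ?_, h5⟩
  unfold Geo at h5 h6
  omega

lemma Side.two_le_dist (hS : Side G U u v x) (hc : G.Connected) : 2 ≤ G.dist v x := by
  have h1 := hc.pos_dist_of_ne hS.ne
  have h2 : G.dist v x ≠ 1 := fun h => hS.nadj (SimpleGraph.dist_eq_one_iff_adj.1 h)
  omega

lemma Side.exists_top (hS : Side G U u v x) (hc : G.Connected) :
    ∃ t ∈ U, G.Adj x t ∧ Geo G v x t ∧ G.dist t v + 1 = G.dist v x := by
  have h2 := hS.two_le_dist hc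
  obtain ⟨t, ht, h3, h4⟩ := hS.exists_level hc (l := G.dist v x - 1) (by omega) (by omega)
  have h5 : G.dist t x = 1 := by unfold Geo at h4; omega
  exact ⟨t, ht, (SimpleGraph.dist_eq_one_iff_adj.1 h5).symm, h4, by omega⟩

/-- The vertices of `U` that lie on no geodesic between the ends. -/
noncomputable def off (G : SimpleGraph V) (U : Finset V) (v x : V) : Finset V :=
  U.filter fun y => ¬ Geo G v x y

lemma Side.incE_off (hS : Side G U u v x) (hc : G.Connected) :
    incE G (off G U v x) + U.card + 1 ≤ incE G U + (off G U v x).card := by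
  have key : ∀ a, ∃ b, (a ∈ U ∧ Geo G v x a ∨ a = x) →
      G.Adj a b ∧ G.dist b v < G.dist a v ∧ Geo G v x b ∧ (a = x → b ∈ U) := by
    intro a
    by_cases h : a ∈ U ∧ Geo G v x a ∨ a = x
    · rcases h with ⟨h1, h2⟩ | rfl
      · obtain ⟨b, hb, -, hg, hd⟩ := hS.strip.symm.step hc h1 h2.symm
        exact ⟨b, fun _ => ⟨hb, by omega, hg.symm,
          fun h => absurd (h ▸ h1) hS.x_notMem⟩⟩
      · obtain ⟨t, ht, h3, h4, h5⟩ := hS.exists_top hc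
        exact ⟨t, fun _ => ⟨h3, by rw [G.dist_comm (u := a)]; omega, h4, fun _ => ht⟩⟩
    · exact ⟨a, fun h' => absurd h' h⟩
  choose p hp using key
  have hmem : ∀ a ∈ insert x (U \ off G U v x), a ∈ U ∧ Geo G v x a ∨ a = x := by
    intro a ha
    simp only [mem_insert, mem_sdiff, off, mem_filter, not_and, not_not] at ha
    rcases ha with rfl | h
    · exact Or.inr rfl
    · exact Or.inl ⟨h.1, h.2 h.1⟩
  have h1 := incE_add_parents (G := G) (A := U) (O := off G U v x)
    (P := insert x (U \ off G U v x)) p (fun a => G.dist a v) (filter_subset _ _)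
    (fun a ha => (hp a (hmem a ha)).1) (fun a ha => (hp a (hmem a ha)).2.1)
    (fun a ha => by
      rcases hmem a ha with h | h
      · exact Or.inl h.1
      · exact Or.inr ((hp a (hmem a ha)).2.2.2 h))
    (fun a ha => by
      refine ⟨fun h => ?_, fun h => (mem_filter.1 h).2 (hp a (hmem a ha)).2.2.1⟩
      rcases hmem a ha with h2 | rfl
      · exact (mem_filter.1 h).2 h2.2
      · exact hS.x_notMem (mem_filter.1 h).1)
  have hsub : off G U v x ⊆ U := filter_subset _ _
  rw [card_insert_of_notMem (by simp [hS.x_notMem]), card_sdiff_of_subset hsub] at h1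
  have h2 := card_le_card hsub
  omega

end SideLemmas

lemma sum_inner_eq_bdry (O : Finset V) (f : V → ℤ) :
    ∑ y ∈ O, ∑ g ∈ nb G y, (f y - f g) = ∑ y ∈ O, ∑ g ∈ (nb G y).filter (· ∉ O), (f y - f g) := by
  have h : ∑ y ∈ O, ∑ g ∈ (nb G y).filter (· ∈ O), (f y - f g) = 0 := by
    have h1 : ∑ y ∈ O, ∑ g ∈ (nb G y).filter (· ∈ O), (f y - f g) =
        ∑ y ∈ O, ∑ g ∈ O, if G.Adj y g then f y - f g else 0 := by
      refine sum_congr rfl fun y _ => ?_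
      rw [← sum_filter]
      exact sum_congr (by ext; simp [and_comm]) fun _ _ => rfl
    have h2 : ∑ y ∈ O, ∑ g ∈ O, (if G.Adj y g then f y - f g else 0) =
        - ∑ y ∈ O, ∑ g ∈ O, if G.Adj y g then f y - f g else 0 := by
      conv_lhs => rw [sum_comm]
      simp only [← sum_neg_distrib]
      refine sum_congr rfl fun y _ => sum_congr rfl fun g _ => ?_
      simp only [G.adj_comm g y]
      split_ifs <;> ring
    omega
  rw [← add_zero (∑ y ∈ O, ∑ g ∈ (nb G y).filter (· ∉ O), (f y - f g)), ← h, ← sum_add_distrib]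
  refine sum_congr rfl fun y _ => ?_
  rw [add_comm, sum_filter_add_sum_filter_not]

/-- Two boundary edges leave any proper part of a 2-connected graph. -/
lemma Low.two_le_bdry (hL : Low G) {O : Finset V} (hO : O.Nonempty) {s t : V} (hs : s ∉ O)
    (ht : t ∉ O) (hst : s ≠ t) : 2 ≤ bdry G O := by
  obtain ⟨a, ha, b, hb, hbs, hab⟩ := hL.noCut hO hs ⟨t, ht, hst.symm⟩
  obtain ⟨a', ha', b', hb', hbb, hab'⟩ := hL.noCut hO hb ⟨s, hs, hbs.symm⟩
  have h1 : ∀ y ∈ O, (if y = a then 1 else 0) + (if y = a' then 1 else 0) ≤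
      ((nb G y).filter (· ∉ O)).card := by
    intro y _
    have hpos : ∀ c, G.Adj y c → c ∉ O → 1 ≤ ((nb G y).filter (· ∉ O)).card := fun c h1 h2 =>
      card_pos.2 ⟨c, by simp [h1, h2]⟩
    by_cases h1 : y = a <;> by_cases h2 : y = a'
    · subst h1; subst h2
      have : ({b, b'} : Finset V) ⊆ (nb G y).filter (· ∉ O) := by
        intro z; simp only [mem_insert, mem_singleton]
        rintro (rfl | rfl) <;> simp [*]
      simpa [card_pair hbb.symm] using card_le_card this
    · subst h1; simpa [h2] using hpos b hab hb
    · subst h2; simpa [h1] using hpos b' hab' hb'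
    · simp [h1, h2]
  have h2 := sum_le_sum h1
  rw [sum_add_distrib, sum_ite_eq' , sum_ite_eq'] at h2
  rw [bdry]
  simpa [ha, ha'] using h2

/-- Curvature inside a strip. -/
lemma Low.two_le_sum_strip (hL : Low G) {U : Finset V} {s t y p q : V} (hS : Strip G U s t)
    (hy : y ∈ U) (h : Two G y p q)
    (hch : ∀ P : V → Prop, P s → ¬ P t → ∃ a b, (a ∈ U ∨ a = s) ∧ (b ∈ U ∨ b = t) ∧ a ≠ y ∧ b ≠ y ∧
      G.Adj a b ∧ P a ∧ ¬ P b) :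
    2 ≤ ∑ z ∈ (insert s (insert t U)).erase y, curv G y z := by
  refine h.two_le_sum hL.conn (by simp) fun P hp hq => ?_
  have hmem : ∀ z, z ∈ (insert s (insert t U)).erase y ↔ z ≠ y ∧ (z ∈ U ∨ z = s ∨ z = t) := by
    intro z; simp only [mem_erase, mem_insert]; tauto
  simp only [hmem]
  have hsy : s ≠ y := (ne_of_mem_of_not_mem hy hS.s_notMem).symm
  have hty : t ≠ y := (ne_of_mem_of_not_mem hy hS.t_notMem).symm
  have hp' := hS.nbr y hy p h.left
  have hq' := hS.nbr y hy q h.right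
  by_cases hs : P s <;> by_cases ht : P t
  · obtain ⟨a, ha, b, hb, hby, hab⟩ := hL.noCut (A := U.filter fun z => z ≠ y ∧ ¬ P z) (g := y)
      ⟨q, by
        simp only [mem_filter]
        refine ⟨?_, h.right.ne', hq⟩
        rcases hq' with h1 | rfl | rfl
        · exact h1
        · exact absurd hs hq
        · exact absurd ht hq⟩ (by simp) ⟨s, by simp [hs], hsy⟩
    simp only [mem_filter, not_and, not_not] at ha hb
    have hbm := hS.nbr a ha.1 b hab
    refine ⟨b, ⟨hby, hbm⟩, a, ⟨ha.2.1, Or.inl ha.1⟩, hab.symm, ?_, ha.2.2⟩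
    rcases hbm with h1 | rfl | rfl
    · exact hb h1 hby
    · exact hs
    · exact ht
  · obtain ⟨a, b, h1, h2, h3, h4, h5⟩ := hch P hs ht
    exact ⟨a, ⟨h3, by tauto⟩, b, ⟨h4, by tauto⟩, h5⟩
  · obtain ⟨a, b, h1, h2, h3, h4, h5, h6, h7⟩ := hch (fun z => ¬ P z) hs (not_not.2 ht)
    exact ⟨b, ⟨h4, by tauto⟩, a, ⟨h3, by tauto⟩, h5.symm, not_not.1 h7, h6⟩
  · obtain ⟨a, ha, b, hb, hby, hab⟩ := hL.noCut (A := U.filter fun z => z ≠ y ∧ P z) (g := y)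
      ⟨p, by
        simp only [mem_filter]
        refine ⟨?_, h.left.ne', hp⟩
        rcases hp' with h1 | rfl | rfl
        · exact h1
        · exact absurd hp hs
        · exact absurd hp ht⟩ (by simp) ⟨s, by simp [hs], hsy⟩
    simp only [mem_filter, not_and] at ha hb
    have hbm := hS.nbr a ha.1 b hab
    refine ⟨a, ⟨ha.2.1, Or.inl ha.1⟩, b, ⟨hby, hbm⟩, hab, ha.2.2, ?_⟩
    rcases hbm with h1 | rfl | rfl
    · exact hb h1 hby
    · exact hs
    · exact ht

end

section
variable {V : Type*} [Fintype V] {G : SimpleGraph V} {U : Finset V} {u v x : V}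

lemma mem_off {y : V} : y ∈ off G U v x ↔ y ∈ U ∧ ¬ Geo G v x y := by simp [off]

lemma Side.geo_of_off_nbr (hS : Side G U u v x) {y g : V} (hy : y ∈ off G U v x) (h : G.Adj y g)
    (hg : g ∉ off G U v x) : Geo G v x g := by
  rw [mem_off] at hy hg
  rcases hS.nbr y hy.1 g h with h1 | rfl | rfl
  · by_contra h2; exact hg ⟨h1, h2⟩
  · exact geo_left
  · exact geo_right

lemma Side.off_term_nonneg (hS : Side G U u v x) (hc : G.Connected) {y g z : V}
    (hy : y ∈ off G U v x) (h : G.Adj y g) (hg : g ∉ off G U v x) (hz : z ∉ U) :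
    G.dist g z ≤ G.dist y z := by
  have h1 := hS.geo_of_off_nbr hy h hg
  rw [mem_off] at hy
  have h2 := dist_le_sum hc v x y
  have h3 := dist_le_of_adj hc h v
  have h4 := dist_le_of_adj hc h x
  have t1 := hc.dist_triangle (u := g) (v := v) (w := z)
  have t2 := hc.dist_triangle (u := g) (v := x) (w := z)
  unfold Geo at *
  rcases dist_separator hc hS.nbr hz hy.1 with h5 | h5 <;> omega

/-- Across the boundary of the off-geodesic part, distances to outside vertices grow. -/
lemma Side.one_le_sum_curv_off (hS : Side G U u v x) (hc : G.Connected)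
    (hne : (off G U v x).Nonempty) {z : V} (hz : z ∉ U) :
    1 ≤ ∑ y ∈ off G U v x, curv G y z := by
  have h0 := sum_inner_eq_bdry (G := G) (off G U v x) fun y => (G.dist y z : ℤ)
  unfold curv
  rw [h0]
  have key : (∃ y ∈ off G U v x, ∃ g, G.Adj y g ∧ g ∉ off G U v x ∧ G.dist g z < G.dist y z) →
      1 ≤ ∑ y ∈ off G U v x, ∑ g ∈ (nb G y).filter (· ∉ off G U v x),
        ((G.dist y z : ℤ) - G.dist g z) := by
    rintro ⟨y, hy, g, hg, hgO, hlt⟩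
    have hnn : ∀ y ∈ off G U v x, ∀ g ∈ (nb G y).filter (· ∉ off G U v x),
        0 ≤ (G.dist y z : ℤ) - G.dist g z := by
      intro y hy g hg
      simp only [mem_filter, mem_nb] at hg
      have := hS.off_term_nonneg hc hy hg.1 hg.2 hz
      omega
    have h1 := single_le_sum (fun y hy => sum_nonneg (hnn y hy)) hy
    have h2 := single_le_sum (hnn y hy) (show g ∈ _ by simp only [mem_filter, mem_nb]; exact ⟨hg, hgO⟩)
    omega
  by_contra hlt
  have hno : ∀ y ∈ off G U v x, ∀ g, G.Adj y g → g ∉ off G U v x → G.dist y z ≤ G.dist g z := by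
    by_contra! h
    exact hlt (key h)
  obtain ⟨y2, hy2, hmin2⟩ := exists_min_image _ (fun y => G.dist y v) hne
  obtain ⟨y1, hy1, hmin1⟩ := exists_min_image _ (fun y => G.dist y x) hne
  have hU2 := (mem_off.1 hy2).1
  have hU1 := (mem_off.1 hy1).1
  obtain ⟨g2, hg2, hd2⟩ := exists_parent hc (ne_of_mem_of_not_mem hU2 hS.v_notMem)
  obtain ⟨g1, hg1, hd1⟩ := exists_parent hc (ne_of_mem_of_not_mem hU1 hS.x_notMem)
  have e2 := hno y2 hy2 g2 hg2 (fun h => by have := hmin2 g2 h; omega)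
  have e1 := hno y1 hy1 g1 hg1 (fun h => by have := hmin1 g1 h; omega)
  have m2 := hmin2 y1 hy1
  have m1 := hmin1 y2 hy2
  have t1 := hc.dist_triangle (u := g2) (v := v) (w := z)
  have t2 := hc.dist_triangle (u := g1) (v := x) (w := z)
  rcases dist_separator hc hS.nbr hz hU2 with h5 | h5 <;>
    rcases dist_separator hc hS.nbr hz hU1 with h6 | h6 <;> omega

/-- On a sparse side every vertex lies on a geodesic between the ends. -/
lemma Low.off_empty (hL : Low G) (hS : Side G U u v x) (hn : U.card + 9 ≤ Fintype.card V)
    (hs : incE G U ≤ U.card + 2) : ∀ y ∈ U, Geo G v x y := by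
  have hc := hL.conn
  by_contra! hno
  obtain ⟨y0, hy0, hy0g⟩ := hno
  set O := off G U v x with hOdef
  have hne : O.Nonempty := ⟨y0, mem_off.2 ⟨hy0, hy0g⟩⟩
  have hOU : ∀ y ∈ O, y ∈ U := fun y hy => (mem_off.1 hy).1
  have hvO : v ∉ O := fun h => hS.v_notMem (hOU v h)
  have hxO : x ∉ O := fun h => hS.x_notMem (hOU x h)
  have h1 := hS.incE_off hc
  rw [← hOdef] at h1
  have h2 := hL.two_le_bdry hne hvO hxO hS.ne
  have h3 := sum_deg_add_bdry (G := G) O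
  have h4 : ∑ a ∈ O, 2 ≤ ∑ a ∈ O, (nb G a).card := sum_le_sum fun a _ => hL.two_le_deg a
  have h4' : ∑ a ∈ O, 2 = 2 * O.card := by rw [sum_const, smul_eq_mul, mul_comm]
  have h5 : bdry G O = 2 := by omega
  have h6 : ∀ a ∈ O, 2 = (nb G a).card :=
    (sum_eq_sum_iff_of_le fun a _ => hL.two_le_deg a).1 (by omega)
  have hcurv : ∀ y ∈ O, 0 ≤ ∑ z ∈ insert v (insert x U), curv G y z := by
    intro y hy
    obtain ⟨p, q, htwo⟩ := exists_two (h6 y hy).symm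
    have h7 := hL.two_le_sum_strip hS.strip (hOU y hy) htwo (by
      intro P hPv hPx
      obtain ⟨a, b, ha, hb, hab, h8, h9, h10, h11⟩ := hS.full_chain hc P hPv hPx
      exact ⟨a, b, ha, hb, fun h => (mem_off.1 hy).2 (h ▸ h10), fun h => (mem_off.1 hy).2 (h ▸ h11),
        hab, h8, h9⟩)
    rw [← add_sum_erase _ _ (show y ∈ insert v (insert x U) by simp [hOU y hy]), curv_self,
      htwo.card]
    push_cast
    linarith
  have hout : (7 : ℤ) ≤ ∑ z ∈ (insert v (insert x U))ᶜ, ∑ y ∈ O, curv G y z := by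
    have h7 : ∑ z ∈ (insert v (insert x U))ᶜ, (1 : ℤ) ≤
        ∑ z ∈ (insert v (insert x U))ᶜ, ∑ y ∈ O, curv G y z := by
      refine sum_le_sum fun z hz => hS.one_le_sum_curv_off hc hne ?_
      simp only [mem_compl, mem_insert, not_or] at hz
      exact hz.2.2
    refine le_trans ?_ h7
    have h8 := card_add_card_compl (insert v (insert x U))
    have h9 := card_insert_le v (insert x U)
    have h10 := card_insert_le x U
    simp only [sum_const, nsmul_eq_mul, mul_one]
    omega
  have htot : (7 : ℤ) ≤ ∑ y ∈ O, ∑ g ∈ (nb G y).filter (· ∉ O), (tr G y - tr G g) := by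
    rw [← sum_inner_eq_bdry O (tr G)]
    simp only [← sum_curv]
    have h7 := sum_nonneg hcurv
    rw [sum_comm] at hout
    rw [← sum_congr rfl fun y _ => sum_add_sum_compl (insert v (insert x U)) (curv G y),
      sum_add_distrib]
    linarith
  have hsq : ∑ y ∈ O, ∑ g ∈ (nb G y).filter (· ∉ O), (6 * (tr G y - tr G g) - 9) ≤
      ∑ y ∈ O, ∑ g ∈ (nb G y).filter (· ∉ O), (tr G y - tr G g) ^ 2 :=
    sum_le_sum fun y _ => sum_le_sum fun g _ => by nlinarith [sq_nonneg (tr G y - tr G g - 3)]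
  have hlin : ∑ y ∈ O, ∑ g ∈ (nb G y).filter (· ∉ O), (6 * (tr G y - tr G g) - 9) =
      6 * ∑ y ∈ O, ∑ g ∈ (nb G y).filter (· ∉ O), (tr G y - tr G g) -
        9 * ∑ y ∈ O, (((nb G y).filter (· ∉ O)).card : ℤ) := by
    rw [mul_sum, mul_sum, ← sum_sub_distrib]
    refine sum_congr rfl fun y _ => ?_
    rw [sum_sub_distrib, ← mul_sum, sum_const, nsmul_eq_mul]
    ring
  have h8 : ∑ y ∈ O, (((nb G y).filter (· ∉ O)).card : ℤ) = 2 := by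
    have : ((bdry G O : ℕ) : ℤ) = 2 := by rw [h5]; rfl
    rw [← this, bdry]; push_cast; rfl
  rw [hlin, h8] at hsq
  have h9 := cut_energy (G := G) O
  have h10 := hL.small
  linarith

end

section
variable {V : Type*} [Fintype V] {G : SimpleGraph V} {U : Finset V} {u v x : V}

/-- The vertices of `U` at distance `l` from `s`. -/
noncomputable def lvl (G : SimpleGraph V) (U : Finset V) (s : V) (l : ℕ) : Finset V :=
  U.filter fun z => G.dist z s = l

/-- The vertices of `U` that share their distance from `s` with another vertex of `U`. -/
noncomputable def multi (G : SimpleGraph V) (U : Finset V) (s : V) : Finset V :=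
  U.filter fun y => ∃ z ∈ U, z ≠ y ∧ G.dist z s = G.dist y s

lemma mem_lvl {s z : V} {l : ℕ} : z ∈ lvl G U s l ↔ z ∈ U ∧ G.dist z s = l := by simp [lvl]

lemma mem_multi {s y : V} :
    y ∈ multi G U s ↔ y ∈ U ∧ ∃ z ∈ U, z ≠ y ∧ G.dist z s = G.dist y s := by simp [multi]

lemma dist_eq_iff_of_geo {s t y z : V} (hy : Geo G s t y) (hz : Geo G s t z) :
    G.dist y s = G.dist z s ↔ G.dist y t = G.dist z t := by
  unfold Geo at *; omega

lemma multi_comm {s t : V} (hg : ∀ y ∈ U, Geo G s t y) : multi G U s = multi G U t := by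
  ext y
  simp only [mem_multi]
  refine and_congr_right fun hy => exists_congr fun z => and_congr_right fun hz => ?_
  rw [dist_eq_iff_of_geo (hg z hz) (hg y hy)]

lemma two_le_card_lvl {s y : V} (h : y ∈ multi G U s) : 2 ≤ (lvl G U s (G.dist y s)).card := by
  obtain ⟨hy, z, hz, hne, hd⟩ := mem_multi.1 h
  rw [← card_pair hne]
  refine card_le_card fun a => ?_
  simp only [mem_insert, mem_singleton, mem_lvl]
  rintro (rfl | rfl)
  · exact ⟨hz, hd⟩
  · exact ⟨hy, rfl⟩

/-- The first multiple level hangs on a single vertex. -/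
lemma Strip.bottom {s t : V} (h : Strip G U s t) (hc : G.Connected) (hg : ∀ y ∈ U, Geo G s t y)
    {y : V} (hy : y ∈ multi G U s) (hmin : ∀ z ∈ multi G U s, G.dist y s ≤ G.dist z s) :
    ∃ p, (p ∈ U ∨ p = s) ∧ G.dist p s + 1 = G.dist y s ∧
      (∀ z ∈ lvl G U s (G.dist y s), G.Adj p z) ∧
      (p ∈ U → (lvl G U s (G.dist y s)).card + 1 ≤ (nb G p).card ∧ p ∉ multi G U s) := by
  have hyU := (mem_multi.1 hy).1
  obtain ⟨p, hp, hpU, -, hd⟩ := h.symm.step hc hyU (hg y hyU).symm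
  have hpm : p ∉ multi G U s := fun hp => by have := hmin p hp; omega
  have hadj : ∀ z ∈ lvl G U s (G.dist y s), G.Adj p z := by
    intro z hz
    rw [mem_lvl] at hz
    obtain ⟨p', hp', hpU', -, hd'⟩ := h.symm.step hc hz.1 (hg z hz.1).symm
    by_cases heq : p' = p
    · subst heq; exact hp'.symm
    · exfalso
      rcases hpU with hpU | rfl
      · rcases hpU' with hpU' | rfl
        · exact hpm (mem_multi.2 ⟨hpU, p', hpU', heq, by omega⟩)
        · rw [SimpleGraph.dist_self] at hd'
          exact h.s_notMem (hc.dist_eq_zero_iff.1 (show G.dist p p' = 0 by omega) ▸ hpU)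
      · rw [SimpleGraph.dist_self] at hd
        exact heq (hc.dist_eq_zero_iff.1 (by omega))
  refine ⟨p, hpU, hd, hadj, fun hpU => ⟨?_, hpm⟩⟩
  obtain ⟨p2, hp2, -, -, hd2⟩ := h.symm.step hc hpU (hg p hpU).symm
  have hnot : p2 ∉ lvl G U s (G.dist y s) := by rw [mem_lvl]; omega
  rw [← card_insert_of_notMem hnot]
  refine card_le_card fun a => ?_
  rw [mem_insert, mem_nb]
  rintro (rfl | ha)
  · exact hp2
  · exact hadj a ha

lemma Side.bdry_eq (hS : Side G U u v x) : bdry G U = 1 + (U.filter (G.Adj x)).card := by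
  have h1 : ∀ a ∈ U, ((nb G a).filter (· ∉ U)).card =
      (if a = u then 1 else 0) + (if G.Adj x a then 1 else 0) := by
    intro a ha
    have h2 : (nb G a).filter (· ∉ U) = ({v, x} : Finset V).filter (G.Adj a) := by
      ext b
      simp only [mem_filter, mem_nb, mem_insert, mem_singleton]
      constructor
      · rintro ⟨h3, h4⟩
        exact ⟨(hS.nbr a ha b h3).resolve_left h4, h3⟩
      · rintro ⟨rfl | rfl, h3⟩
        · exact ⟨h3, hS.v_notMem⟩
        · exact ⟨h3, hS.x_notMem⟩
    have h3 : G.Adj a v ↔ a = u :=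
      ⟨fun h => hS.only a ha h.symm, fun h => h ▸ hS.adj.symm⟩
    rw [h2, card_filter, sum_pair hS.ne]
    simp only [h3, G.adj_comm a x]
  rw [bdry, sum_congr rfl h1, sum_add_distrib, sum_ite_eq', card_filter]
  simp [hS.mem]

/-- The counting inequality for the multiple levels of a side. -/
lemma Low.multi_count (hL : Low G) (hS : Side G U u v x) (hg : ∀ y ∈ U, Geo G v x y)
    {y y' z : V} (hy : y ∈ multi G U v) (hmin : ∀ z ∈ multi G U v, G.dist y v ≤ G.dist z v)
    (hy' : y' ∈ multi G U v) (hmax : ∀ z ∈ multi G U v, G.dist z v ≤ G.dist y' v)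
    (hz : z ∈ multi G U v) :
    (lvl G U v (G.dist y v)).card + (lvl G U v (G.dist y' v)).card + (nb G z).card + 2 * U.card ≤
      2 * incE G U + 2 := by
  have hc := hL.conn
  have hyU := (mem_multi.1 hy).1
  have hyU' := (mem_multi.1 hy').1
  have hzU := (mem_multi.1 hz).1
  obtain ⟨p, hpU, hpd, hpa, hpc⟩ := hS.strip.bottom hc hg hy hmin
  have hpv : p ∈ U := by
    refine hpU.resolve_right ?_
    rintro rfl
    obtain ⟨-, b, hb, hby, hbd⟩ := mem_multi.1 hy
    have h1 := hS.only b hb (hpa b (mem_lvl.2 ⟨hb, hbd⟩))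
    have h2 := hS.only y hyU (hpa y (mem_lvl.2 ⟨hyU, rfl⟩))
    exact hby (h1.trans h2.symm)
  obtain ⟨hpc, hpm⟩ := hpc hpv
  have hg' : ∀ y ∈ U, Geo G x v y := fun y hy => (hg y hy).symm
  have hmc := multi_comm hg
  have hlv : lvl G U v (G.dist y' v) = lvl G U x (G.dist y' x) := by
    ext a
    simp only [mem_lvl]
    exact and_congr_right fun ha => dist_eq_iff_of_geo (hg a ha) (hg y' hyU')
  obtain ⟨q, hqU, hqd, hqa, hqc⟩ := hS.strip.symm.bottom hc hg' (hmc ▸ hy') (fun a ha => by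
    have h1 := hmax a (hmc ▸ ha)
    have h2 := hg a (mem_multi.1 ha).1
    have h3 := hg y' hyU'
    unfold Geo at h2 h3
    omega)
  rw [← hlv] at hqa hqc
  rw [← hmc] at hqc
  have hdeg := sum_deg_add_bdry (G := G) U
  rw [hS.bdry_eq] at hdeg
  have h2 := hL.two_le_deg z
  have hzp : z ≠ p := fun h => hpm (h ▸ hz)
  have hA := two_le_card_lvl hy
  have hA' := two_le_card_lvl hy'
  rcases hqU with hqU | rfl
  · obtain ⟨hqc, hqm⟩ := hqc hqU
    have hzq : z ≠ q := fun h => hqm (h ▸ hz)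
    have hpq : p ≠ q := by
      rintro rfl
      have h1 := hmax y hy
      have h2 := hg p hpv
      have h3 := hg y' hyU'
      unfold Geo at h2 h3
      omega
    obtain ⟨t, ht, hxt, -⟩ := hS.exists_top hc
    have hk : 1 ≤ (U.filter (G.Adj x)).card := card_pos.2 ⟨t, by simp [ht, hxt]⟩
    have hpt : ∀ a ∈ U, (2 + (if a = p then (nb G p).card - 2 else 0) +
        (if a = q then (nb G q).card - 2 else 0) + (if a = z then (nb G z).card - 2 else 0)) ≤
        (nb G a).card := by
      intro a _
      have := hL.two_le_deg a
      by_cases h1 : a = p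
      · subst h1; simp only [if_true, hpq, hzp.symm, if_false]; omega
      by_cases h2 : a = q
      · subst h2; simp only [if_true, hpq.symm, hzq.symm, if_false]; omega
      by_cases h3 : a = z
      · rw [if_neg h1, if_neg h2, if_pos h3, h3]; omega
      · simp only [h1, h2, h3, if_false]; omega
    have hsum := sum_le_sum hpt
    simp only [sum_add_distrib, sum_ite_eq', hpv, hqU, hzU, if_true, sum_const, smul_eq_mul] at hsum
    omega
  · have hk : (lvl G U v (G.dist y' v)).card ≤ (U.filter (G.Adj q)).card :=
      card_le_card fun a ha => mem_filter.2 ⟨(mem_lvl.1 ha).1, hqa a ha⟩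
    have hpt : ∀ a ∈ U, (2 + (if a = p then (nb G p).card - 2 else 0) +
        (if a = z then (nb G z).card - 2 else 0)) ≤ (nb G a).card := by
      intro a _
      have := hL.two_le_deg a
      by_cases h1 : a = p
      · subst h1; simp only [if_true, hzp.symm, if_false]; omega
      by_cases h3 : a = z
      · subst h3; simp only [if_true, h1, if_false]; omega
      · simp only [h1, h3, if_false]; omega
    have hsum := sum_le_sum hpt
    simp only [sum_add_distrib, sum_ite_eq', hpv, hzU, if_true, sum_const, smul_eq_mul] at hsum
    omega

lemma Side.level_bounds (hS : Side G U u v x) (hc : G.Connected) {y : V} (hy : y ∈ U)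
    (hg : Geo G v x y) : 1 ≤ G.dist y v ∧ G.dist y v < G.dist v x := by
  have h1 := hc.pos_dist_of_ne (ne_of_mem_of_not_mem hy hS.v_notMem)
  have h2 := hc.pos_dist_of_ne (ne_of_mem_of_not_mem hy hS.x_notMem)
  unfold Geo at hg
  omega

lemma Side.surj (hS : Side G U u v x) (hc : G.Connected) :
    Icc 1 (G.dist v x - 1) ⊆ U.image fun y => G.dist y v := by
  intro l hl
  rw [mem_Icc] at hl
  obtain ⟨y, hy, h1, -⟩ := hS.exists_level hc hl.1 (by omega)
  exact mem_image.2 ⟨y, hy, h1⟩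

/-- A short side is a path. -/
lemma Side.incE_le (hS : Side G U u v x) (hc : G.Connected) (h : U.card < G.dist v x) :
    incE G U ≤ U.card + 1 := by
  have h1 := card_le_card (hS.surj hc)
  have h2 : (U.image fun y => G.dist y v).card ≤ U.card := card_image_le
  rw [Nat.card_Icc] at h1
  have hinj : Set.InjOn (fun y => G.dist y v) (U : Set V) := by
    rw [← card_image_iff]; omega
  have himg := eq_of_subset_of_card_le (hS.surj hc) (by rw [Nat.card_Icc]; omega)
  have hlev : ∀ y ∈ U, 1 ≤ G.dist y v ∧ G.dist y v < G.dist v x := by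
    intro y hy
    have : G.dist y v ∈ Icc 1 (G.dist v x - 1) := by
      rw [himg]; exact mem_image_of_mem _ hy
    rw [mem_Icc] at this
    omega
  have hinj' : ∀ a b, (a ∈ U ∨ a = v ∨ a = x) → (b ∈ U ∨ b = v ∨ b = x) →
      G.dist a v = G.dist b v → a = b := by
    have hxv := G.dist_comm (u := x) (v := v)
    have hvv : G.dist v v = 0 := by simp
    rintro a b (ha | rfl | rfl) (hb | rfl | rfl) hab
    · exact hinj ha hb hab
    · have := hlev a ha; omega
    · have := hlev a ha; omega
    · have := hlev b hb; omega
    · rfl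
    · have := hS.two_le_dist hc; omega
    · have := hlev b hb; omega
    · have := hS.two_le_dist hc; omega
    · rfl
  have hdeg : ∀ y ∈ U, (nb G y).card ≤ 2 := by
    intro y hy
    have h3 : (nb G y).card = ((nb G y).image fun g => G.dist g v).card := by
      rw [card_image_of_injOn]
      intro a ha b hb hab
      exact hinj' a b (hS.nbr y hy a (by simpa using ha)) (hS.nbr y hy b (by simpa using hb)) hab
    have h4 : ((nb G y).image fun g => G.dist g v) ⊆ {G.dist y v - 1, G.dist y v + 1} := by
      intro l
      simp only [mem_image, mem_nb, mem_insert, mem_singleton]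
      rintro ⟨g, hg, rfl⟩
      have h5 := dist_le_of_adj hc hg v
      have h6 := dist_le_of_adj hc hg.symm v
      have h7 : G.dist g v ≠ G.dist y v := fun h8 =>
        hg.ne' (hinj' g y (hS.nbr y hy g hg) (Or.inl hy) h8)
      omega
    rw [h3]
    exact (card_le_card h4).trans card_le_two
  have hk : (U.filter (G.Adj x)).card ≤ 1 := by
    rw [card_le_one]
    intro a ha b hb
    simp only [mem_filter] at ha hb
    refine hinj ha.1 hb.1 ?_
    have ha1 := dist_le_of_adj hc ha.2 v
    have hb1 := dist_le_of_adj hc hb.2 v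
    have := hlev a ha.1
    have := hlev b hb.1
    have hxv := G.dist_comm (u := x) (v := v)
    dsimp only
    omega
  have h3 := sum_deg_add_bdry (G := G) U
  rw [hS.bdry_eq] at h3
  have h4 := sum_le_sum hdeg
  rw [sum_const, smul_eq_mul] at h4
  omega

/-- The shape of a side with exactly one extra edge. -/
structure Shape (G : SimpleGraph V) (U : Finset V) (v x : V) : Prop where
  geo : ∀ y ∈ U, Geo G v x y
  inc : incE G U = U.card + 2
  deg : ∀ y ∈ multi G U v, (nb G y).card = 2
  exists_min : ∃ y ∈ multi G U v, (∀ z ∈ multi G U v, G.dist y v ≤ G.dist z v) ∧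
    (lvl G U v (G.dist y v)).card = 2
  exists_max : ∃ y ∈ multi G U v, (∀ z ∈ multi G U v, G.dist z v ≤ G.dist y v) ∧
    (lvl G U v (G.dist y v)).card = 2

lemma Low.shape (hL : Low G) (hS : Side G U u v x) (hn : U.card + 9 ≤ Fintype.card V)
    (hs : incE G U ≤ U.card + 2) (hd : G.dist v x ≤ U.card) : Shape G U v x := by
  have hc := hL.conn
  have hg := hL.off_empty hS hn hs
  have hne : (multi G U v).Nonempty := by
    by_contra hemp
    rw [not_nonempty_iff_eq_empty] at hemp
    have h1 : U.card ≤ (Icc 1 (G.dist v x - 1)).card := by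
      refine card_le_card_of_injOn (fun y => G.dist y v) (fun y hy => ?_) fun a ha b hb hab => ?_
      · have := hS.level_bounds hc hy (hg y hy)
        simp only [coe_Icc, Set.mem_Icc]
        omega
      · by_contra hne
        have : b ∈ multi G U v := mem_multi.2 ⟨hb, a, ha, hne, hab⟩
        rw [hemp] at this
        exact absurd this (notMem_empty _)
    rw [Nat.card_Icc] at h1
    have := hS.two_le_dist hc
    omega
  obtain ⟨y, hy, hmin⟩ := exists_min_image _ (fun y => G.dist y v) hne
  obtain ⟨y', hy', hmax⟩ := exists_max_image _ (fun y => G.dist y v) hne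
  have key := fun z hz => hL.multi_count hS hg hy hmin hy' hmax (z := z) hz
  have h1 := two_le_card_lvl hy
  have h2 := two_le_card_lvl hy'
  have h3 := key y hy
  have h4 := hL.two_le_deg y
  refine ⟨hg, by omega, fun z hz => ?_, ⟨y, hy, hmin, by omega⟩, ⟨y', hy', hmax, by omega⟩⟩
  have := key z hz
  have := hL.two_le_deg z
  omega

lemma lvl_subset_multi {y : V} (hy : y ∈ multi G U v) :
    lvl G U v (G.dist y v) ⊆ multi G U v := by
  intro z hz
  obtain ⟨hyU, w, hw, hne, hd⟩ := mem_multi.1 hy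
  rw [mem_lvl] at hz
  by_cases h : z = y
  · subst h; exact hy
  · exact mem_multi.2 ⟨hz.1, y, hyU, Ne.symm h, hz.2.symm⟩

/-- A long side has at least four vertices on multiple levels. -/
lemma Shape.four_le (h : Shape G U v x) (hS : Side G U u v x) (hc : G.Connected)
    (hd : G.dist v x < U.card) : 4 ≤ (multi G U v).card := by
  obtain ⟨y, hy, hmin, hA⟩ := h.exists_min
  obtain ⟨y', hy', hmax, hA'⟩ := h.exists_max
  have hyU := (mem_multi.1 hy).1
  by_cases heq : G.dist y v = G.dist y' v
  · exfalso
    have h1 : (U.erase y).card ≤ (Icc 1 (G.dist v x - 1)).card := by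
      refine card_le_card_of_injOn (fun y => G.dist y v) (fun a ha => ?_) fun a ha b hb hab => ?_
      · have ha := mem_of_mem_erase ha
        have := hS.level_bounds hc ha (h.geo a ha)
        simp only [coe_Icc, Set.mem_Icc]
        omega
      · by_contra hne
        rw [mem_coe, mem_erase] at ha hb
        have h2 : b ∈ multi G U v := mem_multi.2 ⟨hb.2, a, ha.2, hne, hab⟩
        have h3 := hmin b h2
        have h4 := hmax b h2
        dsimp only at hab
        have h5 : ({y, a, b} : Finset V) ⊆ lvl G U v (G.dist y v) := by
          intro c
          simp only [mem_insert, mem_singleton, mem_lvl]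
          rintro (rfl | rfl | rfl)
          · exact ⟨hyU, rfl⟩
          · exact ⟨ha.2, by omega⟩
          · exact ⟨hb.2, by omega⟩
        have h6 := card_le_card h5
        rw [card_eq_three.2 ⟨y, a, b, ha.1.symm, hb.1.symm, hne, rfl⟩] at h6
        omega
    rw [Nat.card_Icc, card_erase_of_mem hyU] at h1
    have := hS.two_le_dist hc
    omega
  · have h1 : Disjoint (lvl G U v (G.dist y v)) (lvl G U v (G.dist y' v)) := by
      rw [disjoint_left]
      intro a ha hb
      rw [mem_lvl] at ha hb
      exact heq (ha.2.symm.trans hb.2)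
    have h2 := card_le_card (union_subset (lvl_subset_multi hy) (lvl_subset_multi hy'))
    rw [card_union_of_disjoint h1] at h2
    omega

/-- Strong concavity at the vertices of multiple levels. -/
lemma Low.concave_multi (hL : Low G) (hS : Side G U u v x) (h : Shape G U v x)
    (hout : ∀ P : V → Prop, P v → ¬ P x → ∃ a b, a ∉ U ∧ b ∉ U ∧ G.Adj a b ∧ P a ∧ ¬ P b)
    {y : V} (hy : y ∈ multi G U v) : 2 ≤ ∑ g ∈ nb G y, (tr G y - tr G g) := by
  have hc := hL.conn
  obtain ⟨hyU, y', hyU', hne, hd⟩ := mem_multi.1 hy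
  have hgy := h.geo y hyU
  have hgy' := h.geo y' hyU'
  have hdx : G.dist y' x = G.dist y x := (dist_eq_iff_of_geo hgy' hgy).1 hd
  obtain ⟨p, hp, -, hpg, hpd⟩ := hS.strip.symm.step hc hyU hgy.symm
  obtain ⟨q, hq, -, hqg, hqd⟩ := hS.strip.step hc hyU hgy
  have hpg := hpg.symm
  have htwo : Two G y p q := by
    obtain ⟨r, s, hrs⟩ := exists_two (h.deg y hy)
    have hpq : p ≠ q := by rintro rfl; unfold Geo at hgy hpg; omega
    rcases hrs.adj_iff.1 hp with rfl | rfl <;> rcases hrs.adj_iff.1 hq with rfl | rfl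
    · exact absurd rfl hpq
    · exact hrs
    · exact hrs.symm
    · exact absurd rfl hpq
  have hyv : v ≠ y := (ne_of_mem_of_not_mem hyU hS.v_notMem).symm
  have hyx : x ≠ y := (ne_of_mem_of_not_mem hyU hS.x_notMem).symm
  unfold Geo at hgy hpg hqg
  have cv : curv G y v = 0 := by
    rw [htwo.curv_eq hc hyv, abs_of_neg] <;> omega
  have cx : curv G y x = 0 := by
    rw [htwo.curv_eq hc hyx, abs_of_pos] <;> omega
  have hin := hL.two_le_sum_strip hS.strip hyU htwo (by
    intro P hPv hPx
    by_cases hPy : P y'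
    · obtain ⟨a, ha, b, hb, hab, h1, h2, -, -, h3, h4⟩ := hS.strip.chain hc
        (P := fun z => P z ∧ z ≠ y) (fun h => hPx h.1) hyU' hgy' ⟨hPy, hne⟩
      have hby : b ≠ y := by rintro rfl; omega
      exact ⟨a, b, Or.inl ha, hb, h1.2, hby, hab, h1.1, fun h => h2 ⟨h, hby⟩⟩
    · obtain ⟨a, ha, b, hb, hab, h1, h2, -, -, h3, h4⟩ := hS.strip.symm.chain hc
        (P := fun z => ¬ P z ∧ z ≠ y) (fun h => h.1 hPv) hyU' hgy'.symm ⟨hPy, hne⟩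
      have hby : b ≠ y := by rintro rfl; omega
      exact ⟨b, a, hb, Or.inl ha, hby, h1.2, hab.symm, by_contra fun h => h2 ⟨h, hby⟩, h1.1⟩)
  have hot : 2 ≤ ∑ z ∈ Uᶜ, curv G y z := by
    obtain ⟨a, b, ha, hb, hab, h1, h2⟩ := hout (fun z => G.dist p z < G.dist q z) (by omega)
      (by omega)
    exact htwo.crossing hc (by simpa using hyU) (mem_compl.2 ha) (mem_compl.2 hb) hab h1
      (not_lt.1 h2)
  rw [← sum_curv, ← sum_add_sum_compl U]
  have hxU : x ∉ U.erase y := fun h => hS.x_notMem (mem_of_mem_erase h)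
  have hvU : v ∉ U.erase y := fun h => hS.v_notMem (mem_of_mem_erase h)
  have e : (insert v (insert x U)).erase y = insert v (insert x (U.erase y)) := by
    rw [erase_insert_of_ne hyv, erase_insert_of_ne hyx]
  rw [e, sum_insert (by simp only [mem_insert, not_or]; exact ⟨hS.ne, hvU⟩), sum_insert hxU, cv, cx]
    at hin
  rw [← add_sum_erase U _ hyU, curv_self, htwo.card]
  push_cast
  linarith

end

section
variable {V : Type*} [Fintype V] {G : SimpleGraph V} {U W : Finset V} {u w v x x' : V}

lemma Sides.symm (h : Sides G U W u w v x x') : Sides G W U w u v x' x where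
  two := h.two.symm
  left := h.right
  right := h.left
  disj a ha hb := h.disj a hb ha
  x_notMem := h.x'_notMem
  x'_notMem := h.x_notMem
  card := h.card.symm
  cover z := by have := h.cover z; tauto
  dist := h.dist.symm
  inc := by rw [add_comm, h.inc, h.card]
  parity := by
    rw [← h.card]
    exact h.parity.imp (fun a => ⟨a.1.symm, a.2⟩) fun a => ⟨a.1.symm, a.2⟩

lemma Sides.outside (h : Sides G U W u w v x x') (hc : G.Connected) (P : V → Prop) (hv : P v)
    (hx : ¬ P x) : ∃ a b, a ∉ U ∧ b ∉ U ∧ G.Adj a b ∧ P a ∧ ¬ P b := by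
  by_cases hx' : P x'
  · rcases h.parity with ⟨rfl, -⟩ | ⟨hadj, -⟩
    · exact absurd hx' hx
    · exact ⟨x', x, h.x'_notMem, h.left.x_notMem, hadj.symm, hx', hx⟩
  · obtain ⟨a, b, ha, hb, hab, h1, h2, -⟩ := h.right.full_chain hc P hv hx'
    refine ⟨a, b, ?_, ?_, hab, h1, h2⟩
    · rcases ha with ha | rfl
      · exact fun h' => h.disj a h' ha
      · exact h.left.v_notMem
    · rcases hb with hb | rfl
      · exact fun h' => h.disj b h' hb
      · exact h.x'_notMem

lemma Low.sides_shape (hL : Low G) (h : Sides G U W u w v x x') :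
    G.dist v x ≤ U.card ∧ Shape G U v x ∧ Shape G W v x' := by
  have hc := hL.conn
  have hlarge := hL.large
  have hinc := h.inc
  have hcard := h.card
  have hd := h.dist
  have hn : U.card + 9 ≤ Fintype.card V := by rcases h.parity with ⟨-, h1⟩ | ⟨-, h1⟩ <;> omega
  have hle : G.dist v x ≤ U.card := by
    by_contra! hlt
    have h1 := h.left.incE_le hc hlt
    have h2 := h.right.incE_le hc (by omega)
    omega
  rcases le_total (incE G U) (U.card + 2) with h1 | h1
  · have hs := hL.shape h.left hn h1 hle
    have := hs.inc
    exact ⟨hle, hs, hL.shape h.right (by omega) (by omega) (by omega)⟩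
  · have hs := hL.shape h.right (by omega) (by omega) (by omega)
    have := hs.inc
    exact ⟨hle, hL.shape h.left hn (by omega) hle, hs⟩

lemma Low.local_energy (hL : Low G) (y : V) :
    -6 * (((nb G y).card : ℤ) - 2) ≤
      ∑ g ∈ nb G y, ((tr G g - tr G y) ^ 2 - 3 * (tr G g - tr G y)) := by
  have h2 := hL.two_le_deg y
  by_cases hd : (nb G y).card = 2
  · obtain ⟨a, b, hab⟩ := exists_two hd
    have h3 := hL.concave hab
    rw [hab.2, sum_pair hab.1] at h3 ⊢
    rw [card_pair hab.1]
    push_cast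
    nlinarith [sq_nonneg (tr G a - tr G y), sq_nonneg (tr G b - tr G y)]
  · have h3 : ∀ g ∈ nb G y, (-2 : ℤ) ≤ (tr G g - tr G y) ^ 2 - 3 * (tr G g - tr G y) := by
      intro g _
      generalize tr G g - tr G y = t
      rcases le_or_gt t 1 with h | h
      · nlinarith
      · nlinarith
    have h4 := card_nsmul_le_sum _ _ _ h3
    rw [nsmul_eq_mul] at h4
    have : (3 : ℤ) ≤ (nb G y).card := by exact_mod_cast (by omega : 3 ≤ (nb G y).card)
    linarith

/-- Both sides have exactly one vertex more than a path. -/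
lemma Low.card_eq_dist (hL : Low G) (h : Sides G U W u w v x x') : U.card = G.dist v x := by
  have hc := hL.conn
  obtain ⟨hle, hU, hW⟩ := hL.sides_shape h
  by_contra hne
  have h1 := hU.four_le h.left hc (by omega)
  have h2 := hW.four_le h.right hc (by have := h.dist; have := h.card; omega)
  set M := multi G U v ∪ multi G W v with hM
  have hMc : 8 ≤ M.card := by
    rw [hM, card_union_of_disjoint]
    · omega
    · rw [disjoint_left]
      exact fun a ha hb => h.disj a (mem_multi.1 ha).1 (mem_multi.1 hb).1
  have key : ∀ y, (if y ∈ M then (8 : ℤ) else 0) + -6 * (((nb G y).card : ℤ) - 2) ≤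
      ∑ g ∈ nb G y, ((tr G g - tr G y) ^ 2 - 3 * (tr G g - tr G y)) := by
    intro y
    split_ifs with hy
    · have h3 : (nb G y).card = 2 ∧ 2 ≤ ∑ g ∈ nb G y, (tr G y - tr G g) := by
        rcases mem_union.1 hy with hy | hy
        · exact ⟨hU.deg y hy, hL.concave_multi h.left hU (h.outside hc) hy⟩
        · exact ⟨hW.deg y hy, hL.concave_multi h.right hW (h.symm.outside hc) hy⟩
      obtain ⟨a, b, hab⟩ := exists_two h3.1
      have h4 := h3.2
      rw [hab.2, sum_pair hab.1] at h4 ⊢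
      rw [card_pair hab.1]
      push_cast
      nlinarith [sq_nonneg (tr G a - tr G b), sq_nonneg (tr G a - tr G y + (tr G b - tr G y) + 2)]
    · simpa using hL.local_energy y
  have hsum := sum_le_sum fun y (_ : y ∈ (univ : Finset V)) => key y
  rw [← energy_eq, sum_add_distrib, ← mul_sum, sum_sub_distrib, sum_ite_mem, univ_inter, sum_const,
    sum_const, card_univ] at hsum
  have h3 : ∑ v : V, ((nb G v).card : ℤ) = 2 * (Fintype.card V + 2) := by
    have := sum_deg (G := G)
    rw [hL.edges] at this
    exact_mod_cast this
  have := hL.small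
  have h8 : (8 : ℤ) ≤ M.card := by exact_mod_cast hMc
  simp only [nsmul_eq_mul] at hsum
  linarith

end

section
/-- Adjacency in the cycle on `0, …, R - 1`. -/
def CycAdj (R i j : ℕ) : Prop :=
  i + 1 = j ∨ j + 1 = i ∨ (i = 0 ∧ j + 1 = R) ∨ (j = 0 ∧ i + 1 = R)

/-- `G` is the cycle on `0, …, R - 1` with the vertices `p` and `q` doubled; `φ` maps the
vertices of `G` to their positions on the cycle. -/
structure DoubleCycle {V : Type*} [Fintype V] (G : SimpleGraph V) (R p q : ℕ) (φ : V → ℕ) :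
    Prop where
  lt : ∀ y, φ y < R
  adj : ∀ y z, G.Adj y z ↔ CycAdj R (φ y) (φ z)
  fib : ∀ i < R, (univ.filter fun y => φ y = i).card =
    1 + (if i = p then 1 else 0) + (if i = q then 1 else 0)
  two_le : 2 ≤ p
  gap : p + 2 ≤ q
  le_R : q + 2 ≤ R

variable {V : Type*} [Fintype V] {G : SimpleGraph V} {U W : Finset V} {u w v x x' : V}

/-- On a side with as many vertices as the distance between the ends, exactly one level is
doubled. -/
lemma Shape.exists_double (h : Shape G U v x) (hS : Side G U u v x) (hc : G.Connected)
    (hd : U.card = G.dist v x) :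
    ∃ m, 2 ≤ m ∧ m < G.dist v x ∧ ∀ l, 1 ≤ l → l < G.dist v x →
      (lvl G U v l).card = 1 + if l = m then 1 else 0 := by
  obtain ⟨y, hy, -, hA⟩ := h.exists_min
  have hyU := (mem_multi.1 hy).1
  have hb := hS.level_bounds hc hyU (h.geo y hyU)
  have hsum : U.card = ∑ l ∈ Icc 1 (G.dist v x - 1), (lvl G U v l).card :=
    card_eq_sum_card_fiberwise fun z hz => by
      have := hS.level_bounds hc hz (h.geo z hz)
      simp only [coe_Icc, Set.mem_Icc]
      omega
  have hpos : ∀ l ∈ Icc 1 (G.dist v x - 1), 1 ≤ (lvl G U v l).card := by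
    intro l hl
    obtain ⟨z, hz, hzl⟩ := mem_image.1 (hS.surj hc hl)
    exact card_pos.2 ⟨z, mem_lvl.2 ⟨hz, hzl⟩⟩
  refine ⟨G.dist y v, ?_, hb.2, ?_⟩
  · by_contra hlt
    have h1 : lvl G U v (G.dist y v) ⊆ {u} := by
      intro z hz
      rw [mem_lvl] at hz
      rw [mem_singleton]
      refine hS.only z hz.1 (SimpleGraph.dist_eq_one_iff_adj.1 ?_)
      rw [G.dist_comm]
      omega
    have := card_le_card h1
    rw [card_singleton] at this
    omega
  · intro l h1 h2
    have hl : l ∈ Icc 1 (G.dist v x - 1) := mem_Icc.2 ⟨h1, by omega⟩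
    split_ifs with hly
    · rw [hly, hA]
    · by_contra hne
      have h3 := hpos l hl
      have h4 : ∀ k ∈ Icc 1 (G.dist v x - 1),
          1 + (if k = G.dist y v then 1 else 0) + (if k = l then 1 else 0) ≤
            (lvl G U v k).card := by
        intro k hk
        have := hpos k hk
        split_ifs with h5 h6 h6
        · omega
        · rw [h5]; omega
        · rw [h6]; omega
        · omega
      have h5 := sum_le_sum h4
      rw [← hsum, sum_add_distrib, sum_add_distrib, sum_ite_eq', sum_ite_eq', if_pos hl,
        if_pos (mem_Icc.2 ⟨hb.1, by omega⟩), sum_const, Nat.card_Icc, smul_eq_mul] at h5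
      omega

lemma Shape.adj_iff (h : Shape G U v x) (hS : Side G U u v x) (hc : G.Connected)
    {m : ℕ} (hm : ∀ l, 1 ≤ l → l < G.dist v x →
      (lvl G U v l).card = 1 + if l = m then 1 else 0)
    {y z : V} (hy : y ∈ U) (hz : z ∈ U ∨ z = v ∨ z = x) :
    G.Adj y z ↔ G.dist y v + 1 = G.dist z v ∨ G.dist z v + 1 = G.dist y v := by
  have hxv := G.dist_comm (u := x) (v := v)
  have hvv : G.dist v v = 0 := by simp
  have hb : ∀ y ∈ U, 1 ≤ G.dist y v ∧ G.dist y v < G.dist v x :=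
    fun y hy => hS.level_bounds hc hy (h.geo y hy)
  have hby := hb y hy
  have single : ∀ a ∈ U, ∀ b ∈ U, G.dist a v = G.dist b v → G.dist a v ≠ m → a = b := by
    intro a ha b hb' hab hne
    have h1 := hm _ (hb a ha).1 (hb a ha).2
    rw [if_neg hne, add_zero, card_eq_one] at h1
    obtain ⟨c, hc'⟩ := h1
    have ha' : a ∈ lvl G U v (G.dist a v) := mem_lvl.2 ⟨ha, rfl⟩
    have hb'' : b ∈ lvl G U v (G.dist a v) := mem_lvl.2 ⟨hb', hab.symm⟩
    rw [hc', mem_singleton] at ha' hb''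
    rw [ha', hb'']
  have inner : ∀ a ∈ U, ∀ b ∈ U, G.dist a v + 1 = G.dist b v → G.Adj a b := by
    intro a ha b hb' hab
    have hba := hb a ha
    have hbb := hb b hb'
    obtain ⟨p, hp, hpU, -, hpd⟩ := hS.strip.symm.step hc hb' (h.geo b hb').symm
    rcases hpU with hpU | rfl
    · by_cases hpm : G.dist p v = m
      · obtain ⟨q, hq, hqU, hqg, hqd⟩ := hS.strip.step hc ha (h.geo a ha)
        have hag := h.geo a ha
        have hbg := h.geo b hb'
        unfold Geo at hqg hag hbg
        rcases hqU with hqU | rfl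
        · rw [← single q hqU b hb' (by omega) (by omega)]; exact hq
        · rw [SimpleGraph.dist_self] at hqd; omega
      · rw [← single p hpU a ha (by omega) hpm]; exact hp.symm
    · rw [hvv] at hpd; omega
  constructor
  · intro hadj
    have h1 := dist_le_of_adj hc hadj v
    have h2 := dist_le_of_adj hc hadj.symm v
    by_contra hne
    have heq : G.dist z v = G.dist y v := by omega
    have hzU : z ∈ U := by
      rcases hz with hz | rfl | rfl
      · exact hz
      · omega
      · omega
    have hym : y ∈ multi G U v := mem_multi.2 ⟨hy, z, hzU, hadj.ne', heq⟩
    obtain ⟨p, hp, -, -, hpd⟩ := hS.strip.symm.step hc hy (h.geo y hy).symm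
    obtain ⟨q, hq, -, hqg, hqd⟩ := hS.strip.step hc hy (h.geo y hy)
    have hyg := h.geo y hy
    unfold Geo at hqg hyg
    have h3 : ({p, q, z} : Finset V) ⊆ nb G y := by
      intro a
      simp only [mem_insert, mem_singleton, mem_nb]
      rintro (rfl | rfl | rfl) <;> assumption
    have h4 := card_le_card h3
    rw [h.deg y hym, card_eq_three.2 ⟨p, q, z, by rintro rfl; omega, by rintro rfl; omega,
      by rintro rfl; omega, rfl⟩] at h4
    omega
  · rintro (h1 | h1)
    · rcases hz with hz | rfl | rfl
      · exact inner y hy z hz h1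
      · omega
      · have := h.geo y hy
        unfold Geo at this
        exact SimpleGraph.dist_eq_one_iff_adj.1 (by omega)
    · rcases hz with hz | rfl | rfl
      · exact (inner z hz y hy h1).symm
      · exact SimpleGraph.dist_eq_one_iff_adj.1 (by omega)
      · omega

/-- A graph of small energy is a cycle with two doubled vertices. -/
lemma Low.exists_doubleCycle (hL : Low G) : ∃ R p q φ, DoubleCycle G R p q φ := by
  have hc := hL.conn
  obtain ⟨U, W, u, w, v, x, x', h⟩ := hL.exists_sides
  obtain ⟨-, hU, hW⟩ := hL.sides_shape h
  have hd := hL.card_eq_dist h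
  have hd' := hL.card_eq_dist h.symm
  obtain ⟨m, hm2, hmd, hm⟩ := hU.exists_double h.left hc hd
  obtain ⟨m', hm2', hmd', hm'⟩ := hW.exists_double h.right hc hd'
  have hdd := h.dist
  have aU := fun y z => hU.adj_iff h.left hc hm (y := y) (z := z)
  have aW := fun y z => hW.adj_iff h.right hc hm' (y := y) (z := z)
  have bU : ∀ y ∈ U, 1 ≤ G.dist y v ∧ G.dist y v < G.dist v x :=
    fun y hy => h.left.level_bounds hc hy (hU.geo y hy)
  have bW : ∀ y ∈ W, 1 ≤ G.dist y v ∧ G.dist y v < G.dist v x :=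
    fun y hy => hdd ▸ h.right.level_bounds hc hy (hW.geo y hy)
  have hxv := G.dist_comm (u := x) (v := v)
  have hxv' := G.dist_comm (u := x') (v := v)
  have hvv : G.dist v v = 0 := by simp
  obtain ⟨R, hR⟩ : ∃ R, x = x' ∧ R = 2 * G.dist v x ∨
      x ≠ x' ∧ G.Adj x x' ∧ R = 2 * G.dist v x + 1 := by
    rcases h.parity with ⟨h1, -⟩ | ⟨h1, -⟩
    · exact ⟨_, Or.inl ⟨h1, rfl⟩⟩
    · exact ⟨_, Or.inr ⟨h1.ne, h1, rfl⟩⟩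
  set φ : V → ℕ := fun y => if y ∈ U ∨ y = v ∨ y = x then G.dist y v else R - G.dist y v with hφ
  have fU : ∀ y ∈ U, φ y = G.dist y v := fun y hy => if_pos (Or.inl hy)
  have fv : φ v = 0 := by rw [hφ]; simp
  have fx : φ x = G.dist v x := by rw [← hxv]; exact if_pos (Or.inr (Or.inr rfl))
  have fW : ∀ y ∈ W, φ y = R - G.dist y v := by
    intro y hy
    refine if_neg ?_
    rintro (h1 | rfl | rfl)
    · exact h.disj y h1 hy
    · exact h.right.v_notMem hy
    · exact h.x_notMem hy
  have fx' : φ x' = R - G.dist v x := by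
    rcases hR with ⟨rfl, hR⟩ | ⟨h1, -, hR⟩
    · omega
    · rw [hdd, ← hxv']
      refine if_neg ?_
      rintro (h2 | h2 | h2)
      · exact h.x'_notMem h2
      · exact h.right.ne h2.symm
      · exact h1 h2.symm
  have key : ∀ y, (y ∈ U ∧ φ y = G.dist y v ∧ 1 ≤ φ y ∧ φ y < G.dist v x) ∨
      (y ∈ W ∧ φ y = R - G.dist y v ∧ 1 ≤ G.dist y v ∧ G.dist y v < G.dist v x) ∨
      (y = v ∧ φ y = 0) ∨ (y = x ∧ φ y = G.dist v x) ∨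
      (y = x' ∧ x ≠ x' ∧ φ y = G.dist v x + 1) := by
    intro y
    rcases h.cover y with hy | hy | rfl | rfl | rfl
    · exact Or.inl ⟨hy, fU y hy, by rw [fU y hy]; exact (bU y hy).1, by
        rw [fU y hy]; exact (bU y hy).2⟩
    · exact Or.inr (Or.inl ⟨hy, fW y hy, bW y hy⟩)
    · exact Or.inr (Or.inr (Or.inl ⟨rfl, fv⟩))
    · exact Or.inr (Or.inr (Or.inr (Or.inl ⟨rfl, fx⟩)))
    · by_cases hxx : x = y
      · exact Or.inr (Or.inr (Or.inr (Or.inl ⟨hxx.symm, hxx ▸ fx⟩)))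
      · refine Or.inr (Or.inr (Or.inr (Or.inr ⟨rfl, hxx, ?_⟩)))
        rcases hR with ⟨h1, -⟩ | ⟨-, -, hR⟩
        · exact absurd h1 hxx
        · omega
  have adjU : ∀ y ∈ U, ∀ z, G.Adj y z ↔ CycAdj R (φ y) (φ z) := by
    intro y hy z
    have := bU y hy
    have hfy := fU y hy
    unfold CycAdj
    rcases key z with ⟨hz, h1⟩ | ⟨hz, h1⟩ | ⟨rfl, h1⟩ | ⟨rfl, h1⟩ | ⟨rfl, h0, h1⟩
    · rw [aU y z hy (Or.inl hz)]; omega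
    · refine iff_of_false (fun hadj => ?_) (by omega)
      rcases h.left.nbr y hy z hadj with h2 | rfl | rfl
      · exact h.disj z h2 hz
      · exact h.right.v_notMem hz
      · exact h.x_notMem hz
    · rw [aU y z hy (Or.inr (Or.inl rfl))]; omega
    · rw [aU y z hy (Or.inr (Or.inr rfl))]; omega
    · refine iff_of_false (fun hadj => ?_) (by omega)
      rcases h.left.nbr y hy z hadj with h2 | rfl | rfl
      · exact h.x'_notMem h2
      · exact h.right.ne rfl
      · exact h0 rfl
  have adjW : ∀ y ∈ W, ∀ z, G.Adj y z ↔ CycAdj R (φ y) (φ z) := by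
    intro y hy z
    have := bW y hy
    have hfy := fW y hy
    unfold CycAdj
    rcases key z with ⟨hz, h1⟩ | ⟨hz, h1⟩ | ⟨rfl, h1⟩ | ⟨rfl, h1⟩ | ⟨rfl, h0, h1⟩
    · refine iff_of_false (fun hadj => ?_) (by omega)
      rcases h.right.nbr y hy z hadj with h2 | rfl | rfl
      · exact h.disj z hz h2
      · exact h.left.v_notMem hz
      · exact h.x'_notMem hz
    · rw [aW y z hy (Or.inl hz)]; omega
    · rw [aW y z hy (Or.inr (Or.inl rfl))]; omega
    · rcases hR with ⟨rfl, hR⟩ | ⟨h2, -, hR⟩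
      · rw [aW y z hy (Or.inr (Or.inr rfl))]; omega
      · refine iff_of_false (fun hadj => ?_) (by omega)
        rcases h.right.nbr y hy z hadj with h3 | rfl | rfl
        · exact h.x_notMem h3
        · exact h.left.ne rfl
        · exact h2 rfl
    · rw [aW y z hy (Or.inr (Or.inr rfl))]; omega
  have cyc_comm : ∀ i j, CycAdj R i j ↔ CycAdj R j i := by intro i j; unfold CycAdj; omega
  refine ⟨R, m, R - m', φ, ?_, ?_, ?_, hm2, by omega, by omega⟩
  · intro y
    rcases key y with ⟨-, h1⟩ | ⟨-, h1⟩ | ⟨-, h1⟩ | ⟨-, h1⟩ | ⟨-, h0, h1⟩ <;> omega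
  · intro y z
    rcases key y with ⟨hy, -⟩ | ⟨hy, -⟩ | hy
    · exact adjU y hy z
    · exact adjW y hy z
    rcases key z with ⟨hz, -⟩ | ⟨hz, -⟩ | hz
    · rw [G.adj_comm, cyc_comm]; exact adjU z hz y
    · rw [G.adj_comm, cyc_comm]; exact adjW z hz y
    unfold CycAdj
    have n1 := h.left.nadj
    have n2 := h.right.nadj
    have n1' : ¬ G.Adj x v := fun a => n1 a.symm
    have n2' : ¬ G.Adj x' v := fun a => n2 a.symm
    rcases hy with ⟨rfl, h1⟩ | ⟨rfl, h1⟩ | ⟨rfl, h0, h1⟩ <;>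
      rcases hz with ⟨rfl, h2⟩ | ⟨rfl, h2⟩ | ⟨rfl, h0, h2⟩
    · exact iff_of_false (fun a => a.ne rfl) (by omega)
    · exact iff_of_false n1 (by omega)
    · exact iff_of_false n2 (by omega)
    · exact iff_of_false n1' (by omega)
    · exact iff_of_false (fun a => a.ne rfl) (by omega)
    · rcases hR with ⟨h3, -⟩ | ⟨-, h3, -⟩
      · exact absurd h3 h0
      · exact iff_of_true h3 (by omega)
    · exact iff_of_false n2' (by omega)
    · rcases hR with ⟨h3, -⟩ | ⟨-, h3, -⟩
      · exact absurd h3 h0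
      · exact iff_of_true h3.symm (by omega)
    · exact iff_of_false (fun a => a.ne rfl) (by omega)
  · intro i hi
    have one : ∀ c, φ c = i → (∀ y, φ y = i → y = c) → (i = m → False) → (i = R - m' → False) →
        (univ.filter fun y => φ y = i).card =
          1 + (if i = m then 1 else 0) + (if i = R - m' then 1 else 0) := by
      intro c h1 h2 h3 h4
      rw [if_neg h3, if_neg h4, card_eq_one]
      refine ⟨c, ?_⟩
      ext y
      simp only [mem_filter, mem_univ, true_and, mem_singleton]
      exact ⟨h2 y, fun h => h ▸ h1⟩
    rcases Nat.lt_trichotomy i (G.dist v x) with hlt | heq | hgt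
    · rcases Nat.eq_zero_or_pos i with rfl | hpos
      · refine one v fv (fun y hy => ?_) (by omega) (by omega)
        rcases key y with ⟨-, h1⟩ | ⟨-, h1⟩ | ⟨h0, h1⟩ | ⟨-, h1⟩ | ⟨-, h0, h1⟩
        · omega
        · omega
        · exact h0
        · omega
        · omega
      · have e : (univ.filter fun y => φ y = i) = lvl G U v i := by
          ext y
          simp only [mem_filter, mem_univ, true_and, mem_lvl]
          constructor
          · intro hy
            rcases key y with ⟨h0, h1⟩ | ⟨-, h1⟩ | ⟨-, h1⟩ | ⟨-, h1⟩ | ⟨-, h0, h1⟩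
            · exact ⟨h0, by omega⟩
            all_goals omega
          · rintro ⟨h1, h2⟩
            rw [fU y h1, h2]
        rw [e, hm i hpos hlt, if_neg (by omega : ¬ i = R - m'), add_zero]
    · refine one x (by omega) (fun y hy => ?_) (by omega) (by omega)
      rcases key y with ⟨-, h1⟩ | ⟨-, h1⟩ | ⟨-, h1⟩ | ⟨h0, h1⟩ | ⟨-, h0, h1⟩
      · omega
      · omega
      · omega
      · exact h0
      · omega
    · rcases Nat.lt_or_ge (R - G.dist v x) i with h3 | h3
      · have e : (univ.filter fun y => φ y = i) = lvl G W v (R - i) := by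
          ext y
          simp only [mem_filter, mem_univ, true_and, mem_lvl]
          constructor
          · intro hy
            rcases key y with ⟨-, h1⟩ | ⟨h0, h1⟩ | ⟨-, h1⟩ | ⟨-, h1⟩ | ⟨-, h0, h1⟩
            · omega
            · exact ⟨h0, by omega⟩
            · omega
            · omega
            · rcases hR with ⟨h2, -⟩ | ⟨-, -, h2⟩
              · exact absurd h2 h0
              · omega
          · rintro ⟨h1, h2⟩
            rw [fW y h1, h2]
            omega
        rw [e, hm' (R - i) (by omega) (by omega), if_neg (by omega : ¬ i = m), add_zero]
        congr 1
        exact if_congr (by omega) rfl rfl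
      · refine one x' (by omega) (fun y hy => ?_) (by omega) (by omega)
        rcases key y with ⟨-, h1⟩ | ⟨-, h1⟩ | ⟨-, h1⟩ | ⟨-, h1⟩ | ⟨h0, -, h1⟩
        · omega
        · omega
        · omega
        · omega
        · exact h0

end

section
/-- The distance in the cycle on `0, …, R - 1`. -/
def cyc (R i j : ℕ) : ℕ := min ((i - j) + (j - i)) (R - ((i - j) + (j - i)))

/-- The successor in the cycle on `0, …, R - 1`. -/
def nxt (R i : ℕ) : ℕ := if i + 1 = R then 0 else i + 1

/-- The predecessor in the cycle on `0, …, R - 1`. -/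
def prv (R i : ℕ) : ℕ := if i = 0 then R - 1 else i - 1

/-- The rotation by `c` of the cycle on `0, …, R - 1`. -/
def rot (R c i : ℕ) : ℕ := if c ≤ i then i - c else i + R - c

/-- The multiplicity of the position `i` when `p` and `q` are doubled. -/
def mult (p q i : ℕ) : ℕ := 1 + (if i = p then 1 else 0) + (if i = q then 1 else 0)

/-- The transmission of a vertex at position `i`, up to a constant. -/
def pot (R p q i : ℕ) : ℕ :=
  cyc R i p + cyc R i q + 2 * ((if i = p then 1 else 0) + (if i = q then 1 else 0))

lemma nxt_prv {R i : ℕ} (h : i < R) : nxt R (prv R i) = i := by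
  unfold nxt prv; split_ifs <;> omega

lemma prv_nxt {R i : ℕ} : prv R (nxt R i) = i := by
  unfold nxt
  split_ifs
  · rw [prv, if_pos rfl]; omega
  · rw [prv, if_neg (by omega)]; omega

lemma nxt_lt {R i : ℕ} (h : i < R) : nxt R i < R := by unfold nxt; split_ifs <;> omega

lemma prv_lt {R i : ℕ} (h : i < R) : prv R i < R := by unfold prv; split_ifs <;> omega

lemma cycAdj_iff {R i j : ℕ} (hi : i < R) (hj : j < R) :
    CycAdj R i j ↔ j = nxt R i ∨ j = prv R i := by
  unfold CycAdj nxt prv; split_ifs <;> omega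

lemma cyc_le_of_cycAdj {R i j k : ℕ} (hi : i < R) (hj : j < R) (hk : k < R) (h : CycAdj R i j) :
    cyc R i k ≤ cyc R j k + 1 := by
  unfold CycAdj at h; unfold cyc; omega

lemma exists_cycAdj {R i k : ℕ} (hi : i < R) (hk : k < R) (h : i ≠ k) :
    ∃ j < R, CycAdj R i j ∧ cyc R j k + 1 = cyc R i k := by
  by_cases h1 : cyc R (nxt R i) k + 1 = cyc R i k
  · exact ⟨_, nxt_lt hi, (cycAdj_iff hi (nxt_lt hi)).2 (Or.inl rfl), h1⟩
  · refine ⟨_, prv_lt hi, (cycAdj_iff hi (prv_lt hi)).2 (Or.inr rfl), ?_⟩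
    revert h1
    unfold cyc nxt prv
    split_ifs <;> omega

lemma sum_cyc {R i : ℕ} (hi : i < R) : ∑ j ∈ range R, cyc R i j = ∑ j ∈ range R, cyc R 0 j := by
  refine sum_nbij' (rot R i) (fun j => if j + i < R then j + i else j + i - R) (fun j hj => ?_)
    (fun j hj => ?_) (fun j hj => ?_) (fun j hj => ?_) (fun j hj => ?_) <;>
    rw [mem_range] at *
  · unfold rot; split_ifs <;> omega
  · split_ifs <;> omega
  · unfold rot; split_ifs <;> omega
  · unfold rot; split_ifs <;> omega
  · unfold rot cyc; split_ifs <;> omega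

variable {V : Type*} [Fintype V] {G : SimpleGraph V} {R p q : ℕ} {φ : V → ℕ}

namespace DoubleCycle

lemma sum_comp (h : DoubleCycle G R p q φ) (f : ℕ → ℤ) :
    ∑ y, f (φ y) = ∑ i ∈ range R, (mult p q i : ℤ) * f i := by
  rw [← sum_fiberwise_of_maps_to (g := φ) (t := range R) fun y _ => mem_range.2 (h.lt y)]
  refine sum_congr rfl fun i hi => ?_
  rw [sum_congr rfl (g := fun _ => f i) fun y hy => by rw [(mem_filter.1 hy).2], sum_const,
    h.fib i (mem_range.1 hi), nsmul_eq_mul]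
  rfl

lemma card_eq (h : DoubleCycle G R p q φ) : Fintype.card V = R + 2 := by
  have h1 := h.sum_comp fun _ => 1
  have := h.gap
  have := h.le_R
  simp only [mult, sum_const, card_univ, nsmul_eq_mul, mul_one] at h1
  push_cast at h1
  rw [sum_add_distrib, sum_add_distrib, sum_ite_eq', sum_ite_eq',
    if_pos (mem_range.2 (by omega)), if_pos (mem_range.2 (by omega))] at h1
  simp only [sum_const, card_range, nsmul_eq_mul, mul_one] at h1
  omega

lemma exists_pos (h : DoubleCycle G R p q φ) {i : ℕ} (hi : i < R) : ∃ y, φ y = i := by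
  have h1 : 0 < (univ.filter fun y => φ y = i).card := by rw [h.fib i hi]; omega
  obtain ⟨y, hy⟩ := card_pos.1 h1
  exact ⟨y, (mem_filter.1 hy).2⟩

lemma cyc_le_dist (h : DoubleCycle G R p q φ) (hc : G.Connected) (y z : V) :
    cyc R (φ y) (φ z) ≤ G.dist y z := by
  generalize hk : G.dist y z = k
  induction k generalizing y with
  | zero =>
    rw [hc.dist_eq_zero_iff.1 hk]
    unfold cyc; omega
  | succ k ih =>
    obtain ⟨u, hu, hd⟩ := exists_parent hc (v := y) (z := z)
      (by rintro rfl; rw [SimpleGraph.dist_self] at hk; omega)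
    have h1 := ih u (by omega)
    have h2 := cyc_le_of_cycAdj (h.lt y) (h.lt u) (h.lt z) ((h.adj y u).1 hu)
    omega

lemma dist_le_cyc (h : DoubleCycle G R p q φ) (hc : G.Connected) {y z : V} (hne : φ y ≠ φ z) :
    G.dist y z ≤ cyc R (φ y) (φ z) := by
  generalize hk : cyc R (φ y) (φ z) = k
  induction k generalizing y with
  | zero =>
    have := h.lt y
    have := h.lt z
    unfold cyc at hk; omega
  | succ k ih =>
    obtain ⟨j, hj, h1, h2⟩ := exists_cycAdj (h.lt y) (h.lt z) hne
    by_cases hjz : j = φ z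
    · have h3 := dist_self_adj ((h.adj y z).2 (hjz ▸ h1))
      omega
    · obtain ⟨u, rfl⟩ := h.exists_pos hj
      have h3 := ih hjz (by omega)
      have h4 := dist_le_of_adj hc ((h.adj y u).2 h1) z
      omega

lemma dist_eq (h : DoubleCycle G R p q φ) (hc : G.Connected) (y z : V) :
    G.dist y z = cyc R (φ y) (φ z) + if φ y = φ z ∧ y ≠ z then 2 else 0 := by
  by_cases hne : φ y = φ z
  · have h0 : cyc R (φ y) (φ z) = 0 := by rw [hne]; unfold cyc; omega
    by_cases hyz : y = z
    · subst hyz; simp [h0]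
    · rw [h0, if_pos ⟨hne, hyz⟩]
      have h1 := hc.pos_dist_of_ne hyz
      have h2 : G.dist y z ≠ 1 := by
        intro h2
        have h3 := (h.adj y z).1 (SimpleGraph.dist_eq_one_iff_adj.1 h2)
        have := h.two_le
        have := h.gap
        have := h.le_R
        unfold CycAdj at h3; omega
      obtain ⟨u, hu⟩ := h.exists_pos (nxt_lt (h.lt y))
      have h3 : CycAdj R (φ y) (φ u) := (cycAdj_iff (h.lt y) (h.lt u)).2 (Or.inl hu)
      have h4 := dist_le_of_adj hc ((h.adj y u).2 h3) z
      have h5 := dist_self_adj ((h.adj z u).2 (hne ▸ h3))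
      rw [G.dist_comm] at h5
      omega
  · rw [if_neg fun h => hne h.1]
    exact le_antisymm (h.dist_le_cyc hc hne) (h.cyc_le_dist hc y z)

lemma tr_eq (h : DoubleCycle G R p q φ) (hc : G.Connected) (y : V) :
    tr G y = (∑ j ∈ range R, cyc R 0 j : ℕ) + (pot R p q (φ y) : ℤ) := by
  have hp : p ∈ range R := mem_range.2 (by have := h.gap; have := h.le_R; omega)
  have hq : q ∈ range R := mem_range.2 (by have := h.le_R; omega)
  have h1 : ∑ z, (if φ y = φ z ∧ y ≠ z then (2 : ℤ) else 0) =
      2 * ((if φ y = p then 1 else 0) + (if φ y = q then 1 else 0)) := by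
    have h2 : (univ.filter fun z => φ y = φ z ∧ y ≠ z) =
        (univ.filter fun z => φ z = φ y).erase y := by
      ext z
      simp only [mem_filter, mem_univ, true_and, mem_erase]
      exact ⟨fun a => ⟨a.2.symm, a.1.symm⟩, fun a => ⟨a.2.symm, a.1.symm⟩⟩
    rw [← sum_filter, sum_const, h2, card_erase_of_mem (by simp), h.fib _ (h.lt y), nsmul_eq_mul]
    push_cast [Nat.add_assoc, Nat.add_sub_cancel_left]
    ring
  have h3 := h.sum_comp fun j => (cyc R (φ y) j : ℤ)
  have h4 := sum_cyc (h.lt y)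
  unfold tr
  simp only [h.dist_eq hc]
  push_cast
  rw [sum_add_distrib, h1, h3]
  unfold mult pot
  push_cast
  simp only [add_mul, one_mul, ite_mul, zero_mul, sum_add_distrib, sum_ite_eq', hp, hq, if_true]
  rw [← Nat.cast_sum, h4]
  push_cast
  ring

/-- The contribution of the edges between the positions `i` and `i + 1`. -/
def gap_energy (R p q i : ℕ) : ℤ :=
  mult p q i * mult p q (nxt R i) * ((pot R p q (nxt R i) : ℤ) - pot R p q i) ^ 2

lemma energy_eq (h : DoubleCycle G R p q φ) (hc : G.Connected) :
    energy G = 2 * ∑ i ∈ range R, gap_energy R p q i := by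
  set f : ℕ → ℕ → ℤ := fun i j => ((pot R p q j : ℤ) - pot R p q i) ^ 2 with hf
  have hR : 6 ≤ R := by have := h.two_le; have := h.gap; have := h.le_R; omega
  have h1 : ∀ y, ∑ g ∈ nb G y, (tr G g - tr G y) ^ 2 =
      mult p q (nxt R (φ y)) * f (φ y) (nxt R (φ y)) +
      mult p q (prv R (φ y)) * f (φ y) (prv R (φ y)) := by
    intro y
    have hy := h.lt y
    have h2 : ∀ g ∈ nb G y, (tr G g - tr G y) ^ 2 = f (φ y) (φ g) := by
      intro g _
      rw [h.tr_eq hc, h.tr_eq hc, hf]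
      ring
    have h3 : nb G y = univ.filter fun g => φ g = nxt R (φ y) ∨ φ g = prv R (φ y) := by
      ext g
      simp only [mem_nb, mem_filter, mem_univ, true_and]
      rw [h.adj, cycAdj_iff hy (h.lt g)]
    have hne : nxt R (φ y) ≠ prv R (φ y) := by unfold nxt prv; split_ifs <;> omega
    rw [sum_congr rfl h2, h3, sum_filter]
    have h4 := h.sum_comp fun j => if j = nxt R (φ y) ∨ j = prv R (φ y) then f (φ y) j else 0
    rw [h4, ← sum_subset (s₁ := {nxt R (φ y), prv R (φ y)}), sum_pair hne, if_pos (Or.inl rfl),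
      if_pos (Or.inr rfl)]
    · intro j
      simp only [mem_insert, mem_singleton, mem_range]
      rintro (rfl | rfl)
      · exact nxt_lt hy
      · exact prv_lt hy
    · intro j _ hj
      rw [mem_insert, mem_singleton] at hj
      rw [if_neg hj, mul_zero]
  unfold energy
  rw [sum_congr rfl fun y _ => h1 y,
    h.sum_comp fun i => mult p q (nxt R i) * f i (nxt R i) + mult p q (prv R i) * f i (prv R i)]
  simp only [mul_add, sum_add_distrib, two_mul]
  congr 1
  · refine sum_congr rfl fun i _ => ?_
    unfold gap_energy; rw [hf]; ring
  · refine sum_nbij' (prv R) (nxt R) (fun i hi => ?_) (fun i hi => ?_) (fun i hi => ?_)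
      (fun i hi => ?_) (fun i hi => ?_) <;> rw [mem_range] at *
    · exact prv_lt hi
    · exact nxt_lt hi
    · exact nxt_prv hi
    · exact prv_nxt
    · unfold gap_energy; rw [nxt_prv hi, hf]; ring

lemma rotate (h : DoubleCycle G R p q φ) {c p' q' : ℕ} (hcR : c < R)
    (hpq : rot R c p = p' ∧ rot R c q = q' ∨ rot R c p = q' ∧ rot R c q = p') (h2 : 2 ≤ p')
    (hg : p' + 2 ≤ q') (hq : q' + 2 ≤ R) : DoubleCycle G R p' q' fun y => rot R c (φ y) := by
  have h1 := h.gap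
  have h3 := h.le_R
  refine ⟨fun y => ?_, fun y z => ?_, fun i hi => ?_, h2, hg, hq⟩
  · have := h.lt y
    unfold rot; split_ifs <;> omega
  · rw [h.adj]
    have := h.lt y
    have := h.lt z
    unfold rot CycAdj; split_ifs <;> omega
  · obtain ⟨j, hj, hji⟩ : ∃ j < R, rot R c j = i := by
      unfold rot
      by_cases hlt : i + c < R
      · exact ⟨i + c, hlt, by split_ifs <;> omega⟩
      · exact ⟨i + c - R, by omega, by split_ifs <;> omega⟩
    have inj : ∀ k < R, rot R c k = i ↔ k = j := by
      intro k hk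
      subst hji
      unfold rot; split_ifs <;> omega
    have hp := inj p (by omega)
    have hq' := inj q (by omega)
    have e : (univ.filter fun y => rot R c (φ y) = i) = univ.filter fun y => φ y = j :=
      filter_congr fun y _ => inj _ (h.lt y)
    rw [e, h.fib j hj]
    rcases hpq with ⟨rfl, rfl⟩ | ⟨rfl, rfl⟩ <;> split_ifs <;> omega

/-- Up to rotation, the first doubled position is `2` and the inner gap is the smaller one. -/
lemma normalize (h : DoubleCycle G R p q φ) :
    ∃ q φ, DoubleCycle G R 2 q φ ∧ 2 * (q - 2) ≤ R := by
  have h1 := h.two_le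
  have h2 := h.gap
  have h3 := h.le_R
  rcases le_or_gt (2 * (q - p)) R with h4 | h4
  · refine ⟨q - p + 2, _, h.rotate (c := p - 2) (p' := 2) (q' := q - p + 2) (by omega)
      (Or.inl ?_) le_rfl (by omega) (by omega), by omega⟩
    unfold rot; split_ifs <;> omega
  · refine ⟨p + R - q + 2, _, h.rotate (c := q - 2) (p' := 2) (q' := p + R - q + 2) (by omega)
      (Or.inr ?_) le_rfl (by omega) (by omega), by omega⟩
    unfold rot; split_ifs <;> omega

end DoubleCycle

end

lemma gap_energy_eq {R p q i j a b : ℕ} {δ : ℤ} (hj : nxt R i = j) (ha : mult p q i = a)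
    (hb : mult p q j = b) (hδ : (pot R p q j : ℤ) = pot R p q i + δ) :
    DoubleCycle.gap_energy R p q i = a * b * δ ^ 2 := by
  unfold DoubleCycle.gap_energy
  rw [hj, ha, hb, hδ]
  ring

lemma gap_energy_nonneg (R p q i : ℕ) : 0 ≤ DoubleCycle.gap_energy R p q i := by
  unfold DoubleCycle.gap_energy; positivity

lemma mult_plain {p q i : ℕ} (hp : i ≠ p) (hq : i ≠ q) : mult p q i = 1 := by
  rw [mult, if_neg hp, if_neg hq]

lemma mult_left {p q : ℕ} (h : p ≠ q) : mult p q p = 2 := by rw [mult, if_pos rfl, if_neg h]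

lemma mult_right {p q : ℕ} (h : p ≠ q) : mult p q q = 2 := by
  rw [mult, if_pos rfl, if_neg h.symm]

lemma pot_plain (R : ℕ) {p q i : ℕ} (hp : i ≠ p) (hq : i ≠ q) :
    pot R p q i = cyc R i p + cyc R i q := by
  rw [pot, if_neg hp, if_neg hq, add_zero, mul_zero, add_zero]

lemma pot_left (R : ℕ) {p q : ℕ} (h : p ≠ q) : pot R p q p = cyc R p q + 2 := by
  rw [pot, if_pos rfl, if_neg h, cyc]; omega

lemma pot_right (R : ℕ) {p q : ℕ} (h : p ≠ q) : pot R p q q = cyc R q p + 2 := by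
  rw [pot, if_pos rfl, if_neg h.symm]; unfold cyc; omega

lemma nxt_of_ne {R i : ℕ} (h : i + 1 ≠ R) : nxt R i = i + 1 := if_neg h

lemma cyc_of_le (R : ℕ) {i j : ℕ} (h : i ≤ j) : cyc R i j = min (j - i) (R - (j - i)) := by
  rw [cyc, Nat.sub_eq_zero_of_le h, zero_add]

lemma cyc_of_ge (R : ℕ) {i j : ℕ} (h : j ≤ i) : cyc R i j = min (i - j) (R - (i - j)) := by
  rw [cyc, Nat.sub_eq_zero_of_le h, add_zero]

/-- Away from the doubled positions, the potential is constant if the sum of the distances is. -/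
lemma pot_nxt_eq {R q i : ℕ} (hq : 4 ≤ q) (hqR : q + 2 ≤ R) (h2 : i ≠ 2) (hqi : i + 1 ≠ q)
    (hi : i < R) (hl : 2 * (q - 2) + 2 = R ∨ 2 * (q - 2) + 3 = R ∧ i ≠ 0 ∧ i ≠ q + 1) :
    pot R 2 q (nxt R i) = pot R 2 q i := by
  by_cases h1 : i + 1 = R
  · rw [nxt, if_pos h1, pot_plain R (by omega) (by omega), pot_plain R (by omega) (by omega)]
    unfold cyc; omega
  rw [nxt_of_ne h1]
  by_cases h3 : i = q
  · rw [h3, pot_right R (by omega), pot_plain R (by omega) (by omega)]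
    unfold cyc; omega
  by_cases h4 : i = 1
  · rw [h4, pot_left R (by omega), pot_plain R (by omega) (by omega)]
    unfold cyc; omega
  rw [pot_plain R (by omega) (by omega), pot_plain R (by omega) (by omega)]
  rcases Nat.lt_trichotomy i 2 with h5 | h5 | h5
  · obtain rfl : i = 0 := by omega
    unfold cyc; omega
  · exact absurd h5 h2
  rw [cyc_of_ge R (by omega : 2 ≤ i), cyc_of_ge R (by omega : 2 ≤ i + 1)]
  rcases Nat.lt_or_gt_of_ne h3 with h6 | h6
  · rw [cyc_of_le R h6.le, cyc_of_le R (by omega : i + 1 ≤ q)]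
    clear h1 h2 h3 h4
    omega
  · rw [cyc_of_ge R h6.le, cyc_of_ge R (by omega : q ≤ i + 1)]
    omega

lemma inner_energy {R q : ℕ} (hq : 4 ≤ q) (hR : q + 2 ≤ R) (hD : 2 * (q - 2) ≤ R) :
    DoubleCycle.gap_energy R 2 q 2 = 8 ∧ DoubleCycle.gap_energy R 2 q (q - 1) = 8 := by
  constructor
  · rw [gap_energy_eq (j := 3) (a := 2) (b := 1) (δ := -2) (nxt_of_ne (by omega))
      (mult_left (by omega)) (mult_plain (by omega) (by omega)) (by
        rw [pot_plain R (by omega) (by omega), pot_left R (by omega)]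
        unfold cyc; omega)]
    norm_num
  · rw [gap_energy_eq (j := q) (a := 1) (b := 2) (δ := 2) ((nxt_of_ne (by omega)).trans (by omega))
      (mult_plain (by omega) (by omega)) (mult_right (by omega)) (by
        rw [pot_right R (by omega), pot_plain R (by omega) (by omega)]
        unfold cyc; omega)]
    norm_num

lemma four_gaps_le {R q i j : ℕ} (hq : 4 ≤ q) (hR : q + 2 ≤ R) (hi : i < 2) (hj : q ≤ j)
    (hjR : j < R) :
    DoubleCycle.gap_energy R 2 q 2 + DoubleCycle.gap_energy R 2 q (q - 1) +
      DoubleCycle.gap_energy R 2 q i + DoubleCycle.gap_energy R 2 q j ≤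
      ∑ k ∈ range R, DoubleCycle.gap_energy R 2 q k := by
  have hsub : ({2, q - 1, i, j} : Finset ℕ) ⊆ range R := by
    intro k
    simp only [mem_insert, mem_singleton, mem_range]
    omega
  refine le_trans (le_of_eq ?_)
    (sum_le_sum_of_subset_of_nonneg hsub fun k _ _ => gap_energy_nonneg R 2 q k)
  rw [sum_insert, sum_insert, sum_pair]
  · ring
  · omega
  · simp only [mem_insert, mem_singleton]; omega
  · simp only [mem_insert, mem_singleton]; omega

lemma sum_gaps_zero {R q : ℕ} (hq : 4 ≤ q) (hR : q + 2 ≤ R) (hD : 2 * (q - 2) = R) :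
    32 ≤ ∑ k ∈ range R, DoubleCycle.gap_energy R 2 q k := by
  have h0 := inner_energy hq hR hD.le
  have h1 : DoubleCycle.gap_energy R 2 q 1 = 8 := by
    rw [gap_energy_eq (j := 2) (a := 1) (b := 2) (δ := 2) (nxt_of_ne (by omega))
      (mult_plain (by omega) (by omega)) (mult_left (by omega)) (by
        rw [pot_left R (by omega), pot_plain R (by omega) (by omega)]
        unfold cyc; omega)]
    norm_num
  have h2 : DoubleCycle.gap_energy R 2 q q = 8 := by
    rw [gap_energy_eq (j := q + 1) (a := 2) (b := 1) (δ := -2) (nxt_of_ne (by omega))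
      (mult_right (by omega)) (mult_plain (by omega) (by omega)) (by
        rw [pot_plain R (by omega) (by omega), pot_right R (by omega)]
        unfold cyc; omega)]
    norm_num
  have := four_gaps_le (i := 1) (j := q) hq hR (by omega) le_rfl (by omega)
  linarith

lemma sum_gaps_one {R q : ℕ} (hq : 4 ≤ q) (hR : q + 2 ≤ R) (hD : 2 * (q - 2) + 1 = R) :
    20 ≤ ∑ k ∈ range R, DoubleCycle.gap_energy R 2 q k := by
  have h0 := inner_energy hq hR (by omega)
  have h1 : DoubleCycle.gap_energy R 2 q 1 = 2 := by
    rw [gap_energy_eq (j := 2) (a := 1) (b := 2) (δ := 1) (nxt_of_ne (by omega))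
      (mult_plain (by omega) (by omega)) (mult_left (by omega)) (by
        rw [pot_left R (by omega), pot_plain R (by omega) (by omega)]
        unfold cyc; omega)]
    norm_num
  have h2 : DoubleCycle.gap_energy R 2 q q = 2 := by
    rw [gap_energy_eq (j := q + 1) (a := 2) (b := 1) (δ := -1) (nxt_of_ne (by omega))
      (mult_right (by omega)) (mult_plain (by omega) (by omega)) (by
        rw [pot_plain R (by omega) (by omega), pot_right R (by omega)]
        unfold cyc; omega)]
    norm_num
  have := four_gaps_le (i := 1) (j := q) hq hR (by omega) le_rfl (by omega)
  linarith

lemma sum_gaps_four {R q : ℕ} (hq : 4 ≤ q) (hD : 2 * (q - 2) + 4 ≤ R) :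
    24 ≤ ∑ k ∈ range R, DoubleCycle.gap_energy R 2 q k := by
  have h0 := inner_energy hq (by omega) (by omega : 2 * (q - 2) ≤ R)
  have h1 : DoubleCycle.gap_energy R 2 q 0 = 4 := by
    rw [gap_energy_eq (j := 1) (a := 1) (b := 1) (δ := -2) (nxt_of_ne (by omega))
      (mult_plain (by omega) (by omega)) (mult_plain (by omega) (by omega)) (by
        rw [pot_plain R (by omega) (by omega), pot_plain R (by omega) (by omega)]
        unfold cyc; omega)]
    norm_num
  have h2 : DoubleCycle.gap_energy R 2 q (q + 1) = 4 := by
    rw [gap_energy_eq (j := q + 2) (a := 1) (b := 1) (δ := 2) (nxt_of_ne (by omega))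
      (mult_plain (by omega) (by omega)) (mult_plain (by omega) (by omega)) (by
        rw [pot_plain R (by omega) (by omega), pot_plain R (by omega) (by omega)]
        unfold cyc; omega)]
    norm_num
  have := four_gaps_le (i := 0) (j := q + 1) hq (by omega) (by omega) (by omega)
    (by omega : q + 1 < R)
  linarith

lemma sum_gaps_two {R q : ℕ} (hq : 4 ≤ q) (hD : 2 * (q - 2) + 2 = R) :
    ∑ k ∈ range R, DoubleCycle.gap_energy R 2 q k = 16 := by
  have h0 := inner_energy hq (by omega) (by omega : 2 * (q - 2) ≤ R)
  have key : ∀ k ∈ range R, DoubleCycle.gap_energy R 2 q k =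
      (if k = 2 then 8 else 0) + if k = q - 1 then 8 else 0 := by
    intro k hk
    rw [mem_range] at hk
    split_ifs with h1 h2 h2
    · omega
    · rw [h1, h0.1, add_zero]
    · rw [h2, h0.2, zero_add]
    · rw [gap_energy_eq (δ := 0) rfl rfl rfl (by
        rw [pot_nxt_eq hq (by omega) h1 (by omega) hk (by omega), add_zero])]
      norm_num
  rw [sum_congr rfl key, sum_add_distrib, sum_ite_eq', sum_ite_eq',
    if_pos (mem_range.2 (by omega)), if_pos (mem_range.2 (by omega))]
  norm_num

lemma sum_gaps_three {R q : ℕ} (hq : 4 ≤ q) (hD : 2 * (q - 2) + 3 = R) :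
    ∑ k ∈ range R, DoubleCycle.gap_energy R 2 q k = 18 := by
  have h0 := inner_energy hq (by omega) (by omega : 2 * (q - 2) ≤ R)
  have h1 : DoubleCycle.gap_energy R 2 q 0 = 1 := by
    rw [gap_energy_eq (j := 1) (a := 1) (b := 1) (δ := -1) (nxt_of_ne (by omega))
      (mult_plain (by omega) (by omega)) (mult_plain (by omega) (by omega)) (by
        rw [pot_plain R (by omega) (by omega), pot_plain R (by omega) (by omega)]
        unfold cyc; omega)]
    norm_num
  have h2 : DoubleCycle.gap_energy R 2 q (q + 1) = 1 := by
    rw [gap_energy_eq (j := q + 2) (a := 1) (b := 1) (δ := 1) (nxt_of_ne (by omega))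
      (mult_plain (by omega) (by omega)) (mult_plain (by omega) (by omega)) (by
        rw [pot_plain R (by omega) (by omega), pot_plain R (by omega) (by omega)]
        unfold cyc; omega)]
    norm_num
  have key : ∀ k ∈ range R, DoubleCycle.gap_energy R 2 q k =
      (if k = 2 then 8 else 0) + (if k = q - 1 then 8 else 0) + (if k = 0 then 1 else 0) +
        if k = q + 1 then 1 else 0 := by
    intro k hk
    rw [mem_range] at hk
    by_cases k2 : k = 2
    · rw [k2, h0.1, if_pos rfl, if_neg (by omega), if_neg (by omega), if_neg (by omega)]; rfl
    by_cases kq : k = q - 1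
    · rw [kq, h0.2, if_pos rfl, if_neg (by omega), if_neg (by omega), if_neg (by omega)]; rfl
    by_cases k0 : k = 0
    · rw [k0, h1, if_pos rfl, if_neg (by omega), if_neg (by omega), if_neg (by omega)]; rfl
    by_cases kq' : k = q + 1
    · rw [kq', h2, if_pos rfl, if_neg (by omega), if_neg (by omega), if_neg (by omega)]; rfl
    rw [if_neg k2, if_neg kq, if_neg k0, if_neg kq', gap_energy_eq (δ := 0) rfl rfl rfl (by
      rw [pot_nxt_eq hq (by omega) k2 (by omega) hk (Or.inr ⟨hD, k0, kq'⟩), add_zero])]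
    norm_num
  rw [sum_congr rfl key]
  simp only [sum_add_distrib, sum_ite_eq']
  rw [if_pos (mem_range.2 (by omega)), if_pos (mem_range.2 (by omega)),
    if_pos (mem_range.2 (by omega)), if_pos (mem_range.2 (by omega))]
  norm_num

/-- The position on the cycle `0, …, R - 1` of the vertex coded by `i`: the codes `R` and `R + 1`
stand for the second vertices at the doubled positions `2` and `q`. -/
def pos (R q i : ℕ) : ℕ := if i = R then 2 else if i = R + 1 then q else i

/-- The codes along the path of length two from `3` to `1` through `m`. -/
def pathQ (m k : ℕ) : ℕ := if k = 0 then 3 else if k = 1 then m else 1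

/-- The codes along the path of length two from `q - 1` to `q + 1` through `m`. -/
def pathR (q m k : ℕ) : ℕ := if k = 0 then q - 1 else if k = 1 then m else q + 1

/-- The codes along the path from `3` to `q - 1`. -/
def pathS (k : ℕ) : ℕ := 3 + k

/-- The codes along the path from `1` through `0` to `q + 1`. -/
def pathT (R k : ℕ) : ℕ := if k ≤ 1 then 1 - k else R + 1 - k

/-- The codes `i` and `j` are consecutive on the path `t` of length `len`. -/
def Cons (t : ℕ → ℕ) (len i j : ℕ) : Prop :=
  ∃ k < len, (i = t k ∧ j = t (k + 1)) ∨ (i = t (k + 1) ∧ j = t k)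

lemma cons_two (t : ℕ → ℕ) (i j : ℕ) : Cons t 2 i j ↔
    ((i = t 0 ∧ j = t 1) ∨ (i = t 1 ∧ j = t 0)) ∨ ((i = t 1 ∧ j = t 2) ∨ (i = t 2 ∧ j = t 1)) := by
  constructor
  · rintro ⟨k, hk, h⟩
    interval_cases k
    · exact Or.inl h
    · exact Or.inr h
  · rintro (h | h)
    · exact ⟨0, by omega, h⟩
    · exact ⟨1, by omega, h⟩

lemma cons_pathS (len i j : ℕ) : Cons pathS len i j ↔
    (3 ≤ i ∧ i < 3 + len ∧ j = i + 1) ∨ (3 ≤ j ∧ j < 3 + len ∧ i = j + 1) := by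
  unfold Cons pathS
  constructor
  · rintro ⟨k, hk, h⟩
    omega
  · rintro (h | h)
    · exact ⟨i - 3, by omega, by omega⟩
    · exact ⟨j - 3, by omega, by omega⟩

lemma cons_pathT {R q : ℕ} (hR : q + 2 ≤ R) (i j : ℕ) : Cons (pathT R) (R - q) i j ↔
    (i = 0 ∧ j = 1) ∨ (i = 1 ∧ j = 0) ∨ (i = 0 ∧ j + 1 = R) ∨ (i + 1 = R ∧ j = 0) ∨
    (q + 1 ≤ i ∧ j = i + 1 ∧ j < R) ∨ (q + 1 ≤ j ∧ i = j + 1 ∧ i < R) := by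
  constructor
  · rintro ⟨k, hk, h⟩
    revert h
    unfold pathT
    split_ifs <;> omega
  · intro h
    have key : (i + j = 1) ∨ (i + j + 1 = R ∧ (i = 0 ∨ j = 0)) ∨
        (q + 1 ≤ i ∧ j = i + 1 ∧ j < R) ∨ (q + 1 ≤ j ∧ i = j + 1 ∧ i < R) := by omega
    rcases key with h' | h' | h' | h'
    · exact ⟨0, by omega, by unfold pathT; split_ifs <;> omega⟩
    · exact ⟨1, by omega, by unfold pathT; split_ifs <;> omega⟩
    · exact ⟨R - i, by omega, by unfold pathT; split_ifs <;> omega⟩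
    · exact ⟨R - j, by omega, by unfold pathT; split_ifs <;> omega⟩

lemma cons_comm {t : ℕ → ℕ} {len i j : ℕ} : Cons t len i j ↔ Cons t len j i := by
  unfold Cons
  refine exists_congr fun k => and_congr_right fun _ => ?_
  tauto

lemma cycAdj_pos_of_cons {R q i j : ℕ} (hq : 5 ≤ q) (hR : q + 2 ≤ R)
    (h : Cons (pathQ 2) 2 i j ∨ Cons (pathQ R) 2 i j ∨ Cons (pathR q q) 2 i j ∨
      Cons (pathR q (R + 1)) 2 i j ∨ Cons pathS (q - 4) i j ∨ Cons (pathT R) (R - q) i j) :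
    CycAdj R (pos R q i) (pos R q j) := by
  simp only [cons_two, cons_pathS, cons_pathT hR, pathQ, pathR, if_true, one_ne_zero,
    if_false, OfNat.ofNat_ne_zero, OfNat.ofNat_ne_one] at h
  unfold CycAdj
  rcases h with h | h | h | h | h | h
  · have h1 : pos R q 2 = 2 := by rw [pos, if_neg, if_neg] <;> omega
    have h2 : pos R q 1 = 1 := by rw [pos, if_neg, if_neg] <;> omega
    have h3 : pos R q 3 = 3 := by rw [pos, if_neg, if_neg] <;> omega
    rcases h with (⟨rfl, rfl⟩ | ⟨rfl, rfl⟩) | ⟨rfl, rfl⟩ | ⟨rfl, rfl⟩ <;> omega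
  · have h1 : pos R q R = 2 := by rw [pos, if_pos rfl]
    have h2 : pos R q 1 = 1 := by rw [pos, if_neg, if_neg] <;> omega
    have h3 : pos R q 3 = 3 := by rw [pos, if_neg, if_neg] <;> omega
    rcases h with (⟨rfl, rfl⟩ | ⟨rfl, rfl⟩) | ⟨rfl, rfl⟩ | ⟨rfl, rfl⟩ <;> omega
  · have h1 : pos R q q = q := by rw [pos, if_neg, if_neg] <;> omega
    have h2 : pos R q (q - 1) = q - 1 := by rw [pos, if_neg, if_neg] <;> omega
    have h3 : pos R q (q + 1) = q + 1 := by rw [pos, if_neg, if_neg] <;> omega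
    rcases h with (⟨rfl, rfl⟩ | ⟨rfl, rfl⟩) | ⟨rfl, rfl⟩ | ⟨rfl, rfl⟩ <;> omega
  · have h1 : pos R q (R + 1) = q := by rw [pos, if_neg, if_pos rfl]; omega
    have h2 : pos R q (q - 1) = q - 1 := by rw [pos, if_neg, if_neg] <;> omega
    have h3 : pos R q (q + 1) = q + 1 := by rw [pos, if_neg, if_neg] <;> omega
    rcases h with (⟨rfl, rfl⟩ | ⟨rfl, rfl⟩) | ⟨rfl, rfl⟩ | ⟨rfl, rfl⟩ <;> omega
  all_goals
    have h1 : pos R q i = i := by rw [pos, if_neg, if_neg] <;> omega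
    have h2 : pos R q j = j := by rw [pos, if_neg, if_neg] <;> omega
    omega

lemma cons_of_next {R q i j : ℕ} (hq : 5 ≤ q) (hR : q + 2 ≤ R)
    (h : (i + 1 = j ∧ j < R) ∨ (i + 1 = R ∧ j = 0) ∨ (i = R ∧ (j = 1 ∨ j = 3)) ∨
      (i = R + 1 ∧ (j = q - 1 ∨ j = q + 1))) :
    Cons (pathQ 2) 2 i j ∨ Cons (pathQ R) 2 i j ∨ Cons (pathR q q) 2 i j ∨
    Cons (pathR q (R + 1)) 2 i j ∨ Cons pathS (q - 4) i j ∨ Cons (pathT R) (R - q) i j := by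
  simp only [cons_two, cons_pathS, cons_pathT hR, pathQ, pathR, if_true, one_ne_zero,
    if_false, OfNat.ofNat_ne_zero, OfNat.ofNat_ne_one]
  rcases h with ⟨rfl, h⟩ | ⟨h, rfl⟩ | ⟨rfl, h⟩ | ⟨rfl, h⟩
  · by_cases h0 : i = 0 ∨ q + 1 ≤ i
    · right; right; right; right; right; omega
    by_cases h3 : i < 3
    · left; omega
    by_cases h4 : i < q - 1
    · right; right; right; right; left; omega
    · right; right; left; omega
  · right; right; right; right; right; omega
  · right; left; omega
  · right; right; right; left; omega

lemma cycAdj_pos_iff {R q i j : ℕ} (hq : 5 ≤ q) (hR : q + 2 ≤ R) (hi : i < R + 2)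
    (hj : j < R + 2) : CycAdj R (pos R q i) (pos R q j) ↔
    Cons (pathQ 2) 2 i j ∨ Cons (pathQ R) 2 i j ∨ Cons (pathR q q) 2 i j ∨
    Cons (pathR q (R + 1)) 2 i j ∨ Cons pathS (q - 4) i j ∨ Cons (pathT R) (R - q) i j := by
  refine ⟨fun h => ?_, cycAdj_pos_of_cons hq hR⟩
  have key : ((i + 1 = j ∧ j < R) ∨ (i + 1 = R ∧ j = 0) ∨ (i = R ∧ (j = 1 ∨ j = 3)) ∨
      (i = R + 1 ∧ (j = q - 1 ∨ j = q + 1))) ∨ ((j + 1 = i ∧ i < R) ∨ (j + 1 = R ∧ i = 0) ∨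
      (j = R ∧ (i = 1 ∨ i = 3)) ∨ (j = R + 1 ∧ (i = q - 1 ∨ i = q + 1))) := by
    unfold CycAdj at h
    have hp : ∀ k < R + 2, (k = R ∧ pos R q k = 2) ∨ (k = R + 1 ∧ pos R q k = q) ∨
        (k < R ∧ pos R q k = k) := fun k hk => by
      unfold pos
      split_ifs <;> omega
    rcases hp i hi with ⟨e, e'⟩ | ⟨e, e'⟩ | ⟨e, e'⟩ <;>
      rcases hp j hj with ⟨f, f'⟩ | ⟨f, f'⟩ | ⟨f, f'⟩ <;> rw [e', f'] at h
    · omega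
    · omega
    · left; right; right; left; omega
    · omega
    · omega
    · left; right; right; right; omega
    · right; right; right; left; omega
    · right; right; right; right; omega
    · rcases h with h | h | h | h
      · left; left; omega
      · right; left; omega
      · right; right; left; omega
      · left; right; left; omega
  rcases key with h | h
  · exact cons_of_next hq hR h
  · have := cons_of_next hq hR h
    simpa only [cons_comm (i := j)] using this

/-- A labelling `g` of the vertices by the codes `0, …, R + 1`, with inverse `c`, for which
adjacency is adjacency of positions. -/
structure Coding {V : Type*} (G : SimpleGraph V) (R q : ℕ) (g : ℕ → V) (c : V → ℕ) : Prop where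
  lt : ∀ v, c v < R + 2
  code : ∀ i < R + 2, c (g i) = i
  vert : ∀ v, g (c v) = v
  adj : ∀ i < R + 2, ∀ j < R + 2, G.Adj (g i) (g j) ↔ CycAdj R (pos R q i) (pos R q j)

section
variable {V : Type*} [Fintype V] {G : SimpleGraph V} {R q : ℕ}

lemma DoubleCycle.exists_coding {φ : V → ℕ} (h : DoubleCycle G R 2 q φ) :
    ∃ g c, Coding G R q g c := by
  have h1 := h.gap
  have h2 := h.le_R
  obtain ⟨y₀⟩ : Nonempty V := Fintype.card_pos_iff.1 (by rw [h.card_eq]; omega)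
  have hσ : ∀ i, ∃ y, i < R → φ y = i := fun i => by
    by_cases hi : i < R
    · obtain ⟨y, hy⟩ := h.exists_pos hi
      exact ⟨y, fun _ => hy⟩
    · exact ⟨y₀, fun h => absurd h hi⟩
  choose σ hσ using hσ
  have second : ∀ i < R, (univ.filter fun y => φ y = i).card = 2 →
      ∃ y, y ≠ σ i ∧ φ y = i ∧ ∀ z, φ z = i → z = y ∨ z = σ i := fun i hi hcard => by
    obtain ⟨a, b, hab, hS⟩ := card_eq_two.1 hcard
    have hmem : ∀ z, φ z = i ↔ z = a ∨ z = b := fun z => by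
      have : z ∈ univ.filter (fun y => φ y = i) ↔ z ∈ ({a, b} : Finset V) := by rw [hS]
      simpa using this
    rcases (hmem (σ i)).1 (hσ i hi) with h | h
    · exact ⟨b, by rw [h]; exact hab.symm, (hmem b).2 (Or.inr rfl), fun z hz => by
        rw [h]; exact ((hmem z).1 hz).symm⟩
    · exact ⟨a, by rw [h]; exact hab, (hmem a).2 (Or.inl rfl), fun z hz => by
        rw [h]; exact (hmem z).1 hz⟩
  obtain ⟨y₁, hy₁, hφ₁, hu₁⟩ := second 2 (by omega)
    (by rw [h.fib 2 (by omega), if_pos rfl, if_neg (by omega)])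
  obtain ⟨y₂, hy₂, hφ₂, hu₂⟩ := second q (by omega)
    (by rw [h.fib q (by omega), if_neg (by omega), if_pos rfl])
  have h12 : y₂ ≠ y₁ := fun e => by rw [e] at hφ₂; omega
  have single : ∀ i < R, i ≠ 2 → i ≠ q → ∀ z, φ z = i → z = σ i := fun i hi hi2 hiq z hz => by
    have hcard := h.fib i hi
    rw [if_neg hi2, if_neg hiq] at hcard
    obtain ⟨a, ha⟩ := card_eq_one.1 hcard
    have hmem : ∀ z, φ z = i → z = a := fun z hz => by
      have : z ∈ univ.filter (fun y => φ y = i) := by simpa using hz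
      rw [ha] at this
      simpa using this
    rw [hmem z hz, hmem _ (hσ i hi)]
  set g : ℕ → V := fun i => if i = R then y₁ else if i = R + 1 then y₂ else σ i with hg
  have hφg : ∀ i < R + 2, φ (g i) = pos R q i := fun i hi => by
    simp only [hg, pos]
    split_ifs with h3 h4
    · exact hφ₁
    · exact hφ₂
    · exact hσ i (by omega)
  refine ⟨g, fun v => if v = y₁ then R else if v = y₂ then R + 1 else φ v, fun v => ?_,
    fun i hi => ?_, fun v => ?_, fun i hi j hj => by rw [h.adj, hφg i hi, hφg j hj]⟩
  · have := h.lt v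
    split_ifs <;> omega
  · simp only [hg]
    by_cases h3 : i = R
    · simp [h3]
    by_cases h4 : i = R + 1
    · simp [h4, h12]
    have hiR : i < R := by omega
    rw [if_neg h3, if_neg h4, if_neg, if_neg, hσ i hiR]
    · intro e
      have := hσ i hiR
      rw [e, hφ₂] at this
      subst this
      exact hy₂ e.symm
    · intro e
      have := hσ i hiR
      rw [e, hφ₁] at this
      subst this
      exact hy₁ e.symm
  · have hv := h.lt v
    by_cases h3 : v = y₁
    · simp [hg, h3]
    by_cases h4 : v = y₂
    · simp [hg, h4, h12]
    rw [if_neg h3, if_neg h4]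
    simp only [hg]
    rw [if_neg (by omega), if_neg (by omega)]
    by_cases h5 : φ v = 2
    · rw [h5]; exact ((hu₁ v h5).resolve_left h3).symm
    by_cases h6 : φ v = q
    · rw [h6]; exact ((hu₂ v h6).resolve_left h4).symm
    exact (single _ hv h5 h6 v rfl).symm

lemma Coding.doubleCycle {g : ℕ → V} {c : V → ℕ} (h : Coding G R q g c) (hq : 4 ≤ q)
    (hR : q + 2 ≤ R) : DoubleCycle G R 2 q (fun v => pos R q (c v)) where
  lt v := by
    have := h.lt v
    unfold pos
    split_ifs <;> omega
  adj y z := by rw [← h.adj _ (h.lt y) _ (h.lt z), h.vert, h.vert]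
  fib i hi := by
    have e : (univ.filter fun y => pos R q (c y) = i).card =
        ((range (R + 2)).filter fun k => pos R q k = i).card := by
      refine card_bij' (fun y _ => c y) (fun k _ => g k) (fun y hy => ?_) (fun k hk => ?_)
        (fun y _ => h.vert y) (fun k hk => ?_)
      · simpa [h.lt y] using hy
      · simp only [mem_filter, mem_range] at hk
        simpa [h.code k hk.1] using hk.2
      · simp only [mem_filter, mem_range] at hk
        exact h.code k hk.1
    have e2 : ((range R).filter fun k => pos R q k = i) = {i} := by
      ext k
      simp only [mem_filter, mem_range, mem_singleton]
      constructor
      · rintro ⟨hk, rfl⟩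
        rw [pos, if_neg (by omega), if_neg (by omega)]
      · rintro rfl
        exact ⟨hi, by rw [pos, if_neg (by omega), if_neg (by omega)]⟩
    rw [e, card_filter, sum_range_succ, sum_range_succ, ← card_filter, e2, card_singleton]
    have hp : pos R q R = 2 := by rw [pos, if_pos rfl]
    have hp' : pos R q (R + 1) = q := by rw [pos, if_neg, if_pos rfl]; omega
    simp only [hp, hp', eq_comm]
  two_le := le_rfl
  gap := hq
  le_R := hR

end

section
variable {V : Type*} {G : SimpleGraph V} {R q : ℕ} {g : ℕ → V} {c : V → ℕ}

lemma exists_walk_getVert (f : ℕ → V) : ∀ k : ℕ, (∀ i < k, G.Adj (f i) (f (i + 1))) →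
    ∃ P : G.Walk (f 0) (f k), P.length = k ∧ ∀ i ≤ k, P.getVert i = f i := by
  intro k
  induction k generalizing f with
  | zero => exact fun _ => ⟨.nil, rfl, fun i hi => by rw [Nat.le_zero.1 hi]; rfl⟩
  | succ k ih =>
    intro h
    obtain ⟨P, hP, hf⟩ := ih (fun i => f (i + 1)) fun i hi => h (i + 1) (by omega)
    refine ⟨.cons (h 0 (by omega)) P, by simp [hP], fun i hi => ?_⟩
    cases i with
    | zero => rfl
    | succ i =>
      rw [SimpleGraph.Walk.getVert_cons_succ]
      exact hf i (by omega)

lemma Coding.eq_iff (h : Coding G R q g c) {i : ℕ} (hi : i < R + 2) (v : V) :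
    v = g i ↔ c v = i :=
  ⟨fun e => by rw [e, h.code i hi], fun e => by rw [← e, h.vert]⟩

/-- A path of codes gives a path in the graph. -/
lemma Coding.exists_path (h : Coding G R q g c) {t : ℕ → ℕ} {len : ℕ}
    (ht : ∀ k ≤ len, t k < R + 2) (hinj : ∀ k ≤ len, ∀ l ≤ len, t k = t l → k = l)
    (hadj : ∀ i j, Cons t len i j → CycAdj R (pos R q i) (pos R q j)) {a b : ℕ}
    (ha : t 0 = a) (hb : t len = b) :
    ∃ P : G.Walk (g a) (g b), P.IsPath ∧ P.length = len ∧
      (∀ v, v ∈ P.support ↔ ∃ k ≤ len, c v = t k) ∧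
      ∀ u v, Cons t len (c u) (c v) → s(u, v) ∈ P.edges := by
  obtain ⟨P, hP, hf⟩ := exists_walk_getVert (G := G) (fun k => g (t k)) len fun k hk =>
    (h.adj _ (ht k hk.le) _ (ht (k + 1) hk)).2 (hadj _ _ ⟨k, hk, Or.inl ⟨rfl, rfl⟩⟩)
  subst ha hb
  refine ⟨P, ?_, hP, fun v => ?_, fun u v => ?_⟩
  · rw [← SimpleGraph.Walk.IsPath.getVert_injOn_iff]
    intro k hk l hl e
    simp only [Set.mem_ofPred_eq, hP] at hk hl
    rw [hf k hk, hf l hl, h.eq_iff (ht l hl), h.code _ (ht k hk)] at e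
    exact hinj k hk l hl e
  · rw [SimpleGraph.Walk.mem_support_iff_exists_getVert]
    refine ⟨fun ⟨k, hk, hl⟩ => ?_, fun ⟨k, hl, hk⟩ => ⟨k, ?_, by omega⟩⟩
    · rw [hP] at hl
      rw [hf k hl] at hk
      exact ⟨k, hl, (h.eq_iff (ht k hl) v).1 hk.symm⟩
    · rw [hf k hl]
      exact ((h.eq_iff (ht k hl) v).2 hk).symm
  · rintro ⟨k, hk, e⟩
    rw [SimpleGraph.Walk.mk_mem_edges_iff_exists]
    refine ⟨k, by omega, ?_⟩
    rw [hf k hk.le, hf (k + 1) hk, Sym2.eq_iff]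
    rcases e with ⟨e, e'⟩ | ⟨e, e'⟩ <;> rw [← e, ← e', h.vert, h.vert] <;> simp

lemma Coding.theta3 (h : Coding G R q g c) (hq : 5 ≤ q) (hR : q + 2 ≤ R) :
    ∃ (w y x z : V) (Q₁ Q₂ : G.Walk w y) (R₁ R₂ : G.Walk x z) (S : G.Walk w x)
      (T : G.Walk y z), Theta3Cond G w y x z Q₁ Q₂ R₁ R₂ S T ∧
      Q₁.length = 2 ∧ Q₂.length = 2 ∧ R₁.length = 2 ∧ R₂.length = 2 ∧
      S.length = q - 4 ∧ T.length = R - q := by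
  have hQ : ∀ m, (m = 2 ∨ m = R) →
      (∀ i j, Cons (pathQ m) 2 i j → CycAdj R (pos R q i) (pos R q j)) →
      ∃ P : G.Walk (g 3) (g 1), P.IsPath ∧ P.length = 2 ∧
      (∀ v, v ∈ P.support ↔ c v = 3 ∨ c v = m ∨ c v = 1) ∧
      ∀ u v, Cons (pathQ m) 2 (c u) (c v) → s(u, v) ∈ P.edges := fun m hm hadj => by
    obtain ⟨P, h1, h2, h3, h4⟩ := h.exists_path (t := pathQ m) (len := 2)
      (fun k hk => by unfold pathQ; split_ifs <;> omega)
      (fun k hk l hl => by unfold pathQ; split_ifs <;> omega) hadj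
      (a := 3) (b := 1) rfl rfl
    refine ⟨P, h1, h2, fun v => ?_, h4⟩
    rw [h3]
    refine ⟨fun ⟨k, hk, e⟩ => ?_, fun e => ?_⟩
    · rw [e]
      unfold pathQ
      split_ifs <;> simp
    · rcases e with e | e | e
      · exact ⟨0, by omega, e⟩
      · exact ⟨1, by omega, e⟩
      · exact ⟨2, le_rfl, e⟩
  have hR' : ∀ m, (m = q ∨ m = R + 1) →
      (∀ i j, Cons (pathR q m) 2 i j → CycAdj R (pos R q i) (pos R q j)) →
      ∃ P : G.Walk (g (q - 1)) (g (q + 1)), P.IsPath ∧ P.length = 2 ∧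
      (∀ v, v ∈ P.support ↔ c v = q - 1 ∨ c v = m ∨ c v = q + 1) ∧
      ∀ u v, Cons (pathR q m) 2 (c u) (c v) → s(u, v) ∈ P.edges := fun m hm hadj => by
    obtain ⟨P, h1, h2, h3, h4⟩ := h.exists_path (t := pathR q m) (len := 2)
      (fun k hk => by unfold pathR; split_ifs <;> omega)
      (fun k hk l hl => by unfold pathR; split_ifs <;> omega) hadj
      (a := q - 1) (b := q + 1) rfl rfl
    refine ⟨P, h1, h2, fun v => ?_, h4⟩
    rw [h3]
    refine ⟨fun ⟨k, hk, e⟩ => ?_, fun e => ?_⟩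
    · rw [e]
      unfold pathR
      split_ifs <;> simp
    · rcases e with e | e | e
      · exact ⟨0, by omega, e⟩
      · exact ⟨1, by omega, e⟩
      · exact ⟨2, le_rfl, e⟩
  obtain ⟨Q₁, q₁, lq₁, sq₁, eq₁⟩ := hQ 2 (Or.inl rfl) fun i j hc =>
    cycAdj_pos_of_cons hq hR (Or.inl hc)
  obtain ⟨Q₂, q₂, lq₂, sq₂, eq₂⟩ := hQ R (Or.inr rfl) fun i j hc =>
    cycAdj_pos_of_cons hq hR (Or.inr (Or.inl hc))
  obtain ⟨R₁, r₁, lr₁, sr₁, er₁⟩ := hR' q (Or.inl rfl) fun i j hc =>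
    cycAdj_pos_of_cons hq hR (Or.inr (Or.inr (Or.inl hc)))
  obtain ⟨R₂, r₂, lr₂, sr₂, er₂⟩ := hR' (R + 1) (Or.inr rfl) fun i j hc =>
    cycAdj_pos_of_cons hq hR (Or.inr (Or.inr (Or.inr (Or.inl hc))))
  obtain ⟨S, s₁, ls, ss', es⟩ := h.exists_path (t := pathS) (len := q - 4)
    (fun k hk => by unfold pathS; omega) (fun k hk l hl => by unfold pathS; omega)
    (fun i j hc => cycAdj_pos_of_cons hq hR (Or.inr (Or.inr (Or.inr (Or.inr (Or.inl hc))))))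
    (a := 3) (b := q - 1) rfl (by unfold pathS; omega)
  obtain ⟨T, t₁, lt, st', et⟩ := h.exists_path (t := pathT R) (len := R - q)
    (fun k hk => by unfold pathT; split_ifs <;> omega)
    (fun k hk l hl => by unfold pathT; split_ifs <;> omega)
    (fun i j hc => cycAdj_pos_of_cons hq hR (Or.inr (Or.inr (Or.inr (Or.inr (Or.inr hc))))))
    (a := 1) (b := q + 1) rfl (by unfold pathT; split_ifs <;> omega)
  have ss : ∀ v, v ∈ S.support ↔ 3 ≤ c v ∧ c v ≤ q - 1 := fun v => by
    rw [ss']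
    unfold pathS
    exact ⟨fun ⟨k, hk, e⟩ => by omega, fun e => ⟨c v - 3, by omega, by omega⟩⟩
  have st : ∀ v, v ∈ T.support ↔ c v ≤ 1 ∨ (q + 1 ≤ c v ∧ c v < R) := fun v => by
    rw [st']
    unfold pathT
    refine ⟨fun ⟨k, hk, e⟩ => by split_ifs at e <;> omega, fun e => ?_⟩
    by_cases h1 : c v ≤ 1
    · exact ⟨1 - c v, by omega, by rw [if_pos (by omega)]; omega⟩
    · exact ⟨R + 1 - c v, by omega, by rw [if_neg (by omega)]; omega⟩
  have ne : ∀ i < R + 2, ∀ j < R + 2, i ≠ j → g i ≠ g j := fun i hi j hj hij e => by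
    rw [h.eq_iff hj, h.code i hi] at e
    exact hij e
  refine ⟨g 3, g 1, g (q - 1), g (q + 1), Q₁, Q₂, R₁, R₂, S, T, ⟨ne _ (by omega) _ (by omega)
    (by omega), ?_, ne _ (by omega) _ (by omega) (by omega), ne _ (by omega) _ (by omega)
    (by omega), ne _ (by omega) _ (by omega) (by omega), ne _ (by omega) _ (by omega) (by omega),
    q₁, q₂, r₁, r₂, s₁, t₁, fun e => ?_, fun e => ?_, ?_, ?_, ?_, ?_, ?_, ?_, ?_, ?_, ?_, ?_, ?_,
    ?_, ?_, ?_, ?_, fun v => ?_, fun e he => ?_⟩, lq₁, lq₂, lr₁, lr₂, ls, lt⟩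
  · exact ne _ (by omega) _ (by omega) (by omega)
  · have h1 := (sq₁ (g 2)).2 (Or.inr (Or.inl (h.code 2 (by omega))))
    rw [e, sq₂, h.code 2 (by omega)] at h1
    omega
  · have h1 := (sr₁ (g q)).2 (Or.inr (Or.inl (h.code q (by omega))))
    rw [e, sr₂, h.code q (by omega)] at h1
    omega
  iterate 15
    · intro v
      simp only [sq₁, sq₂, sr₁, sr₂, ss, st, h.eq_iff (show 3 < R + 2 by omega),
        h.eq_iff (show 1 < R + 2 by omega), h.eq_iff (show q - 1 < R + 2 by omega),
        h.eq_iff (show q + 1 < R + 2 by omega)]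
      omega
  · have := h.lt v
    rw [sq₁, sq₂, sr₁, sr₂, ss, st]
    omega
  · induction e with
    | h u v =>
      rw [SimpleGraph.mem_edgeSet, ← h.vert u, ← h.vert v, h.adj _ (h.lt u) _ (h.lt v),
        cycAdj_pos_iff hq hR (h.lt u) (h.lt v)] at he
      rcases he with he | he | he | he | he | he
      · exact Or.inl (eq₁ _ _ he)
      · exact Or.inr (Or.inl (eq₂ _ _ he))
      · exact Or.inr (Or.inr (Or.inl (er₁ _ _ he)))
      · exact Or.inr (Or.inr (Or.inr (Or.inl (er₂ _ _ he))))
      · exact Or.inr (Or.inr (Or.inr (Or.inr (Or.inl (es _ _ he)))))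
      · exact Or.inr (Or.inr (Or.inr (Or.inr (Or.inr (et _ _ he)))))

end

section
variable {V : Type*} {G : SimpleGraph V} {R q : ℕ}

lemma cons_of_mem_edges {u v : V} {P : G.Walk u v} {g : ℕ → V} {t : ℕ → ℕ} {len i j : ℕ}
    (hl : P.length = len) (hg : ∀ k ≤ len, P.getVert k = g (t k)) (ht : ∀ k ≤ len, t k < R + 2)
    (hinj : ∀ i < R + 2, ∀ j < R + 2, g i = g j → i = j) (hi : i < R + 2) (hj : j < R + 2)
    (h : s(g i, g j) ∈ P.edges) : Cons t len i j := by
  rw [SimpleGraph.Walk.mk_mem_edges_iff_exists] at h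
  obtain ⟨k, hk, e⟩ := h
  rw [hl] at hk
  rw [hg k hk.le, hg (k + 1) hk, Sym2.eq_iff] at e
  refine ⟨k, hk, ?_⟩
  rcases e with ⟨e, e'⟩ | ⟨e, e'⟩
  · exact Or.inl ⟨(hinj _ (ht k hk.le) _ hi e).symm, (hinj _ (ht _ hk) _ hj e').symm⟩
  · exact Or.inr ⟨(hinj _ (ht _ hk) _ hi e').symm, (hinj _ (ht _ hk.le) _ hj e).symm⟩

lemma adj_of_cons {u v : V} {P : G.Walk u v} {g : ℕ → V} {t : ℕ → ℕ} {len i j : ℕ}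
    (hl : P.length = len) (hg : ∀ k ≤ len, P.getVert k = g (t k)) (h : Cons t len i j) :
    G.Adj (g i) (g j) := by
  obtain ⟨k, hk, h⟩ := h
  have := P.adj_getVert_succ (i := k) (by omega)
  rw [hg k hk.le, hg (k + 1) hk] at this
  rcases h with ⟨rfl, rfl⟩ | ⟨rfl, rfl⟩
  · exact this
  · exact this.symm

lemma exists_code_of_mem {u v x : V} {P : G.Walk u v} {g : ℕ → V} {t : ℕ → ℕ} {len : ℕ}
    (hl : P.length = len) (hg : ∀ k ≤ len, P.getVert k = g (t k)) (ht : ∀ k ≤ len, t k < R + 2)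
    (h : x ∈ P.support) : ∃ i < R + 2, g i = x := by
  obtain ⟨k, hk, hk'⟩ := SimpleGraph.Walk.mem_support_iff_exists_getVert.1 h
  exact ⟨t k, ht k (by omega), by rw [← hg k (by omega), hk]⟩

lemma exists_coding_of_theta3 [Fintype V] {w y x z : V} {Q₁ Q₂ : G.Walk w y} {R₁ R₂ : G.Walk x z}
    {S : G.Walk w x} {T : G.Walk y z} (h : Theta3Cond G w y x z Q₁ Q₂ R₁ R₂ S T)
    (hQ₁ : Q₁.length = 2) (hQ₂ : Q₂.length = 2) (hR₁ : R₁.length = 2) (hR₂ : R₂.length = 2)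
    (hS : S.length = q - 4) (hT : T.length = R - q) (hq : 5 ≤ q) (hR : q + 2 ≤ R)
    (hcard : Fintype.card V = R + 2) : ∃ g c, Coding G R q g c := by
  obtain ⟨-, -, -, -, -, -, -, -, -, -, -, -, -, -, -, -, -, -, -, -, -, -, -, -, -, -, -, -, -,
    hcov, hedge⟩ := h
  set g : ℕ → V := fun i => if i = 0 then T.getVert 1 else if i = 1 then y else
    if i = 2 then Q₁.getVert 1 else if i < q then S.getVert (i - 3) else
    if i = q then R₁.getVert 1 else if i < R then T.getVert (R + 1 - i) else
    if i = R then Q₂.getVert 1 else R₂.getVert 1 with hg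
  have g1 : g 1 = y := by simp [hg]
  have g3 : g 3 = w := by simp [hg, show 3 < q by omega]
  have gx : g (q - 1) = x := by
    simp only [hg]
    rw [if_neg (by omega), if_neg (by omega), if_neg (by omega), if_pos (by omega),
      show q - 1 - 3 = S.length by omega, SimpleGraph.Walk.getVert_length]
  have gz : g (q + 1) = z := by
    simp only [hg]
    rw [if_neg (by omega), if_neg (by omega), if_neg (by omega), if_neg (by omega),
      if_neg (by omega), if_pos (by omega), show R + 1 - (q + 1) = T.length by omega,
      SimpleGraph.Walk.getVert_length]
  have two : ∀ {u v : V} (P : G.Walk u v) (hl : P.length = 2) (t : ℕ → ℕ), g (t 0) = u →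
      g (t 1) = P.getVert 1 → g (t 2) = v → ∀ k ≤ 2, P.getVert k = g (t k) := by
    intro u v P hl t h0 h1 h2 k hk
    interval_cases k
    · rw [h0, SimpleGraph.Walk.getVert_zero]
    · exact h1.symm
    · rw [h2, ← hl, SimpleGraph.Walk.getVert_length]
  have vQ₁ := two Q₁ hQ₁ (pathQ 2) g3 (by simp [hg, pathQ]) g1
  have vQ₂ := two Q₂ hQ₂ (pathQ R) g3 (by
    simp only [hg, pathQ, if_true, one_ne_zero, if_false]
    rw [if_neg (by omega), if_neg (by omega), if_neg (by omega),
      if_neg (by omega), if_neg (by omega), if_neg (by omega)]) g1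
  have vR₁ := two R₁ hR₁ (pathR q q) gx (by
    simp only [hg, pathR, if_true, one_ne_zero, if_false]
    rw [if_neg (by omega), if_neg (by omega), if_neg (by omega),
      if_neg (by omega)]) gz
  have vR₂ := two R₂ hR₂ (pathR q (R + 1)) gx (by
    simp only [hg, pathR, if_true, one_ne_zero, if_false]
    rw [if_neg (by omega), if_neg (by omega), if_neg (by omega),
      if_neg (by omega), if_neg (by omega), if_neg (by omega), if_neg (by omega)]) gz
  have vS : ∀ k ≤ q - 4, S.getVert k = g (pathS k) := fun k hk => by
    simp only [hg, pathS]
    rw [if_neg (by omega), if_neg (by omega), if_neg (by omega), if_pos (by omega),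
      Nat.add_sub_cancel_left]
  have vT : ∀ k ≤ R - q, T.getVert k = g (pathT R k) := fun k hk => by
    by_cases h0 : k = 0
    · rw [h0, SimpleGraph.Walk.getVert_zero, ← g1, pathT, if_pos (Nat.zero_le 1)]
    by_cases h1 : k = 1
    · simp [hg, pathT, h1]
    · simp only [hg, pathT]
      rw [if_neg (show ¬ k ≤ 1 by omega), if_neg (by omega), if_neg (by omega), if_neg (by omega),
        if_neg (by omega), if_neg (by omega), if_pos (by omega)]
      congr 1
      omega
  have lQ : ∀ m < R + 2, ∀ k ≤ 2, pathQ m k < R + 2 := fun m hm k hk => by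
    unfold pathQ; split_ifs <;> omega
  have lR : ∀ m < R + 2, ∀ k ≤ 2, pathR q m k < R + 2 := fun m hm k hk => by
    unfold pathR; split_ifs <;> omega
  have lS : ∀ k ≤ q - 4, pathS k < R + 2 := fun k hk => by unfold pathS; omega
  have lT : ∀ k ≤ R - q, pathT R k < R + 2 := fun k hk => by unfold pathT; split_ifs <;> omega
  have hsurj : ∀ v, ∃ i < R + 2, g i = v := fun v => by
    rcases hcov v with h | h | h | h | h | h
    · exact exists_code_of_mem hQ₁ vQ₁ (lQ 2 (by omega)) h
    · exact exists_code_of_mem hQ₂ vQ₂ (lQ R (by omega)) h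
    · exact exists_code_of_mem hR₁ vR₁ (lR q (by omega)) h
    · exact exists_code_of_mem hR₂ vR₂ (lR (R + 1) (by omega)) h
    · exact exists_code_of_mem hS vS lS h
    · exact exists_code_of_mem hT vT lT h
  have hbij : Function.Bijective fun i : Fin (R + 2) => g i := by
    rw [Fintype.bijective_iff_surjective_and_card, Fintype.card_fin, hcard]
    refine ⟨fun v => ?_, rfl⟩
    obtain ⟨i, hi, e⟩ := hsurj v
    exact ⟨⟨i, hi⟩, e⟩
  have hinj : ∀ i < R + 2, ∀ j < R + 2, g i = g j → i = j := fun i hi j hj e =>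
    congrArg Fin.val (hbij.1 (a₁ := ⟨i, hi⟩) (a₂ := ⟨j, hj⟩) e)
  choose c hc hc' using hsurj
  refine ⟨g, c, hc, fun i hi => hinj _ (hc _) _ hi (hc' _), hc', fun i hi j hj => ?_⟩
  rw [cycAdj_pos_iff hq hR hi hj]
  constructor
  · intro h
    rcases hedge s(g i, g j) h with h | h | h | h | h | h
    · exact Or.inl (cons_of_mem_edges hQ₁ vQ₁ (lQ 2 (by omega)) hinj hi hj h)
    · exact Or.inr (Or.inl (cons_of_mem_edges hQ₂ vQ₂ (lQ R (by omega)) hinj hi hj h))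
    · exact Or.inr (Or.inr (Or.inl (cons_of_mem_edges hR₁ vR₁ (lR q (by omega)) hinj hi hj h)))
    · exact Or.inr (Or.inr (Or.inr (Or.inl
        (cons_of_mem_edges hR₂ vR₂ (lR (R + 1) (by omega)) hinj hi hj h))))
    · exact Or.inr (Or.inr (Or.inr (Or.inr (Or.inl (cons_of_mem_edges hS vS lS hinj hi hj h)))))
    · exact Or.inr (Or.inr (Or.inr (Or.inr (Or.inr (cons_of_mem_edges hT vT lT hinj hi hj h)))))
  · rintro (h | h | h | h | h | h)
    · exact adj_of_cons hQ₁ vQ₁ h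
    · exact adj_of_cons hQ₂ vQ₂ h
    · exact adj_of_cons hR₁ vR₁ h
    · exact adj_of_cons hR₂ vR₂ h
    · exact adj_of_cons hS vS h
    · exact adj_of_cons hT vT h

end

section
variable {V : Type*} [Fintype V] {G : SimpleGraph V} {R q : ℕ} {φ : V → ℕ}

/-- The graphs `F_n` are the cycles with two doubled vertices whose two arcs differ by two
(`n` even) or three (`n` odd). -/
lemma isFGraph_iff (hn : 29 ≤ Fintype.card V) : IsFGraph (Fintype.card V) G ↔
    ∃ R q φ, DoubleCycle G R 2 q φ ∧
      (2 * (q - 2) + 2 = R ∨ 2 * (q - 2) + 3 = R) := by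
  constructor
  · rintro ⟨a, b, ha, -, hab, hb, w, y, x, z, Q₁, Q₂, R₁, R₂, S, T, h, hQ₁, hQ₂, hR₁, hR₂, hS, hT⟩
    have hb' : b = a + 2 ∨ b = a + 3 := by
      split_ifs at hb
      · exact Or.inl hb
      · exact Or.inr hb
    obtain ⟨g, c, hgc⟩ := exists_coding_of_theta3 (q := a + 4) (R := a + b + 4) h hQ₁ hQ₂ hR₁ hR₂
      (by omega) (by omega) (by omega) (by omega) (by omega)
    exact ⟨_, _, _, hgc.doubleCycle (by omega) (by omega), by omega⟩
  · rintro ⟨R, q, φ, h, hD⟩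
    have hcard := h.card_eq
    have hgap := h.gap
    obtain ⟨g, c, hgc⟩ := h.exists_coding
    refine ⟨q - 4, R - q, by omega, by omega, by omega, ?_, hgc.theta3 (by omega) (by omega)⟩
    rw [hcard]
    split_ifs with hev
    · obtain ⟨k, hk⟩ := hev
      omega
    · rw [Nat.not_even_iff_odd] at hev
      obtain ⟨k, hk⟩ := hev
      omega

lemma energy_bound (hc : G.Connected) (he : G.edgeFinset.card = Fintype.card V + 2)
    (hn : 29 ≤ Fintype.card V) : (if Even (Fintype.card V) then 32 else 36) ≤ energy G ∧
      (energy G = (if Even (Fintype.card V) then 32 else 36) ↔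
        IsFGraph (Fintype.card V) G) := by
  have hF : IsFGraph (Fintype.card V) G →
      energy G = if Even (Fintype.card V) then 32 else 36 := by
    rw [isFGraph_iff hn]
    rintro ⟨R, q, φ, h, hD⟩
    have h1 := h.gap
    rw [h.card_eq, h.energy_eq hc]
    rcases hD with hD | hD
    · rw [if_pos ⟨q, by omega⟩, sum_gaps_two h1 hD, show (2 : ℤ) * 16 = 32 by norm_num]
    · rw [if_neg (Nat.not_even_iff_odd.2 ⟨q, by omega⟩), sum_gaps_three h1 hD,
        show (2 : ℤ) * 18 = 36 by norm_num]
  by_cases hs : energy G ≤ 36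
  · obtain ⟨R, p, q, φ, h⟩ := (Low.mk hc he hn hs).exists_doubleCycle
    obtain ⟨q, φ, h, hqR⟩ := h.normalize
    have h1 := h.gap
    have h2 := h.le_R
    have hcard := h.card_eq
    have hE := h.energy_eq hc
    have hcases : 2 * (q - 2) = R ∨ 2 * (q - 2) + 1 = R ∨ 2 * (q - 2) + 2 = R ∨
        2 * (q - 2) + 3 = R ∨ 2 * (q - 2) + 4 ≤ R := by omega
    rcases hcases with hD | hD | hD | hD | hD
    · have := sum_gaps_zero h1 h2 hD
      omega
    · have := sum_gaps_one h1 h2 hD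
      omega
    · have hF' := (isFGraph_iff hn).2 ⟨R, q, φ, h, Or.inl hD⟩
      exact ⟨(hF hF').ge, fun _ => hF', hF⟩
    · have hF' := (isFGraph_iff hn).2 ⟨R, q, φ, h, Or.inr hD⟩
      exact ⟨(hF hF').ge, fun _ => hF', hF⟩
    · have := sum_gaps_four h1 hD
      omega
  · have hle : (if Even (Fintype.card V) then 32 else 36 : ℤ) ≤ 36 := by split_ifs <;> norm_num
    exact ⟨by omega, fun h => absurd (h.trans_le hle) hs, hF⟩

end

end RevSz

/-- A connected tricyclic graph of order `n ≥ 29` has revised Szeged index at most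
`B(n)` (`(n³+2n²−16)/4` for even `n`, `(n³+2n²−18)/4` for odd `n`), with equality
iff `G` is isomorphic to `Fₙ`. -/
theorem revSz_tricyclic_le_with_equality {V : Type*} [Fintype V] (G : SimpleGraph V)
    (hconn : G.Connected) (htri : G.edgeFinset.card = Fintype.card V + 2)
    (hn : 29 ≤ Fintype.card V) :
    revSz G ≤ (if Even (Fintype.card V) then
        ((Fintype.card V : ℚ) ^ 3 + 2 * (Fintype.card V : ℚ) ^ 2 - 16) / 4
      else
        ((Fintype.card V : ℚ) ^ 3 + 2 * (Fintype.card V : ℚ) ^ 2 - 18) / 4) ∧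
    (revSz G = (if Even (Fintype.card V) then
        ((Fintype.card V : ℚ) ^ 3 + 2 * (Fintype.card V : ℚ) ^ 2 - 16) / 4
      else
        ((Fintype.card V : ℚ) ^ 3 + 2 * (Fintype.card V : ℚ) ^ 2 - 18) / 4)
      ↔ IsFGraph (Fintype.card V) G) := by
  obtain ⟨hle, heq⟩ : (if Even (Fintype.card V) then 32 else 36) ≤ RevSz.energy G ∧
      (RevSz.energy G = (if Even (Fintype.card V) then 32 else 36) ↔
        IsFGraph (Fintype.card V) G) := RevSz.energy_bound hconn htri hn
  have key := RevSz.revSz_eq hconn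
  rw [htri] at key
  push_cast at key
  rw [← heq]
  split_ifs at hle ⊢ with hev
  all_goals
    have hle' := (Int.cast_le (R := ℚ)).2 hle
    rw [← Int.cast_inj (α := ℚ)]
    push_cast at hle' ⊢
    exact ⟨by linarith, fun h => by linarith, fun h => by linarith⟩
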